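/- Let k ≥ 2 be an integer and let n ≥ m ≥ 0 be integers such that L_n^{(k)} · L_m^{(k)} is a repdigit with at least two digits (that is, equal to a·(10^d − 1)/9 for some d ≥ 2 and 1 ≤ a ≤ 9). Then (k, n, m) is one of (2,5,0), (2,5,1), (2,5,2), (2,5,3), (2,5,4), (4,5,0), (4,5,1), (4,5,2), and the corresponding products are 22, 11, 33, 44, 77, 44, 22, 66. -/

import Mathlib

/-- The `k`-generalized Lucas sequence: `L 0 = 2`, `L 1 = 1`, and for `n ≥ 2`,
`L n = L (n-1) + L (n-2) + ⋯ + L (n-k)`, where terms with negative index count as `0`. -/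
def lucasK (k : ℕ) : ℕ → ℕ
  | 0 => 2
  | 1 => 1
  | n + 2 => ∑ j ∈ Finset.range k, if _ : j ≤ n + 1 then lucasK k (n + 1 - j) else 0
termination_by n => n
decreasing_by omega

section

open Complex

/-- derivatives of `c + (z - a) q z` -/
lemma iterDeriv_linmul (q : ℂ → ℂ) (hq : Differentiable ℂ q) (a c : ℂ) (u : ℕ) :
    iteratedDeriv (u+1) (fun z => c + (z - a) * q z) =
      fun z => (z - a) * iteratedDeriv (u+1) q z + (u+1 : ℂ) * iteratedDeriv u q z := by
  have hd : ∀ u : ℕ, Differentiable ℂ (iteratedDeriv u q) := fun u =>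
    (hq.contDiff (n := ⊤)).differentiable_iteratedDeriv u (by exact WithTop.coe_lt_top _)
  induction u with
  | zero =>
    funext z
    rw [iteratedDeriv_succ, iteratedDeriv_zero, iteratedDeriv_succ, iteratedDeriv_zero]
    have h1 : HasDerivAt (fun z => c + (z - a) * q z) (1 * q z + (z - a) * deriv q z) z :=
      (((hasDerivAt_id z).sub_const a).mul (hq z).hasDerivAt).const_add c
    rw [h1.deriv]; push_cast; ring
  | succ u ih =>
    funext z
    rw [iteratedDeriv_succ, ih]
    have h1 : HasDerivAt (fun z => (z - a) * iteratedDeriv (u+1) q z + (u+1 : ℂ) * iteratedDeriv u q z)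
       ((1 * iteratedDeriv (u+1) q z + (z - a) * deriv (iteratedDeriv (u+1) q) z) +
        (u+1 : ℂ) * deriv (iteratedDeriv u q) z) z :=
      (((hasDerivAt_id z).sub_const a).mul (hd (u+1) z).hasDerivAt).add
        ((hd u z).hasDerivAt.const_mul _)
    rw [h1.deriv, ← iteratedDeriv_succ, ← iteratedDeriv_succ]; push_cast; ring

lemma newton_aux (S τ M : ℕ) (hM : S ≤ M) (hM1 : 1 ≤ M) :
    ∀ (N : ℕ) (f : ℂ → ℂ) (μ : ℕ → ℕ) (δ F : ℝ), Differentiable ℂ f → 0 ≤ δ → 0 ≤ F →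
      (∑ s ∈ Finset.range S, μ s = N) → (∀ s < S, μ s ≤ τ) →
      (∀ s < S, ∀ u < μ s, ‖iteratedDeriv u f s‖ ≤ δ * u.factorial) →
      (∀ z : ℂ, ‖z‖ ≤ 9 * M → ‖f z‖ ≤ F) →
      ∀ x : ℕ, x ≤ M → ‖f x‖ ≤ F / 8 ^ N + 2 * ((M * (τ + 2) + 1 : ℝ)) ^ N * δ := by
  intro N
  induction N with
  | zero =>
    intro f μ δ F _ hδ hF _ _ _ hb x hx
    have h1 : ‖f x‖ ≤ F := by
      apply hb
      rw [Complex.norm_natCast]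
      have : (x:ℝ) ≤ M := by exact_mod_cast hx
      linarith [(Nat.cast_nonneg M : (0:ℝ) ≤ M)]
    simp only [pow_zero, div_one]
    linarith
  | succ N ih =>
    intro f μ δ F hf hδ hF hsum hτ hj hb x hx
    have hMr : (1:ℝ) ≤ M := by exact_mod_cast hM1
    obtain ⟨a, haS, ha⟩ : ∃ a < S, 1 ≤ μ a := by
      by_contra hcon
      push Not at hcon
      have : ∑ s ∈ Finset.range S, μ s = 0 := by
        apply Finset.sum_eq_zero
        intro s hs
        have := hcon s (Finset.mem_range.mp hs)
        omega
      omega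
    set q := dslope f (a:ℂ) with hqdef
    have hq : Differentiable ℂ q := by
      have := (Complex.differentiableOn_dslope (f := f) (s := Set.univ) (c := (a:ℂ)) Filter.univ_mem).2
        hf.differentiableOn
      exact differentiableOn_univ.mp this
    have hfq : f = fun z => f a + (z - a) * q z := by
      funext z
      have := sub_smul_dslope f (a:ℂ) z
      rw [smul_eq_mul] at this
      rw [hqdef, this]; ring
    have hfa : ‖f a‖ ≤ δ := by
      have := hj a haS 0 (by omega)
      simpa using this
    have haM : (a:ℝ) ≤ M := by exact_mod_cast (by omega : a ≤ M)
    have hder : ∀ u : ℕ, ∀ z, iteratedDeriv (u+1) f z =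
        (z - a) * iteratedDeriv (u+1) q z + (u+1 : ℂ) * iteratedDeriv u q z := by
      intro u z
      conv_lhs => rw [hfq]
      rw [iterDeriv_linmul q hq]
    -- growth
    have hqb : ∀ z : ℂ, ‖z‖ ≤ 9 * M → ‖q z‖ ≤ (F + δ) / (8 * M) := by
      intro z hz
      have hU : Bornology.IsBounded (Metric.ball (0:ℂ) (9 * M)) := Metric.isBounded_ball
      have h9 : (9 * M : ℝ) ≠ 0 := by positivity
      refine Complex.norm_le_of_forall_mem_frontier_norm_le hU hq.diffContOnCl (C := (F + δ) / (8 * M)) ?_ ?_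
      · intro w hw
        rw [frontier_ball _ h9, mem_sphere_zero_iff_norm] at hw
        have h1 : ‖w - a‖ ≥ 8 * M := by
          have := norm_sub_norm_le w (a:ℂ)
          rw [hw, Complex.norm_natCast] at this
          linarith
        have h2 : (w - a) * q w = f w - f a := by
          conv_rhs => rw [hfq]
          simp
        have h3 : ‖w - a‖ * ‖q w‖ ≤ F + δ := by
          rw [← norm_mul, h2]
          exact (norm_sub_le _ _).trans (add_le_add (hb w hw.le) hfa)
        rw [le_div_iff₀ (by positivity)]
        nlinarith [norm_nonneg (q w)]
      · rw [closure_ball _ h9]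
        simpa using hz
    -- jets
    set μ' : ℕ → ℕ := fun s => if s = a then μ s - 1 else μ s with hμ'
    have hjet : ∀ s < S, ∀ u < μ' s, ‖iteratedDeriv u q s‖ ≤ ((τ + 2) * δ) * u.factorial := by
      intro s hs u hu
      by_cases hsa : s = a
      · subst hsa
        simp only [hμ', if_true] at hu
        have h1 := hj s hs (u+1) (by omega)
        rw [hder u] at h1
        simp only [sub_self, zero_mul, zero_add, norm_mul] at h1
        have h2 : ‖(u+1 : ℂ)‖ = (u+1:ℝ) := by
          have := Complex.norm_natCast (u+1); push_cast at this; exact this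
        rw [h2, Nat.factorial_succ] at h1
        push_cast at h1
        have h3 : ‖iteratedDeriv u q s‖ ≤ δ * u.factorial := by
          have hpos : (0:ℝ) < u + 1 := by positivity
          have : (u+1:ℝ) * ‖iteratedDeriv u q s‖ ≤ (u+1) * (δ * u.factorial) := by
            calc _ ≤ _ := h1
              _ = _ := by ring
          exact le_of_mul_le_mul_left this hpos
        refine h3.trans ?_
        have : (0:ℝ) ≤ δ * u.factorial := by positivity
        have h4 : (0:ℝ) ≤ τ := by positivity
        nlinarith
      · simp only [hμ', if_neg hsa] at hu
        have hsa' : (1:ℝ) ≤ ‖(s:ℂ) - a‖ := by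
          have h1 : ((s:ℂ) - a) = (((s:ℤ) - (a:ℤ) : ℤ) : ℂ) := by push_cast; rfl
          rw [h1, Complex.norm_intCast]
          have : (1:ℤ) ≤ |(s:ℤ) - a| := Int.one_le_abs (by omega)
          exact_mod_cast this
        have key : ∀ v < μ s, ‖iteratedDeriv v q s‖ ≤ ((v + 2) * δ) * v.factorial := by
          intro v
          induction v with
          | zero =>
            intro hv
            have h1 := hj s hs 0 hv
            simp only [iteratedDeriv_zero, Nat.factorial_zero, Nat.cast_one, mul_one] at h1 ⊢
            have h2 : ((s:ℂ) - a) * q s = f s - f a := by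
              conv_rhs => rw [hfq]
              simp
            have h3 : ‖(s:ℂ) - a‖ * ‖q s‖ ≤ δ + δ := by
              rw [← norm_mul, h2]
              exact (norm_sub_le _ _).trans (add_le_add h1 hfa)
            push_cast
            nlinarith [norm_nonneg (q s)]
          | succ v ihv =>
            intro hv
            have h0 := ihv (by omega)
            have h1 := hj s hs (v+1) hv
            have h2 : ((s:ℂ) - a) * iteratedDeriv (v+1) q s =
                iteratedDeriv (v+1) f s - (v+1:ℂ) * iteratedDeriv v q s := by
              rw [hder v]; ring
            have hv1 : ‖(v+1 : ℂ)‖ = (v+1:ℝ) := by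
              have := Complex.norm_natCast (v+1); push_cast at this; exact this
            have h3 : ‖(s:ℂ) - a‖ * ‖iteratedDeriv (v+1) q s‖ ≤
                δ * (v+1).factorial + (v+1) * ((v + 2) * δ * v.factorial) := by
              rw [← norm_mul, h2]
              refine (norm_sub_le _ _).trans (add_le_add h1 ?_)
              rw [norm_mul, hv1]
              gcongr
            have h4 : ‖iteratedDeriv (v+1) q s‖ ≤ ‖(s:ℂ) - a‖ * ‖iteratedDeriv (v+1) q s‖ := by
              nlinarith [norm_nonneg (iteratedDeriv (v+1) q s)]
            refine (h4.trans h3).trans (le_of_eq ?_)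
            rw [Nat.factorial_succ]; push_cast; ring
        refine (key u hu).trans ?_
        have : (u:ℝ) ≤ τ := by exact_mod_cast (by have := hτ s hs; omega : u ≤ τ)
        gcongr
    have hsum' : ∑ s ∈ Finset.range S, μ' s = N := by
      have haR : a ∈ Finset.range S := Finset.mem_range.mpr haS
      rw [← Finset.add_sum_erase _ _ haR] at hsum ⊢
      have : ∑ s ∈ (Finset.range S).erase a, μ' s = ∑ s ∈ (Finset.range S).erase a, μ s := by
        apply Finset.sum_congr rfl
        intro s hs
        simp only [hμ', if_neg (Finset.ne_of_mem_erase hs)]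
      rw [this]
      simp only [hμ', if_true]
      omega
    have hτ' : ∀ s < S, μ' s ≤ τ := by
      intro s hs
      have := hτ s hs
      simp only [hμ']; split_ifs <;> omega
    have hfin := ih q μ' ((τ + 2) * δ) ((F + δ) / (8 * M)) hq (by positivity) (by positivity) hsum' hτ' hjet hqb x hx
    have hxa : ‖(x:ℂ) - a‖ ≤ M := by
      have h1 : ((x:ℂ) - a) = (((x:ℤ) - (a:ℤ) : ℤ) : ℂ) := by push_cast; rfl
      rw [h1, Complex.norm_intCast]
      have : |(x:ℤ) - a| ≤ M := by rw [abs_le]; omega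
      exact_mod_cast this
    have hfx : ‖f x‖ ≤ δ + M * ‖q x‖ := by
      rw [hfq]
      refine (norm_add_le _ _).trans (add_le_add hfa ?_)
      rw [norm_mul]; gcongr
    set y : ℝ := M * (τ + 2) + 1 with hy
    have hy1 : (1:ℝ) ≤ y := by rw [hy]; have : (0:ℝ) ≤ M * (τ+2) := by positivity
                               linarith
    have hyN : (1:ℝ) ≤ y ^ N := one_le_pow₀ hy1
    calc ‖f x‖ ≤ δ + M * ‖q x‖ := hfx
      _ ≤ δ + M * ((F + δ) / (8 * M) / 8 ^ N + 2 * y ^ N * ((τ + 2) * δ)) := by gcongr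
      _ = F / 8 ^ (N+1) + δ / 8 ^ (N+1) + δ + 2 * (y - 1) * y ^ N * δ := by
          rw [hy]; field_simp; ring
      _ ≤ F / 8 ^ (N+1) + δ + δ + 2 * (y - 1) * y ^ N * δ := by
          have : δ / 8 ^ (N+1) ≤ δ := div_le_self hδ (one_le_pow₀ (by norm_num))
          linarith
      _ ≤ F / 8 ^ (N+1) + 2 * y ^ (N+1) * δ := by
          have : 0 ≤ (y ^ N - 1) * δ := mul_nonneg (by linarith) hδ
          have e : y ^ (N+1) = y ^ N * y := pow_succ y N
          rw [e]; nlinarith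

/-- Approximate Schwarz lemma. -/
lemma newton_bound (S τ M : ℕ) (hM : S ≤ M) (hM1 : 1 ≤ M) (f : ℂ → ℂ) (δ F : ℝ)
    (hf : Differentiable ℂ f) (hδ : 0 ≤ δ) (hF : 0 ≤ F)
    (hj : ∀ s < S, ∀ u < τ, ‖iteratedDeriv u f s‖ ≤ δ * u.factorial)
    (hb : ∀ z : ℂ, ‖z‖ ≤ 9 * M → ‖f z‖ ≤ F) (x : ℕ) (hx : x ≤ M) :
    ‖f x‖ ≤ F / 8 ^ (S * τ) + 2 * ((M * (τ + 2) + 1 : ℝ)) ^ (S * τ) * δ :=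
  newton_aux S τ M hM hM1 (S * τ) f (fun _ => τ) δ F hf hδ hF (by simp) (fun _ _ => le_rfl) hj hb x hx

end

section

open Complex

/-- the auxiliary exponential sum -/
noncomputable def bf {ι : Type} [Fintype ι] (p X Y W : ι → ℝ) (t1 t2 : ℕ) (z : ℂ) : ℂ :=
  ∑ i, ((p i * X i ^ t1 * Y i ^ t2 : ℝ) : ℂ) * Complex.exp ((W i : ℂ) * z)

/-- its algebraic counterpart -/
noncomputable def bg {ι : Type} [Fintype ι] (p X Y V : ι → ℝ) (t1 t2 : ℕ) (s : ℕ) : ℝ :=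
  ∑ i, p i * X i ^ t1 * Y i ^ t2 * V i ^ s

lemma bf_diff {ι : Type} [Fintype ι] (p X Y W : ι → ℝ) (t1 t2 : ℕ) :
    Differentiable ℂ (bf p X Y W t1 t2) := by
  unfold bf
  fun_prop

lemma bf_iter {ι : Type} [Fintype ι] (p X Y W : ι → ℝ) (t1 t2 u : ℕ) :
    iteratedDeriv u (bf p X Y W t1 t2) = fun z =>
      ∑ i, ((p i * X i ^ t1 * Y i ^ t2 * W i ^ u : ℝ) : ℂ) * Complex.exp ((W i : ℂ) * z) := by
  induction u with
  | zero => funext z; simp [bf]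
  | succ u ih =>
    rw [iteratedDeriv_succ, ih]
    funext z
    have : HasDerivAt (fun z : ℂ => ∑ i, ((p i * X i ^ t1 * Y i ^ t2 * W i ^ u : ℝ) : ℂ) * Complex.exp ((W i : ℂ) * z))
      (∑ i, ((p i * X i ^ t1 * Y i ^ t2 * W i ^ u : ℝ) : ℂ) * (Complex.exp ((W i : ℂ) * z) * ((W i : ℂ) * 1))) z := by
      apply HasDerivAt.fun_sum
      intro i _
      exact (((hasDerivAt_id z).const_mul (W i : ℂ)).cexp).const_mul _
    rw [this.deriv]
    apply Finset.sum_congr rfl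
    intro i _
    push_cast; ring

lemma bf_iter_binom {ι : Type} [Fintype ι] (p X Y W : ι → ℝ) (la lt : ℝ)
    (hW : ∀ i, W i = X i * la + Y i * lt) (t1 t2 u : ℕ) (z : ℂ) :
    iteratedDeriv u (bf p X Y W t1 t2) z = ∑ j ∈ Finset.range (u+1),
      ((la ^ j * lt ^ (u - j) * (u.choose j) : ℝ) : ℂ) * bf p X Y W (t1 + j) (t2 + (u - j)) z := by
  rw [bf_iter]
  simp only [bf, Finset.mul_sum]
  rw [Finset.sum_comm]
  apply Finset.sum_congr rfl
  intro i _
  have h : ((W i ^ u : ℝ) : ℂ) = ∑ j ∈ Finset.range (u+1), ((((X i * la) ^ j * (Y i * lt) ^ (u - j) * (u.choose j) : ℝ)) : ℂ) := by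
    rw [hW i, add_pow]; push_cast; rfl
  have e : ((p i * X i ^ t1 * Y i ^ t2 * W i ^ u : ℝ) : ℂ) = ((p i * X i ^ t1 * Y i ^ t2 : ℝ) : ℂ) * ((W i ^ u : ℝ) : ℂ) := by
    push_cast; ring
  rw [e, h, Finset.mul_sum, Finset.sum_mul]
  apply Finset.sum_congr rfl
  intro j _
  push_cast; ring

lemma abs_coef_le {ι : Type} (p X Y : ι → ℝ) (P B : ℝ) (T : ℕ) (hB : 1 ≤ B)
    (hp : ∀ i, |p i| ≤ P) (hX : ∀ i, |X i| ≤ B) (hY : ∀ i, |Y i| ≤ B) (i : ι) (t1 t2 : ℕ)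
    (h1 : t1 ≤ T) (h2 : t2 ≤ T) : |p i * X i ^ t1 * Y i ^ t2| ≤ P * B ^ (2 * T) := by
  have hP : 0 ≤ P := (abs_nonneg _).trans (hp i)
  rw [abs_mul, abs_mul, abs_pow, abs_pow, two_mul, pow_add, ← mul_assoc]
  have a1 : |X i| ^ t1 ≤ B ^ T := (pow_le_pow_left₀ (abs_nonneg _) (hX i) _).trans (pow_le_pow_right₀ hB h1)
  have a2 : |Y i| ^ t2 ≤ B ^ T := (pow_le_pow_left₀ (abs_nonneg _) (hY i) _).trans (pow_le_pow_right₀ hB h2)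
  have := hp i
  gcongr

lemma bf_sub_bg {ι : Type} [Fintype ι] (p X Y W V l3 : ι → ℝ) (P B Lam eps L Vm : ℝ) (T M : ℕ)
    (hB : 1 ≤ B) (hp : ∀ i, |p i| ≤ P) (hX : ∀ i, |X i| ≤ B) (hY : ∀ i, |Y i| ≤ B)
    (hl0 : ∀ i, 0 ≤ l3 i) (hl : ∀ i, l3 i ≤ L) (hV0 : ∀ i, 0 < V i) (hVm : ∀ i, V i ≤ Vm) (hVm1 : 1 ≤ Vm)
    (hWV : ∀ i, W i = Real.log (V i) - l3 i * Lam) (hLam : |Lam| ≤ eps) (hsm : L * M * eps ≤ 1)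
    (t1 t2 s : ℕ) (h1 : t1 ≤ T) (h2 : t2 ≤ T) (hs : s ≤ M) :
    ‖bf p X Y W t1 t2 s - bg p X Y V t1 t2 s‖ ≤
      (Fintype.card ι * P * B ^ (2 * T) * Vm ^ M) * (2 * L * M * eps) := by
  have heps : 0 ≤ eps := (abs_nonneg _).trans hLam
  have hbound : ∀ i, ‖((p i * X i ^ t1 * Y i ^ t2 : ℝ) : ℂ) * Complex.exp ((W i : ℂ) * s) -
      ((p i * X i ^ t1 * Y i ^ t2 * V i ^ s : ℝ) : ℂ)‖ ≤ P * B ^ (2 * T) * Vm ^ M * (2 * L * M * eps) := by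
    intro i
    have hP : 0 ≤ P := (abs_nonneg _).trans (hp i)
    have hL : 0 ≤ L := (hl0 i).trans (hl i)
    have hc := abs_coef_le p X Y P B T hB hp hX hY i t1 t2 h1 h2
    set c := p i * X i ^ t1 * Y i ^ t2
    set w : ℝ := - (l3 i * Lam * s) with hw
    have e1 : Complex.exp ((W i : ℂ) * s) = ((V i ^ s * Real.exp w : ℝ) : ℂ) := by
      have : (W i : ℂ) * s = ((W i * s : ℝ) : ℂ) := by push_cast; rfl
      rw [this, ← Complex.ofReal_exp]
      congr 1
      have h3 : V i ^ s = Real.exp (s * Real.log (V i)) := by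
        rw [mul_comm, Real.exp_mul, Real.exp_log (hV0 i), Real.rpow_natCast]
      rw [h3, ← Real.exp_add, hWV i, hw]; congr 1; ring
    rw [e1, ← Complex.ofReal_mul, ← Complex.ofReal_sub, Complex.norm_real, Real.norm_eq_abs]
    have e2 : c * (V i ^ s * Real.exp w) - c * V i ^ s = c * (V i ^ s) * (Real.exp w - 1) := by ring
    rw [e2, abs_mul, abs_mul]
    have hsM : (s:ℝ) ≤ M := by exact_mod_cast hs
    have hwa : |w| ≤ L * M * eps := by
      rw [hw, abs_neg, abs_mul, abs_mul, abs_of_nonneg (hl0 i), (abs_of_nonneg (Nat.cast_nonneg s) : |(s:ℝ)| = s)]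
      calc l3 i * |Lam| * s ≤ L * eps * M := by
            have := hl i; gcongr
        _ = L * M * eps := by ring
    have h4 : |Real.exp w - 1| ≤ 2 * (L * M * eps) :=
      (Real.abs_exp_sub_one_le (hwa.trans hsm)).trans (by linarith)
    have h5 : |V i ^ s| ≤ Vm ^ M := by
      rw [abs_of_pos (pow_pos (hV0 i) s)]
      exact (pow_le_pow_left₀ (hV0 i).le (hVm i) s).trans (pow_le_pow_right₀ hVm1 hs)
    calc |c| * |V i ^ s| * |Real.exp w - 1| ≤ (P * B ^ (2*T)) * (Vm ^ M) * (2 * (L * M * eps)) := by gcongr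
      _ = _ := by ring
  have e0 : bf p X Y W t1 t2 s - (bg p X Y V t1 t2 s : ℂ) = ∑ i, (((p i * X i ^ t1 * Y i ^ t2 : ℝ) : ℂ) * Complex.exp ((W i : ℂ) * s) -
      ((p i * X i ^ t1 * Y i ^ t2 * V i ^ s : ℝ) : ℂ)) := by
    rw [Finset.sum_sub_distrib]; simp only [bf, bg]; push_cast; rfl
  rw [e0]
  refine (norm_sum_le _ _).trans ?_
  refine (Finset.sum_le_sum (fun i _ => hbound i)).trans (le_of_eq ?_)
  rw [Finset.sum_const, Finset.card_univ, nsmul_eq_mul]; ring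

/-- One extrapolation step. -/
lemma extrap {ι : Type} [Fintype ι] (p X Y W V l3 : ι → ℝ) (P B Lam eps L Vm Wm la lt : ℝ)
    (T M S τ T' E : ℕ)
    (hB : 1 ≤ B) (hP : 1 ≤ P) (hL1 : 1 ≤ L) (hp : ∀ i, |p i| ≤ P) (hX : ∀ i, |X i| ≤ B) (hY : ∀ i, |Y i| ≤ B)
    (hl0 : ∀ i, 0 ≤ l3 i) (hl : ∀ i, l3 i ≤ L) (hV0 : ∀ i, 0 < V i) (hVm : ∀ i, V i ≤ Vm) (hVm1 : 1 ≤ Vm)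
    (hWV : ∀ i, W i = Real.log (V i) - l3 i * Lam) (hLam : |Lam| ≤ eps) (hsm : L * M * eps ≤ 1)
    (hW : ∀ i, W i = X i * la + Y i * lt) (hla : 0 ≤ la) (hlt : 0 ≤ lt) (hlalt : la + lt ≤ 4)
    (hWm : ∀ i, |W i| ≤ Wm) (hSM : S ≤ M) (hM1 : 1 ≤ M) (hcard : 1 ≤ Fintype.card ι)
    (hT' : T' + τ ≤ T)
    (hliou : ∀ t1 t2 s, t1 ≤ T → t2 ≤ T → s ≤ M → bg p X Y V t1 t2 s ≠ 0 →
      1 ≤ |bg p X Y V t1 t2 s| * (Fintype.card ι * P * B ^ (2 * T) * Vm ^ M) ^ E)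
    (H1 : 4 * (Fintype.card ι * P * B ^ (2 * T) * Vm ^ M) ^ (E+1) * Real.exp (Wm * (9 * M)) ≤ 8 ^ (S * τ))
    (H2 : eps * (2 * L * M) * (12 * (Fintype.card ι * P * B ^ (2 * T) * Vm ^ M) ^ (E+1) *
      (M * (τ + 2) + 1 : ℝ) ^ (S * τ) * 4 ^ τ) ≤ 1)
    (hz : ∀ t1 t2 s, t1 < T' + τ → t2 < T' + τ → s < S → bg p X Y V t1 t2 s = 0) :
    ∀ t1 t2 s, t1 < T' → t2 < T' → s ≤ M → bg p X Y V t1 t2 s = 0 := by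
  intro t1 t2 s h1 h2 hs
  by_contra hne
  set Z : ℝ := Fintype.card ι * P * B ^ (2 * T) * Vm ^ M with hZ
  have hc1 : (1:ℝ) ≤ Fintype.card ι := by exact_mod_cast hcard
  have hMr : (1:ℝ) ≤ M := by exact_mod_cast hM1
  have hZ1 : 1 ≤ Z := by
    have := one_le_pow₀ hB (n := 2*T)
    have := one_le_pow₀ hVm1 (n := M)
    rw [hZ]
    exact one_le_mul_of_one_le_of_one_le (one_le_mul_of_one_le_of_one_le (one_le_mul_of_one_le_of_one_le hc1 hP) ‹_›) ‹_›
  have heps : 0 ≤ eps := (abs_nonneg _).trans hLam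
  set Δ : ℝ := Z * (2 * L * M * eps) with hΔ
  have hΔ0 : 0 ≤ Δ := by positivity
  have hclose : ∀ t1 t2 s : ℕ, t1 ≤ T → t2 ≤ T → s ≤ M → ‖bf p X Y W t1 t2 s - bg p X Y V t1 t2 s‖ ≤ Δ :=
    fun t1 t2 s a b c => bf_sub_bg p X Y W V l3 P B Lam eps L Vm T M hB hp hX hY hl0 hl hV0 hVm hVm1 hWV hLam hsm t1 t2 s a b c
  -- jets
  have hjet : ∀ s' < S, ∀ u < τ, ‖iteratedDeriv u (bf p X Y W t1 t2) s'‖ ≤ (4 ^ τ * Δ) * u.factorial := by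
    intro s' hs' u hu
    rw [bf_iter_binom p X Y W la lt hW]
    have hterm : ∀ j ∈ Finset.range (u+1), ‖((la ^ j * lt ^ (u - j) * (u.choose j) : ℝ) : ℂ) *
        bf p X Y W (t1 + j) (t2 + (u - j)) s'‖ ≤ la ^ j * lt ^ (u - j) * (u.choose j) * Δ := by
      intro j hj
      have hj' : j ≤ u := by have := Finset.mem_range.mp hj; omega
      rw [norm_mul, Complex.norm_real, Real.norm_eq_abs, abs_of_nonneg (by positivity)]
      have h0 := hclose (t1+j) (t2+(u-j)) s' (by omega) (by omega) (by omega)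
      rw [hz (t1+j) (t2+(u-j)) s' (by omega) (by omega) hs'] at h0
      simp only [Complex.ofReal_zero, sub_zero] at h0
      gcongr
    refine (norm_sum_le _ _).trans ((Finset.sum_le_sum hterm).trans ?_)
    rw [← Finset.sum_mul, ← add_pow]
    have h5 : (la + lt) ^ u ≤ 4 ^ τ :=
      (pow_le_pow_left₀ (by linarith) hlalt u).trans (pow_le_pow_right₀ (by norm_num) hu.le)
    have h6 : (1:ℝ) ≤ u.factorial := by exact_mod_cast Nat.factorial_pos u
    calc (la + lt) ^ u * Δ ≤ 4 ^ τ * Δ := by gcongr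
      _ ≤ 4 ^ τ * Δ * u.factorial := le_mul_of_one_le_right (by positivity) h6
  have hgrow : ∀ z : ℂ, ‖z‖ ≤ 9 * M → ‖bf p X Y W t1 t2 z‖ ≤ Z * Real.exp (Wm * (9 * M)) := by
    intro z hz'
    have hb : ∀ i, ‖((p i * X i ^ t1 * Y i ^ t2 : ℝ) : ℂ) * Complex.exp ((W i : ℂ) * z)‖ ≤
        P * B ^ (2*T) * Vm ^ M * Real.exp (Wm * (9 * M)) := by
      intro i
      rw [norm_mul, Complex.norm_real, Real.norm_eq_abs, Complex.norm_exp]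
      have hc := abs_coef_le p X Y P B T hB hp hX hY i t1 t2 (by omega) (by omega)
      have h7 : ((W i : ℂ) * z).re ≤ Wm * (9 * M) := by
        refine (Complex.re_le_norm _).trans ?_
        rw [norm_mul, Complex.norm_real, Real.norm_eq_abs]
        have := hWm i
        have := (abs_nonneg _).trans this
        gcongr
      have h8 := Real.exp_le_exp.mpr h7
      have h9 : P * B ^ (2*T) ≤ P * B ^ (2*T) * Vm ^ M := le_mul_of_one_le_right (by positivity) (one_le_pow₀ hVm1)
      have := hc.trans h9
      gcongr
    unfold bf
    refine (norm_sum_le _ _).trans ((Finset.sum_le_sum (fun i _ => hb i)).trans (le_of_eq ?_))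
    rw [Finset.sum_const, Finset.card_univ, nsmul_eq_mul, hZ]; ring
  have hnb := newton_bound S τ M hSM hM1 (bf p X Y W t1 t2) (4 ^ τ * Δ) (Z * Real.exp (Wm * (9 * M)))
    (bf_diff p X Y W t1 t2) (by positivity) (by positivity) hjet hgrow s hs
  have hcl := hclose t1 t2 s (by omega) (by omega) hs
  have hg : |bg p X Y V t1 t2 s| ≤ Δ + (Z * Real.exp (Wm * (9 * M)) / 8 ^ (S * τ) + 2 * ((M * (τ + 2) + 1 : ℝ)) ^ (S * τ) * (4 ^ τ * Δ)) := by
    have : ‖((bg p X Y V t1 t2 s : ℝ) : ℂ)‖ ≤ ‖bf p X Y W t1 t2 s - bg p X Y V t1 t2 s‖ + ‖bf p X Y W t1 t2 s‖ := by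
      have := norm_sub_le (bf p X Y W t1 t2 s) (bf p X Y W t1 t2 s - bg p X Y V t1 t2 s)
      rw [sub_sub_cancel] at this
      linarith
    rw [Complex.norm_real, Real.norm_eq_abs] at this
    linarith
  have hl := hliou t1 t2 s (by omega) (by omega) hs hne
  set y : ℝ := M * (τ + 2) + 1 with hy
  have hy1 : (1:ℝ) ≤ y := by
    have : (0:ℝ) ≤ M * (τ+2) := by positivity
    rw [hy]; linarith
  have hyN : 1 ≤ y ^ (S*τ) := one_le_pow₀ hy1
  have h4 : (1:ℝ) ≤ 4 ^ τ := one_le_pow₀ (by norm_num)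
  have hq : Δ ≤ y ^ (S*τ) * (4 ^ τ * Δ) := by
    have : 1 * (1 * Δ) ≤ y ^ (S*τ) * (4 ^ τ * Δ) := by gcongr
    linarith
  have hg2 : |bg p X Y V t1 t2 s| ≤ Z * Real.exp (Wm * (9 * M)) / 8 ^ (S * τ) + 3 * (y ^ (S * τ) * (4 ^ τ * Δ)) := by
    linarith
  have hA : Z * Real.exp (Wm * (9 * M)) / 8 ^ (S * τ) * Z ^ E ≤ 1/4 := by
    rw [div_mul_eq_mul_div, div_le_iff₀ (by positivity)]
    rw [pow_succ] at H1
    linarith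
  have hBb : 3 * (y ^ (S * τ) * (4 ^ τ * Δ)) * Z ^ E ≤ 1/4 := by
    rw [hΔ]
    rw [pow_succ] at H2
    linarith
  have : |bg p X Y V t1 t2 s| * Z ^ E ≤ 1/2 := by
    have := mul_le_mul_of_nonneg_right hg2 (by positivity : 0 ≤ Z ^ E)
    rw [add_mul] at this
    linarith
  linarith

end

section

open Polynomial

/-- Liouville-type property of a real number: integer polynomial values are not too small. -/
def Liou (α : ℝ) (D : ℕ) : Prop :=
  ∀ (Q : ℤ[X]) (Bd : ℝ), 1 ≤ Bd → (∀ z : ℂ, ‖z‖ ≤ 2 → ‖aeval z Q‖ ≤ Bd) → aeval α Q ≠ 0 →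
    1 ≤ |aeval α Q| * Bd ^ D

lemma liou_of_root (α : ℝ) (ψ : ℤ[X]) (hm : ψ.Monic) (hr : aeval α ψ = 0)
    (hroots : ∀ z : ℂ, aeval z ψ = 0 → ‖z‖ ≤ 2) : Liou α (ψ.natDegree - 1) := by
  intro Q Bd hBd hQ hne
  have hintZ : IsIntegral ℤ α := ⟨ψ, hm, by simpa [aeval_def] using hr⟩
  have hintQ : IsIntegral ℚ α := hintZ.tower_top
  let K := IntermediateField.adjoin ℚ {α}
  have : FiniteDimensional ℚ K := IntermediateField.adjoin.finiteDimensional hintQ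
  let a : K := IntermediateField.AdjoinSimple.gen ℚ α
  have haα : algebraMap K ℝ a = α := IntermediateField.AdjoinSimple.algebraMap_gen ℚ α
  have hinta : IsIntegral ℤ a := by
    rw [← isIntegral_algebraMap_iff (algebraMap K ℝ).injective, haα]
    exact hintZ
  let x : K := aeval a Q
  have hx : algebraMap K ℝ x = aeval α Q := by
    rw [← haα, aeval_algebraMap_apply]
  have hxint : IsIntegral ℤ x := by
    have : x ∈ integralClosure ℤ K := by
      have h := Subalgebra.aeval_coe (integralClosure ℤ K) (⟨a, hinta⟩ : integralClosure ℤ K) Q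
      have : x = ((aeval (⟨a, hinta⟩ : integralClosure ℤ K) Q : integralClosure ℤ K) : K) := by
        rw [← h]
      rw [this]; exact Subtype.prop _
    exact this
  have hx0 : x ≠ 0 := by
    intro h; apply hne; rw [← hx, h, map_zero]
  have hnorm : IsIntegral ℤ (Algebra.norm ℚ x) := Algebra.isIntegral_norm ℚ hxint
  obtain ⟨N, hN⟩ := IsIntegrallyClosed.isIntegral_iff.mp hnorm
  have hN0 : N ≠ 0 := by
    intro h
    rw [h, map_zero] at hN
    exact hx0 (Algebra.norm_eq_zero_iff.mp hN.symm)
  have hprod := Algebra.norm_eq_prod_embeddings ℚ ℂ x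
  rw [← hN] at hprod
  let σ0 : K →ₐ[ℚ] ℂ := ((Complex.ofRealAm).restrictScalars ℚ).comp (IsScalarTower.toAlgHom ℚ K ℝ)
  have hσ0 : ‖σ0 x‖ = |aeval α Q| := by
    have : σ0 x = ((algebraMap K ℝ x : ℝ) : ℂ) := rfl
    rw [this, hx, Complex.norm_real, Real.norm_eq_abs]
  have hσ : ∀ σ : K →ₐ[ℚ] ℂ, ‖σ x‖ ≤ Bd := by
    intro σ
    have h1 : σ x = aeval (σ a) Q := by
      have := (aeval_algHom_apply (σ.restrictScalars ℤ) a Q)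
      exact this.symm
    rw [h1]
    apply hQ
    apply hroots
    have h2 := aeval_algHom_apply (σ.restrictScalars ℤ) a ψ
    have h3 : aeval a ψ = 0 := by
      apply (algebraMap K ℝ).injective
      rw [map_zero, ← hr, ← haα, aeval_algebraMap_apply]
    rw [h3, map_zero] at h2
    exact h2
  have hcard : Fintype.card (K →ₐ[ℚ] ℂ) ≤ ψ.natDegree := by
    rw [AlgHom.card, IntermediateField.adjoin.finrank hintQ]
    have hd : minpoly ℚ α ∣ ψ.map (Int.castRingHom ℚ) := by
      apply minpoly.dvd
      rw [← hr, aeval_def, eval₂_map, aeval_def]; congr 1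
    have := natDegree_le_of_dvd hd ((hm.map _).ne_zero)
    rwa [hm.natDegree_map] at this
  classical
  have h1 : (1:ℝ) ≤ ‖∏ σ : K →ₐ[ℚ] ℂ, σ x‖ := by
    rw [← hprod]
    have : ((algebraMap ℚ ℂ) ((algebraMap ℤ ℚ) N)) = (N : ℂ) := by simp
    rw [this, Complex.norm_intCast]
    exact_mod_cast Int.one_le_abs hN0
  rw [norm_prod, ← Finset.mul_prod_erase _ _ (Finset.mem_univ σ0), hσ0] at h1
  refine h1.trans ?_
  gcongr
  have h2 : ∏ σ ∈ Finset.univ.erase σ0, ‖σ x‖ ≤ Bd ^ (Finset.univ.erase σ0).card := by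
    refine (Finset.prod_le_prod (fun σ _ => norm_nonneg _) (fun σ _ => hσ σ)).trans (le_of_eq ?_)
    rw [Finset.prod_const]
  refine h2.trans (pow_le_pow_right₀ hBd ?_)
  rw [Finset.card_erase_of_mem (Finset.mem_univ _), Finset.card_univ]
  omega

/-- Vandermonde in finset form -/
lemma vand {ι : Type} (s : Finset ι) (x c : ι → ℝ) (hinj : Set.InjOn x s) (N : ℕ) (hN : s.card ≤ N)
    (h : ∀ t < N, ∑ i ∈ s, c i * x i ^ t = 0) : ∀ i ∈ s, c i = 0 := by
  classical
  intro i hi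
  let q : ℝ[X] := ∏ j ∈ s.erase i, (X - C (x j))
  have hdeg : q.natDegree < N := by
    have : q.natDegree = (s.erase i).card := by
      simp [q, natDegree_prod_of_monic _ _ (fun j _ => monic_X_sub_C (x j))]
    rw [this, Finset.card_erase_of_mem hi]
    have := Finset.card_pos.mpr ⟨i, hi⟩
    omega
  have h1 : ∑ j ∈ s, c j * q.eval (x j) = 0 := by
    have : ∀ j, q.eval (x j) = ∑ t ∈ Finset.range (q.natDegree + 1), q.coeff t * x j ^ t := fun j => eval_eq_sum_range _
    simp only [this, Finset.mul_sum]
    rw [Finset.sum_comm]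
    apply Finset.sum_eq_zero
    intro t ht
    have ht' : t < N := by have := Finset.mem_range.mp ht; omega
    have : ∑ j ∈ s, c j * (q.coeff t * x j ^ t) = q.coeff t * ∑ j ∈ s, c j * x j ^ t := by
      rw [Finset.mul_sum]; apply Finset.sum_congr rfl; intros; ring
    rw [this, h t ht', mul_zero]
  rw [Finset.sum_eq_single i] at h1
  · have hq : q.eval (x i) ≠ 0 := by
      simp only [q, eval_prod, eval_sub, eval_X, eval_C]
      rw [Finset.prod_ne_zero_iff]
      intro j hj
      rw [sub_ne_zero]
      intro hx
      exact (Finset.ne_of_mem_erase hj) (hinj (Finset.mem_of_mem_erase hj) hi hx.symm)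
    exact (mul_eq_zero.mp h1).resolve_right hq
  · intro j hj hji
    have : q.eval (x j) = 0 := by
      simp only [q, eval_prod, eval_sub, eval_X, eval_C]
      apply Finset.prod_eq_zero (Finset.mem_erase.mpr ⟨hji, hj⟩)
      ring
    rw [this, mul_zero]
  · intro h; exact absurd hi h

/-- zero estimate -/
lemma zero_est {ι : Type} [Fintype ι] (p X Y V : ι → ℝ) (N : ℕ)
    (hinj : ∀ i j, V i = V j → X i = X j → i = j)
    (hcl : ∀ i, (Finset.univ.filter (fun j => V j = V i)).card ≤ N)
    (h : ∀ t s, t < N → s < Fintype.card ι → bg p X Y V t 0 s = 0) : ∀ i, p i = 0 := by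
  classical
  have key : ∀ t < N, ∀ v ∈ Finset.univ.image V, ∑ i ∈ Finset.univ.filter (fun i => V i = v), p i * X i ^ t = 0 := by
    intro t ht
    apply vand (Finset.univ.image V) id (fun v => ∑ i ∈ Finset.univ.filter (fun i => V i = v), p i * X i ^ t)
      Function.injective_id.injOn (Fintype.card ι) (by simpa using Finset.card_image_le (s := Finset.univ) (f := V))
    intro s hs
    have := h t s ht hs
    rw [bg] at this
    simp only [pow_zero, mul_one] at this
    rw [← Finset.sum_fiberwise_of_maps_to (s := Finset.univ) (t := Finset.univ.image V) (g := V)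
      (fun i _ => Finset.mem_image_of_mem _ (Finset.mem_univ i))] at this
    rw [← this]
    apply Finset.sum_congr rfl
    intro v _
    rw [Finset.sum_mul]
    apply Finset.sum_congr rfl
    intro i hi
    rw [(Finset.mem_filter.mp hi).2]; rfl
  intro i
  have hk := fun t ht => key t ht (V i) (Finset.mem_image_of_mem _ (Finset.mem_univ i))
  refine vand (Finset.univ.filter (fun j => V j = V i)) X p ?_ N ?_ hk i (by simp)
  · intro a ha b hb hab
    have ha' := (Finset.mem_filter.mp (Finset.mem_coe.mp ha)).2
    have hb' := (Finset.mem_filter.mp (Finset.mem_coe.mp hb)).2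
    exact hinj a b (ha'.trans hb'.symm) hab
  · convert hcl i

end

section

lemma pigeon {ι κ : Type} [Fintype ι] [Fintype κ] [DecidableEq ι] (c : κ → ι → ℝ) (U : ℝ) (P E : ℕ)
    (hU : ∀ k i, |c k i| ≤ U) (hP3 : 3 ≤ P) (hP : Fintype.card ι * U ≤ P)
    (hcard : (2 * E + 3) * Fintype.card κ ≤ Fintype.card ι) (hι : 0 < Fintype.card ι)
    (hl : ∀ p : ι → ℤ, (∀ i, |p i| ≤ P) → ∀ k, ∑ i, (p i : ℝ) * c k i ≠ 0 →
      1 ≤ |∑ i, (p i : ℝ) * c k i| * ((P:ℝ) ^ 2) ^ E) :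
    ∃ p : ι → ℤ, p ≠ 0 ∧ (∀ i, |p i| ≤ P) ∧ ∀ k, ∑ i, (p i : ℝ) * c k i = 0 := by
  classical
  let R : ℤ := (P:ℤ) ^ (2 * E + 2)
  have hP3r : (3:ℝ) ≤ P := by exact_mod_cast hP3
  let φ : (ι → Fin (P+1)) → (κ → ℤ) := fun p k => ⌊(∑ i, ((p i : ℕ) : ℝ) * c k i) * ((P:ℝ) ^ 2) ^ E⌋
  have hmaps : ∀ p ∈ (Finset.univ : Finset (ι → Fin (P+1))), φ p ∈ Fintype.piFinset (fun _ : κ => Finset.Icc (-R) R) := by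
    intro p _
    rw [Fintype.mem_piFinset]
    intro k
    have hb : |∑ i, ((p i : ℕ) : ℝ) * c k i| ≤ (P:ℝ) ^ 2 := by
      refine (Finset.abs_sum_le_sum_abs _ _).trans ?_
      have : ∀ i ∈ Finset.univ, |((p i : ℕ) : ℝ) * c k i| ≤ P * U := by
        intro i _
        rw [abs_mul, abs_of_nonneg (Nat.cast_nonneg _ : (0:ℝ) ≤ ((p i : ℕ) : ℝ))]
        have h1 : ((p i : ℕ) : ℝ) ≤ P := by exact_mod_cast Nat.lt_succ_iff.mp (p i).2
        have h2 := hU k i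
        have h3 := abs_nonneg (c k i)
        exact mul_le_mul h1 h2 h3 (Nat.cast_nonneg _)
      refine (Finset.sum_le_sum this).trans ?_
      rw [Finset.sum_const, Finset.card_univ, nsmul_eq_mul]
      nlinarith
    have hb2 : |(∑ i, ((p i : ℕ) : ℝ) * c k i) * ((P:ℝ) ^ 2) ^ E| ≤ (R : ℝ) := by
      rw [abs_mul, abs_of_nonneg (by positivity : 0 ≤ ((P:ℝ) ^ 2) ^ E)]
      have : (R:ℝ) = (P:ℝ)^2 * ((P:ℝ) ^ 2) ^ E := by
        simp only [R]; push_cast; ring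
      rw [this]; gcongr
    rw [abs_le] at hb2
    rw [Finset.mem_Icc]
    constructor
    · apply Int.le_floor.mpr; push_cast; exact hb2.1
    · have := (Int.floor_le ((∑ i, ((p i : ℕ) : ℝ) * c k i) * ((P:ℝ) ^ 2) ^ E)).trans hb2.2
      exact Int.cast_le.mp this
  have hlt : (Fintype.piFinset (fun _ : κ => Finset.Icc (-R) R)).card < (Finset.univ : Finset (ι → Fin (P+1))).card := by
    rw [Fintype.card_piFinset, Finset.prod_const, Finset.card_univ, Finset.card_univ, Fintype.card_fun, Fintype.card_fin, Int.card_Icc]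
    have h1 : (R + 1 - -R).toNat ≤ P ^ (2 * E + 3) := by
      have : (R + 1 - -R) ≤ ((P ^ (2*E+3) : ℕ) : ℤ) := by
        have hR1 : (1:ℤ) ≤ R := one_le_pow₀ (by exact_mod_cast (by omega : 1 ≤ P))
        have : ((P ^ (2*E+3) : ℕ) : ℤ) = R * P := by simp only [R]; push_cast; ring
        rw [this]
        have : (3:ℤ) ≤ P := by exact_mod_cast hP3
        nlinarith
      exact Int.toNat_le.mpr this
    calc (R + 1 - -R).toNat ^ Fintype.card κ ≤ (P ^ (2 * E + 3)) ^ Fintype.card κ := Nat.pow_le_pow_left h1 _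
      _ = P ^ ((2 * E + 3) * Fintype.card κ) := (pow_mul _ _ _).symm
      _ ≤ P ^ Fintype.card ι := Nat.pow_le_pow_right (by omega) hcard
      _ < (P+1) ^ Fintype.card ι := Nat.pow_lt_pow_left (by omega) (by omega)
  obtain ⟨p, -, p', -, hne, heq⟩ := Finset.exists_ne_map_eq_of_card_lt_of_maps_to hlt hmaps
  refine ⟨fun i => (p i : ℕ) - (p' i : ℕ), ?_, ?_, ?_⟩
  · intro h
    apply hne
    funext i
    have := congrFun h i
    simp only [Pi.zero_apply] at this
    apply Fin.ext; omega
  · intro i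
    have h1 := (p i).2
    have h2 := (p' i).2
    rw [abs_le]; constructor <;> push_cast <;> omega
  · intro k
    by_contra hcon
    have h1 := hl (fun i => (p i : ℕ) - (p' i : ℕ)) (by
      intro i
      have h1 := (p i).2
      have h2 := (p' i).2
      rw [abs_le]; constructor <;> push_cast <;> omega) k hcon
    have h2 : (⌊(∑ i, ((p i : ℕ) : ℝ) * c k i) * ((P:ℝ) ^ 2) ^ E⌋ : ℤ) = ⌊(∑ i, ((p' i : ℕ) : ℝ) * c k i) * ((P:ℝ) ^ 2) ^ E⌋ := congrFun heq k
    have h3 := Int.abs_sub_lt_one_of_floor_eq_floor h2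
    rw [← sub_mul, ← Finset.sum_sub_distrib, abs_mul, abs_of_nonneg (by positivity : 0 ≤ ((P:ℝ) ^ 2) ^ E)] at h3
    have h4 : ∑ i, (((p i : ℕ) : ℝ) * c k i - ((p' i : ℕ) : ℝ) * c k i) = ∑ i, (((((p i : ℕ) : ℤ) - ((p' i : ℕ) : ℤ)) : ℤ) : ℝ) * c k i := by
      apply Finset.sum_congr rfl
      intro i _
      push_cast; ring
    rw [h4] at h3
    linarith

end

section

open Polynomial

/-- index set of the auxiliary function -/
abbrev BI (A L : ℕ) : Type := Fin (A+1) × Fin (A+1) × Fin (L+1)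

def bX {A L : ℕ} (n : ℕ) (i : BI A L) : ℤ := (i.1 : ℕ) - (n:ℤ) * (i.2.2 : ℕ)
def bY {A L : ℕ} (d : ℕ) (i : BI A L) : ℤ := (i.2.1 : ℕ) + (d:ℤ) * (i.2.2 : ℕ)
noncomputable def bV {A L : ℕ} (α γ : ℝ) (i : BI A L) : ℝ := α ^ (i.1 : ℕ) * 10 ^ (i.2.1 : ℕ) * γ ^ (i.2.2 : ℕ)

lemma BI_card (A L : ℕ) : Fintype.card (BI A L) = (A+1) * ((A+1) * (L+1)) := by
  simp [BI]

lemma bX_le {A L n B : ℕ} (h : A + n * L ≤ B) (i : BI A L) : |((bX n i : ℤ) : ℝ)| ≤ B := by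
  have h1 := i.1.2
  have h2 : (i.2.2 : ℕ) ≤ L := by have := i.2.2.2; omega
  have h3 : n * (i.2.2 : ℕ) ≤ n * L := Nat.mul_le_mul_left _ h2
  have : |bX n i| ≤ (B : ℤ) := by
    unfold bX
    rw [abs_le]
    constructor <;> zify at h3 h1 h <;> nlinarith
  exact_mod_cast this

lemma bY_le {A L d B : ℕ} (h : A + d * L ≤ B) (i : BI A L) : |((bY d i : ℤ) : ℝ)| ≤ B := by
  have h1 := i.2.1.2
  have h2 : (i.2.2 : ℕ) ≤ L := by have := i.2.2.2; omega
  have h3 : d * (i.2.2 : ℕ) ≤ d * L := Nat.mul_le_mul_left _ h2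
  have : |bY d i| ≤ (B : ℤ) := by
    unfold bY
    rw [abs_le]
    constructor <;> zify at h3 h1 h <;> nlinarith
  exact_mod_cast this

lemma bg_liou (α γ : ℝ) (D g L A n d B T P : ℕ) (G1 G2 : ℤ[X]) (hL : Liou α D) (hα1 : 1 ≤ α) (hα2 : α ≤ 2)
    (hA : A = g * L) (hG1 : ∀ z : ℂ, ‖z‖ ≤ 2 → ‖aeval z G1‖ ≤ 10 ^ g)
    (hG2 : ∀ z : ℂ, ‖z‖ ≤ 2 → ‖aeval z G2‖ ≤ 10 ^ g)
    (hG2p : aeval α G2 ≠ 0) (hγ : γ = aeval α G1 / aeval α G2)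
    (hB1 : A + n * L ≤ B) (hB2 : A + d * L ≤ B) (hB : 1 ≤ B) (hP : 1 ≤ P)
    (p : BI A L → ℤ) (hp : ∀ i, |p i| ≤ P) (t1 t2 s : ℕ) (h1 : t1 ≤ T) (h2 : t2 ≤ T)
    (hne : bg (fun i => (p i : ℝ)) (fun i => (bX n i : ℝ)) (fun i => (bY d i : ℝ)) (bV α γ) t1 t2 s ≠ 0) :
    1 ≤ |bg (fun i => (p i : ℝ)) (fun i => (bX n i : ℝ)) (fun i => (bY d i : ℝ)) (bV α γ) t1 t2 s| *
      ((Fintype.card (BI A L) : ℝ) * P * (B:ℝ) ^ (2 * T) * (200 ^ A) ^ s) ^ (D + 1) := by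
  set b := bg (fun i => (p i : ℝ)) (fun i => (bX n i : ℝ)) (fun i => (bY d i : ℝ)) (bV α γ) t1 t2 s with hb
  set Zs : ℝ := (Fintype.card (BI A L) : ℝ) * P * (B:ℝ) ^ (2 * T) * (200 ^ A) ^ s with hZs
  let Q : ℤ[X] := ∑ i : BI A L, C (p i * bX n i ^ t1 * bY d i ^ t2 * 10 ^ ((i.2.1 : ℕ) * s)) *
    (X ^ ((i.1 : ℕ) * s) * (G1 ^ ((i.2.2 : ℕ) * s) * G2 ^ ((L - (i.2.2 : ℕ)) * s)))
  have hcard : (1:ℝ) ≤ Fintype.card (BI A L) := by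
    rw [BI_card]; exact_mod_cast Nat.mul_pos (by omega) (Nat.mul_pos (by omega) (by omega))
  have hBr : (1:ℝ) ≤ B := by exact_mod_cast hB
  have hPr : (1:ℝ) ≤ P := by exact_mod_cast hP
  have hK1 : 1 ≤ (Fintype.card (BI A L) : ℝ) * P * (B:ℝ) ^ (2 * T) :=
    one_le_mul_of_one_le_of_one_le (one_le_mul_of_one_le_of_one_le hcard hPr) (one_le_pow₀ hBr)
  have hZ1 : 1 ≤ Zs := by
    rw [hZs]
    exact one_le_mul_of_one_le_of_one_le hK1 (one_le_pow₀ (one_le_pow₀ (by norm_num)))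
  have hQα : aeval α Q = b * (aeval α G2) ^ (L * s) := by
    simp only [Q, map_sum, map_mul, map_pow, aeval_X, hb, bg, Finset.sum_mul]
    apply Finset.sum_congr rfl
    intro i _
    have hi : (i.2.2 : ℕ) ≤ L := by have := i.2.2.2; omega
    have e1 : L * s = (i.2.2 : ℕ) * s + (L - (i.2.2 : ℕ)) * s := by rw [← add_mul]; congr 1; omega
    rw [e1, pow_add]
    simp only [bV, hγ, mul_pow, div_pow, ← pow_mul]
    simp only [eq_intCast, map_intCast, map_ofNat]
    field_simp
  have hQz : ∀ z : ℂ, ‖z‖ ≤ 2 → ‖aeval z Q‖ ≤ Zs := by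
    intro z hz
    have hterm : ∀ i ∈ (Finset.univ : Finset (BI A L)), ‖aeval z (C (p i * bX n i ^ t1 * bY d i ^ t2 * 10 ^ ((i.2.1 : ℕ) * s)) *
      (X ^ ((i.1 : ℕ) * s) * (G1 ^ ((i.2.2 : ℕ) * s) * G2 ^ ((L - (i.2.2 : ℕ)) * s))) : ℤ[X])‖ ≤ P * (B:ℝ) ^ (2*T) * (200 ^ A) ^ s := by
      intro i _
      have hi : (i.2.2 : ℕ) ≤ L := by have := i.2.2.2; omega
      have hi1 : (i.1 : ℕ) ≤ A := by have := i.1.2; omega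
      have hi2 : (i.2.1 : ℕ) ≤ A := by have := i.2.1.2; omega
      have hc := abs_coef_le (fun i => (p i : ℝ)) (fun i => (bX n i : ℝ)) (fun i => (bY d i : ℝ)) P B T hBr
        (fun i => by exact_mod_cast hp i) (bX_le hB1) (bY_le hB2) i t1 t2 h1 h2
      simp only [map_mul, map_pow, aeval_X, norm_mul, norm_pow]
      have e1 : ‖aeval z (C (p i) : ℤ[X])‖ * ‖aeval z (C (bX n i) : ℤ[X])‖ ^ t1 * ‖aeval z (C (bY d i) : ℤ[X])‖ ^ t2 =
          |(p i : ℝ) * (bX n i : ℝ) ^ t1 * (bY d i : ℝ) ^ t2| := by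
        simp only [eq_intCast, map_intCast, Complex.norm_intCast, abs_mul, abs_pow]
      have e2 : ‖aeval z (C 10 : ℤ[X])‖ = 10 := by simp [map_ofNat]
      rw [e1, e2]
      have g1 : (10:ℝ) ^ ((i.2.1 : ℕ) * s) ≤ 10 ^ (A * s) := pow_le_pow_right₀ (by norm_num) (Nat.mul_le_mul_right _ hi2)
      have g2 : ‖z‖ ^ ((i.1 : ℕ) * s) ≤ 2 ^ (A * s) :=
        (pow_le_pow_left₀ (norm_nonneg _) hz _).trans (pow_le_pow_right₀ (by norm_num) (Nat.mul_le_mul_right _ hi1))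
      have g3 : ‖aeval z G1‖ ^ ((i.2.2 : ℕ) * s) * ‖aeval z G2‖ ^ ((L - (i.2.2 : ℕ)) * s) ≤ 10 ^ (A * s) := by
        calc ‖aeval z G1‖ ^ ((i.2.2 : ℕ) * s) * ‖aeval z G2‖ ^ ((L - (i.2.2 : ℕ)) * s)
            ≤ (10 ^ g) ^ ((i.2.2 : ℕ) * s) * (10 ^ g) ^ ((L - (i.2.2 : ℕ)) * s) := by
              have := hG1 z hz; have := hG2 z hz; gcongr
          _ = 10 ^ (A * s) := by
              rw [← pow_add, ← add_mul, ← pow_mul, show (i.2.2 : ℕ) + (L - (i.2.2 : ℕ)) = L by omega,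
                ← mul_assoc, ← hA]
      calc _ ≤ P * (B:ℝ) ^ (2*T) * 10 ^ (A * s) * (2 ^ (A * s) * 10 ^ (A * s)) := by gcongr
        _ = P * (B:ℝ) ^ (2*T) * (10 * 2 * 10) ^ (A * s) := by rw [mul_pow, mul_pow]; ring
        _ = _ := by rw [← pow_mul]; norm_num
    simp only [Q, map_sum]
    refine (norm_sum_le _ _).trans ((Finset.sum_le_sum hterm).trans (le_of_eq ?_))
    rw [Finset.sum_const, Finset.card_univ, nsmul_eq_mul, hZs]; ring
  have hG2α : |aeval α G2| ≤ 10 ^ g := by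
    have := hG2 (α : ℂ) (by rw [Complex.norm_real, Real.norm_eq_abs, abs_of_nonneg (by linarith)]; exact hα2)
    have e : aeval (α : ℂ) G2 = ((aeval α G2 : ℝ) : ℂ) := by
      exact aeval_algebraMap_apply ℂ α G2
    rwa [e, Complex.norm_real, Real.norm_eq_abs] at this
  have h3 := hL Q Zs hZ1 hQz (by rw [hQα]; exact mul_ne_zero hne (pow_ne_zero _ hG2p))
  rw [hQα, abs_mul, abs_pow] at h3
  refine h3.trans ?_
  rw [mul_assoc, pow_succ']
  gcongr
  calc |aeval α G2| ^ (L * s) ≤ (10 ^ g) ^ (L * s) := by gcongr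
    _ = (10 ^ A) ^ s := by rw [hA, ← pow_mul, ← pow_mul]; congr 1; ring
    _ ≤ (200 ^ A) ^ s := by gcongr; norm_num
    _ ≤ Zs := le_mul_of_one_le_left (by positivity) hK1

lemma bV_pos {A L : ℕ} {α γ : ℝ} (hα : 0 < α) (hγ : 0 < γ) (i : BI A L) : 0 < bV α γ i := by
  unfold bV; positivity

lemma bV_le {A L g : ℕ} {α γ : ℝ} (hA : A = g * L) (hα : 1 ≤ α) (hα2 : α ≤ 2) (hγ : 0 < γ) (hγ2 : γ ≤ 10 ^ g)
    (i : BI A L) : bV α γ i ≤ 200 ^ A := by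
  have hi : (i.2.2 : ℕ) ≤ L := by have := i.2.2.2; omega
  have hi1 : (i.1 : ℕ) ≤ A := by have := i.1.2; omega
  have hi2 : (i.2.1 : ℕ) ≤ A := by have := i.2.1.2; omega
  unfold bV
  have g1 : (10:ℝ) ^ ((i.2.1 : ℕ)) ≤ 10 ^ A := pow_le_pow_right₀ (by norm_num) hi2
  have g2 : α ^ ((i.1 : ℕ)) ≤ 2 ^ A :=
        (pow_le_pow_left₀ (by linarith) hα2 _).trans (pow_le_pow_right₀ (by norm_num) hi1)
  have g3 : γ ^ ((i.2.2 : ℕ)) ≤ 10 ^ A := by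
    refine (pow_le_pow_left₀ hγ.le hγ2 _).trans ?_
    rw [← pow_mul]
    exact pow_le_pow_right₀ (by norm_num) ((Nat.mul_le_mul_left _ hi).trans hA.ge)
  calc _ ≤ (2:ℝ) ^ A * 10 ^ A * 10 ^ A := by gcongr
    _ = 200 ^ A := by rw [← mul_pow, ← mul_pow]; norm_num

lemma log_ten_le : Real.log 10 ≤ 2.4 := by
  have h : Real.log 10 = Real.log 2 + Real.log 5 := by rw [← Real.log_mul] <;> norm_num
  have h1 : Real.log 10 * 3 ≤ Real.log 2 * 10 := by
    have h3 : Real.log 10 * 3 = Real.log (10 ^ 3) := by rw [Real.log_pow]; push_cast; ring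
    have h4 : Real.log 2 * 10 = Real.log (2 ^ 10) := by rw [Real.log_pow]; push_cast; ring
    rw [h3, h4]; exact Real.log_le_log (by norm_num) (by norm_num)
  have := Real.log_two_lt_d9
  linarith

lemma bV_log {A L g : ℕ} {α γ : ℝ} (hA : A = g * L) (hα : 1 ≤ α) (hα2 : α ≤ 2) (hγ : 0 < γ) (hγ2 : γ ≤ 10 ^ g)
    (hγ3 : 1 ≤ γ * 10 ^ g) (i : BI A L) : |Real.log (bV α γ i)| ≤ 5.6 * A := by
  have hi : ((i.2.2 : ℕ) : ℝ) ≤ L := by have := i.2.2.2; exact_mod_cast (by omega : (i.2.2 : ℕ) ≤ L)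
  have hi1 : ((i.1 : ℕ) : ℝ) ≤ A := by have := i.1.2; exact_mod_cast (by omega : (i.1 : ℕ) ≤ A)
  have hi2 : ((i.2.1 : ℕ) : ℝ) ≤ A := by have := i.2.1.2; exact_mod_cast (by omega : (i.2.1 : ℕ) ≤ A)
  have hlog : Real.log (bV α γ i) = (i.1 : ℕ) * Real.log α + (i.2.1 : ℕ) * Real.log 10 + (i.2.2 : ℕ) * Real.log γ := by
    unfold bV
    rw [Real.log_mul (by positivity) (by positivity), Real.log_mul (by positivity) (by positivity),
      Real.log_pow, Real.log_pow, Real.log_pow]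
  have h10 := log_ten_le
  have h10' : 0 ≤ Real.log 10 := Real.log_nonneg (by norm_num)
  have ha0 : 0 ≤ Real.log α := Real.log_nonneg hα
  have ha1 : Real.log α ≤ 0.7 := by
    have := Real.log_le_log (by linarith) hα2
    have := Real.log_two_lt_d9
    linarith
  have hg : |Real.log γ| ≤ g * 2.4 := by
    have h1 : Real.log γ ≤ g * Real.log 10 := by
      rw [← Real.log_pow]; exact Real.log_le_log hγ hγ2
    have h2 : 0 ≤ Real.log γ + g * Real.log 10 := by
      rw [← Real.log_pow, ← Real.log_mul (by positivity) (by positivity)]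
      exact Real.log_nonneg hγ3
    have h3 : g * Real.log 10 ≤ g * 2.4 := by gcongr
    rw [abs_le]; constructor <;> linarith
  rw [hlog]
  have e1 : |((i.1 : ℕ) : ℝ) * Real.log α| ≤ A * 0.7 := by
    rw [abs_of_nonneg (by positivity)]; gcongr
  have e2 : |((i.2.1 : ℕ) : ℝ) * Real.log 10| ≤ A * 2.4 := by
    rw [abs_of_nonneg (by positivity)]; gcongr
  have e3 : |((i.2.2 : ℕ) : ℝ) * Real.log γ| ≤ L * (g * 2.4) := by
    rw [abs_mul, abs_of_nonneg (Nat.cast_nonneg _ : (0:ℝ) ≤ ((i.2.2 : ℕ) : ℝ))]; gcongr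
  have e4 : (L:ℝ) * (g * 2.4) = A * 2.4 := by rw [hA]; push_cast; ring
  rw [e4] at e3
  have := abs_add_three (((i.1 : ℕ) : ℝ) * Real.log α) (((i.2.1 : ℕ) : ℝ) * Real.log 10) (((i.2.2 : ℕ) : ℝ) * Real.log γ)
  linarith

end

section

open Polynomial

/-- The size parameter in the extrapolation. -/
noncomputable def bZ (A L T P B M : ℕ) : ℝ :=
  (Fintype.card (BI A L) : ℝ) * P * (B:ℝ) ^ (2 * T) * (200 ^ A) ^ M

lemma bVX_inj {A L n : ℕ} {α γ : ℝ} (hα0 : 0 < α) (hγ0 : 0 < γ) (hAn : A < n) (i j : BI A L)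
    (hVij : bV α γ i = bV α γ j) (hXi : bX n i = bX n j) : i = j := by
  obtain ⟨i1, i2, i3⟩ := i
  obtain ⟨j1, j2, j3⟩ := j
  unfold bX at hXi
  unfold bV at hVij
  simp only at hXi hVij
  have hi1 := i1.2
  have hj1 := j1.2
  have h3 : (i3 : ℕ) = (j3 : ℕ) := by
    by_contra hne
    rcases Nat.lt_or_gt_of_ne hne with h | h
    · have h' : (n:ℤ) * ((i3 : ℕ) : ℤ) + n ≤ n * ((j3 : ℕ) : ℤ) := by
        have : ((i3 : ℕ) : ℤ) + 1 ≤ ((j3 : ℕ) : ℤ) := by exact_mod_cast h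
        nlinarith
      omega
    · have h' : (n:ℤ) * ((j3 : ℕ) : ℤ) + n ≤ n * ((i3 : ℕ) : ℤ) := by
        have : ((j3 : ℕ) : ℤ) + 1 ≤ ((i3 : ℕ) : ℤ) := by exact_mod_cast h
        nlinarith
      omega
  have h1 : (i1 : ℕ) = (j1 : ℕ) := by rw [h3] at hXi; omega
  have h2 : (i2 : ℕ) = (j2 : ℕ) := by
    rw [h1, h3] at hVij
    have h5 := mul_right_cancel₀ (pow_ne_zero _ hγ0.ne') hVij
    have h4 : (10:ℝ) ^ (i2 : ℕ) = 10 ^ (j2 : ℕ) := mul_left_cancel₀ (pow_ne_zero _ hα0.ne') h5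
    exact pow_right_injective₀ (by norm_num) (by norm_num) h4
  exact Prod.ext (Fin.ext h1) (Prod.ext (Fin.ext h2) (Fin.ext h3))

lemma bV_class {A L : ℕ} {α γ : ℝ} (hα0 : 0 < α) (hγ0 : 0 < γ)
    (hind : ∀ i j : ℤ, α ^ i * 10 ^ j = 1 → i = 0 ∧ j = 0) (i : BI A L) :
    (Finset.univ.filter (fun j : BI A L => bV α γ j = bV α γ i)).card ≤ L + 1 := by
  have : (Finset.univ.filter (fun j : BI A L => bV α γ j = bV α γ i)).card ≤ (Finset.univ : Finset (Fin (L+1))).card := by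
    apply Finset.card_le_card_of_injOn (fun j => j.2.2) (fun _ _ => Finset.mem_coe.mpr (Finset.mem_univ _))
    intro a ha b hb hab
    have ha' := (Finset.mem_filter.mp (Finset.mem_coe.mp ha)).2
    have hb' := (Finset.mem_filter.mp (Finset.mem_coe.mp hb)).2
    have hVab : bV α γ a = bV α γ b := ha'.trans hb'.symm
    obtain ⟨a1, a2, a3⟩ := a
    obtain ⟨b1, b2, b3⟩ := b
    simp only at hab
    subst hab
    unfold bV at hVab
    simp only at hVab
    have h5 := mul_right_cancel₀ (pow_ne_zero _ hγ0.ne') hVab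
    have h6 := hind ((a1 : ℕ) - (b1 : ℕ)) ((a2 : ℕ) - (b2 : ℕ)) (by
      rw [zpow_sub₀ hα0.ne', zpow_sub₀ (by norm_num)]
      simp only [zpow_natCast]
      rw [div_mul_div_comm, h5, div_self (by positivity)])
    have h7 : (a1 : ℕ) = (b1 : ℕ) := by omega
    have h8 : (a2 : ℕ) = (b2 : ℕ) := by omega
    exact Prod.ext (Fin.ext h7) (Prod.ext (Fin.ext h8) rfl)
  simpa using this

theorem baker_core (α γ ε : ℝ) (D g L A n d B T P S₀ σ J τ : ℕ) (G1 G2 : ℤ[X]) (hL : Liou α D)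
    (hα1 : 1 < α) (hα2 : α ≤ 2)
    (hind : ∀ i j : ℤ, α ^ i * 10 ^ j = 1 → i = 0 ∧ j = 0)
    (hA : A = g * L) (hg : 1 ≤ g) (hL1 : 1 ≤ L)
    (hG1 : ∀ z : ℂ, ‖z‖ ≤ 2 → ‖aeval z G1‖ ≤ 10 ^ g)
    (hG2 : ∀ z : ℂ, ‖z‖ ≤ 2 → ‖aeval z G2‖ ≤ 10 ^ g)
    (hG2p : aeval α G2 ≠ 0) (hγ : γ = aeval α G1 / aeval α G2)
    (hγ0 : 0 < γ) (hγ2 : γ ≤ 10 ^ g) (hγ3 : 1 ≤ γ * 10 ^ g)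
    (hB1 : A + n * L ≤ B) (hB2 : A + d * L ≤ B) (hAn : A < n)
    (hP : P = Fintype.card (BI A L) * (B ^ (2 * T) * (200 ^ A) ^ S₀))
    (hcard : (2 * (D + 1) + 3) * (T * (T * S₀)) ≤ Fintype.card (BI A L))
    (hS0 : 1 ≤ S₀) (hσ : 3 ≤ σ) (hT : L + 1 + J * τ ≤ T)
    (hJ : Fintype.card (BI A L) ≤ σ ^ J * S₀)
    (hε : |n * Real.log α - d * Real.log 10 + Real.log γ| ≤ ε)
    (hsm : ∀ j < J, L * ((σ ^ (j+1) * S₀ : ℕ) : ℝ) * ε ≤ 1)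
    (H1 : ∀ j < J, 4 * (bZ A L T P B (σ ^ (j+1) * S₀)) ^ (D + 2) *
      Real.exp (6 * A * (9 * ((σ ^ (j+1) * S₀ : ℕ) : ℝ))) ≤ 8 ^ (σ ^ j * S₀ * τ))
    (H2 : ∀ j < J, ε * (2 * L * ((σ ^ (j+1) * S₀ : ℕ) : ℝ)) * (12 * (bZ A L T P B (σ ^ (j+1) * S₀)) ^ (D + 2) *
      (((σ ^ (j+1) * S₀ : ℕ) : ℝ) * (τ + 2) + 1 : ℝ) ^ (σ ^ j * S₀ * τ) * 4 ^ τ) ≤ 1) : False := by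
  classical
  have hα0 : 0 < α := by linarith
  have hA1 : 1 ≤ A := by rw [hA]; exact Nat.mul_pos hg hL1
  have hB : 1 ≤ B := by omega
  have hBr : (1:ℝ) ≤ B := by exact_mod_cast hB
  have hcard1 : 1 ≤ Fintype.card (BI A L) := by
    rw [BI_card]; exact Nat.mul_pos (by omega) (Nat.mul_pos (by omega) (by omega))
  have hcard8 : 3 ≤ Fintype.card (BI A L) := by
    rw [BI_card]
    nlinarith [Nat.mul_le_mul (by omega : 2 ≤ A + 1) (by omega : 2 ≤ L + 1)]
  have hU1 : 1 ≤ B ^ (2 * T) * (200 ^ A) ^ S₀ := Nat.mul_pos (pow_pos hB _) (by positivity)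
  have hP3 : 3 ≤ P := by rw [hP]; nlinarith
  set X : BI A L → ℝ := fun i => (bX n i : ℝ) with hX
  set Y : BI A L → ℝ := fun i => (bY d i : ℝ) with hY
  set V : BI A L → ℝ := bV α γ with hV
  have hXB : ∀ i, |X i| ≤ B := bX_le hB1
  have hYB : ∀ i, |Y i| ≤ B := bY_le hB2
  have hV0 : ∀ i, 0 < V i := fun i => bV_pos hα0 hγ0 i
  have hVm : ∀ i, V i ≤ 200 ^ A := fun i => bV_le hA hα1.le hα2 hγ0 hγ2 i
  have h200 : (1:ℝ) ≤ 200 ^ A := one_le_pow₀ (by norm_num)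
  have hliou : ∀ p : BI A L → ℤ, (∀ i, |p i| ≤ P) → ∀ t1 t2 s, t1 ≤ T → t2 ≤ T →
      bg (fun i => (p i : ℝ)) X Y V t1 t2 s ≠ 0 → 1 ≤ |bg (fun i => (p i : ℝ)) X Y V t1 t2 s| * (bZ A L T P B s) ^ (D+1) :=
    fun p hp t1 t2 s h1 h2 hne => bg_liou α γ D g L A n d B T P G1 G2 hL hα1.le hα2 hA hG1 hG2 hG2p hγ hB1 hB2 hB (by omega)
      p hp t1 t2 s h1 h2 hne
  have hZmono : ∀ s M, s ≤ M → bZ A L T P B s ≤ bZ A L T P B M := by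
    intro s M h
    unfold bZ
    have := pow_le_pow_right₀ h200 h
    gcongr
  have hZ0 : ∀ s, 0 ≤ bZ A L T P B s := by intro s; unfold bZ; positivity
  -- pigeonhole
  obtain ⟨p, hp0, hpP, hpz⟩ := pigeon (ι := BI A L) (κ := Fin T × Fin T × Fin S₀)
    (fun k i => X i ^ (k.1 : ℕ) * Y i ^ (k.2.1 : ℕ) * V i ^ (k.2.2 : ℕ)) ((B:ℝ) ^ (2*T) * (200 ^ A) ^ S₀) P (D+1)
    (by
      intro k i
      have h := abs_coef_le (fun _ : BI A L => (1:ℝ)) X Y 1 B T hBr (fun _ => by simp) hXB hYB i k.1 k.2.1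
        k.1.2.le k.2.1.2.le
      simp only [one_mul] at h
      rw [abs_mul]
      have h2 : |V i ^ (k.2.2 : ℕ)| ≤ (200 ^ A) ^ S₀ := by
        rw [abs_of_pos (pow_pos (hV0 i) _)]
        exact (pow_le_pow_left₀ (hV0 i).le (hVm i) _).trans (pow_le_pow_right₀ h200 k.2.2.2.le)
      gcongr)
    hP3 (by rw [hP]; push_cast; exact le_rfl)
    (by simpa using hcard) hcard1
    (by
      intro p hp k hne
      have e : ∑ i, (p i : ℝ) * (X i ^ (k.1 : ℕ) * Y i ^ (k.2.1 : ℕ) * V i ^ (k.2.2 : ℕ)) =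
          bg (fun i => (p i : ℝ)) X Y V k.1 k.2.1 k.2.2 := by
        unfold bg; apply Finset.sum_congr rfl; intros; ring
      simp only [e] at hne ⊢
      refine (hliou p hp _ _ _ k.1.2.le k.2.1.2.le hne).trans ?_
      gcongr
      · exact hZ0 _
      · refine (hZmono _ S₀ k.2.2.2.le).trans (le_of_eq ?_)
        unfold bZ
        have : (P:ℝ) = Fintype.card (BI A L) * ((B:ℝ) ^ (2 * T) * (200 ^ A) ^ S₀) := by rw [hP]; push_cast; rfl
        rw [sq]; nth_rewrite 3 [this]; ring)
  set pr : BI A L → ℝ := fun i => (p i : ℝ) with hpr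
  have hprP : ∀ i, |pr i| ≤ P := by intro i; simp only [hpr]; exact_mod_cast hpP i
  have hstage : ∀ j, j ≤ J → ∀ t1 t2 s, t1 < T - j * τ → t2 < T - j * τ → s < σ ^ j * S₀ → bg pr X Y V t1 t2 s = 0 := by
    intro j
    induction j with
    | zero =>
      intro _ t1 t2 s h1 h2 hs
      have := hpz (⟨t1, by omega⟩, ⟨t2, by omega⟩, ⟨s, by simpa using hs⟩)
      simp only at this
      rw [← this]
      unfold bg; apply Finset.sum_congr rfl; intros; ring
    | succ j ih =>
      intro hj t1 t2 s h1 h2 hs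
      have hjτ : (j+1) * τ ≤ J * τ := Nat.mul_le_mul_right _ hj
      have hjτ' : (j+1) * τ = j * τ + τ := by ring
      have hSM : σ ^ j * S₀ ≤ σ ^ (j+1) * S₀ := Nat.mul_le_mul_right _ (Nat.pow_le_pow_right (by omega) (by omega))
      have hM3 : 3 ≤ σ ^ (j+1) * S₀ := by
        have : σ ^ 1 ≤ σ ^ (j+1) := Nat.pow_le_pow_right (by omega) (by omega)
        nlinarith
      set M := σ ^ (j+1) * S₀ with hM
      have hsmj := hsm j (by omega)
      have hε0 : 0 ≤ ε := (abs_nonneg _).trans hε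
      have hLr : (1:ℝ) ≤ L := by exact_mod_cast hL1
      have hLam := hε
      set Lam := n * Real.log α - d * Real.log 10 + Real.log γ with hLamdef
      have hlog : ∀ i : BI A L, Real.log (V i) = (i.1 : ℕ) * Real.log α + (i.2.1 : ℕ) * Real.log 10 + (i.2.2 : ℕ) * Real.log γ := by
        intro i
        simp only [hV, bV]
        rw [Real.log_mul (by positivity) (by positivity), Real.log_mul (by positivity) (by positivity),
          Real.log_pow, Real.log_pow, Real.log_pow]
      refine extrap pr X Y (fun i => X i * Real.log α + Y i * Real.log 10) V (fun i => ((i.2.2 : ℕ) : ℝ)) P B Lam ε L (200 ^ A) (6 * A)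
        (Real.log α) (Real.log 10) T M (σ ^ j * S₀) τ (T - (j+1) * τ) (D+1) hBr (by exact_mod_cast (by omega : 1 ≤ P)) hLr hprP hXB hYB
        (fun i => Nat.cast_nonneg _) ?_ hV0 hVm h200 ?_ hLam ?_ (fun i => rfl) (Real.log_nonneg hα1.le) (Real.log_nonneg (by norm_num))
        ?_ ?_ hSM (by omega) hcard1 (by omega) ?_ (H1 j (by omega)) (H2 j (by omega)) ?_ t1 t2 s h1 h2 hs.le
      · intro i
        have := i.2.2.2
        exact_mod_cast (by omega : (i.2.2 : ℕ) ≤ L)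
      · intro i
        rw [hlog i, hLamdef]
        simp only [hX, hY, bX, bY]; push_cast; ring
      · exact hsmj
      · have h1 := log_ten_le
        have h2 := Real.log_le_log hα0 hα2
        have := Real.log_two_lt_d9
        linarith
      · intro i
        have e : X i * Real.log α + Y i * Real.log 10 = Real.log (V i) - (i.2.2 : ℕ) * Lam := by
          rw [hlog i, hLamdef]
          simp only [hX, hY, bX, bY]; push_cast; ring
        rw [e]
        have h1 := bV_log hA hα1.le hα2 hγ0 hγ2 hγ3 i
        have h2 : |((i.2.2 : ℕ) : ℝ) * Lam| ≤ L * ε := by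
          rw [abs_mul, abs_of_nonneg (Nat.cast_nonneg _ : (0:ℝ) ≤ ((i.2.2 : ℕ) : ℝ))]
          have := i.2.2.2
          have : ((i.2.2 : ℕ) : ℝ) ≤ L := by exact_mod_cast (by omega : (i.2.2 : ℕ) ≤ L)
          gcongr
        have h3 : (L:ℝ) * ε ≤ 1/3 := by
          have hMr : (3:ℝ) ≤ M := by exact_mod_cast hM3
          have : (L:ℝ) * ε * 3 ≤ L * ε * M := by gcongr
          linarith
        have hAr : (1:ℝ) ≤ A := by exact_mod_cast hA1
        have h4 := abs_sub (Real.log (V i)) (((i.2.2 : ℕ) : ℝ) * Lam)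
        linarith
      · intro t1 t2 s a b c hne
        refine (hliou p hpP t1 t2 s a b hne).trans ?_
        have := hZmono s M c
        refine mul_le_mul_of_nonneg_left (pow_le_pow_left₀ (hZ0 _) this _) (abs_nonneg _)
      · intro t1 t2 s a b c
        exact ih (by omega) t1 t2 s (by omega) (by omega) c
  have hfin := hstage J le_rfl
  have hz := zero_est pr X Y V (L+1) ?_ ?_ ?_
  · apply hp0
    funext i
    have := hz i
    simp only [hpr] at this
    exact_mod_cast this
  · intro i j hVij hXij
    exact bVX_inj hα0 hγ0 hAn i j hVij (by simpa [hX] using hXij)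
  · intro i
    exact bV_class hα0 hγ0 hind i
  · intro t s ht hs
    exact hfin t 0 s (by omega) (by omega) (by omega)

end

section

open Polynomial

lemma bZ_le (A L T c bB S₀ M P : ℕ) (hc : Fintype.card (BI A L) ≤ 2 ^ c)
    (hP : P = Fintype.card (BI A L) * ((2 ^ bB) ^ (2 * T) * (200 ^ A) ^ S₀)) :
    bZ A L T P (2 ^ bB) M ≤ 2 ^ (2 * c + 4 * T * bB + 8 * A * (S₀ + M)) := by
  unfold bZ
  have h1 : ((Fintype.card (BI A L) : ℕ) : ℝ) ≤ 2 ^ c := by exact_mod_cast hc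
  have h2 : (P:ℝ) = (Fintype.card (BI A L) : ℝ) * ((2 ^ bB) ^ (2 * T) * (200 ^ A) ^ S₀) := by rw [hP]; push_cast; rfl
  rw [h2]
  push_cast
  have h3 : ∀ q : ℕ, ((200:ℝ) ^ A) ^ q ≤ 2 ^ (8 * A * q) := by
    intro q
    rw [← pow_mul, mul_assoc, pow_mul 2 8]
    gcongr; norm_num
  calc (Fintype.card (BI A L) : ℝ) * ((Fintype.card (BI A L) : ℝ) * ((2 ^ bB) ^ (2 * T) * (200 ^ A) ^ S₀)) *
        (2 ^ bB) ^ (2 * T) * (200 ^ A) ^ M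
      ≤ 2 ^ c * (2 ^ c * ((2 ^ bB) ^ (2 * T) * 2 ^ (8 * A * S₀))) * (2 ^ bB) ^ (2 * T) * 2 ^ (8 * A * M) := by
        have := h3 S₀; have := h3 M; gcongr
    _ = _ := by rw [← pow_mul, ← pow_add, ← pow_add, ← pow_add, ← pow_add, ← pow_add]; congr 1; ring

/-- A lower bound for linear forms in three logarithms, with free parameters. -/
theorem baker_param (α γ : ℝ) (D g L A n d T S₀ σ J τ c bB w : ℕ) (G1 G2 : ℤ[X]) (hL : Liou α D)
    (hα1 : 1 < α) (hα2 : α ≤ 2)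
    (hind : ∀ i j : ℤ, α ^ i * 10 ^ j = 1 → i = 0 ∧ j = 0)
    (hA : A = g * L) (hg : 1 ≤ g) (hL1 : 1 ≤ L)
    (hG1 : ∀ z : ℂ, ‖z‖ ≤ 2 → ‖aeval z G1‖ ≤ 10 ^ g)
    (hG2 : ∀ z : ℂ, ‖z‖ ≤ 2 → ‖aeval z G2‖ ≤ 10 ^ g)
    (hG2p : aeval α G2 ≠ 0) (hγ : γ = aeval α G1 / aeval α G2)
    (hγ0 : 0 < γ) (hγ2 : γ ≤ 10 ^ g) (hγ3 : 1 ≤ γ * 10 ^ g)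
    (hB1 : A + n * L ≤ 2 ^ bB) (hB2 : A + d * L ≤ 2 ^ bB) (hAn : A < n)
    (hcard : (2 * D + 5) * (T * (T * S₀)) ≤ (A+1) * ((A+1) * (L+1)))
    (hcard2 : (A+1) * ((A+1) * (L+1)) ≤ 2 ^ c)
    (hS0 : 1 ≤ S₀) (hσ : 3 ≤ σ) (hT : T = L + 1 + J * τ) (hJ1 : 1 ≤ J) (hτ : 1 ≤ τ)
    (hJ : (A+1) * ((A+1) * (L+1)) ≤ σ ^ J * S₀)
    (hC : 2 + (D+2) * (2 * c + 4 * T * bB + 8 * A * S₀) + (8 * (D+2) + 81) * A * σ * S₀ ≤ 3 * S₀ * τ)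
    (hw1 : 8 * (σ ^ J * S₀ * (τ + 2) + 1) ≤ 2 ^ w) (hw2 : 6 * L * (σ ^ J * S₀) ≤ 2 ^ w) :
    (1/2 : ℝ) ^ (w * (σ ^ J * S₀ * τ)) < |n * Real.log α - d * Real.log 10 + Real.log γ| := by
  by_contra hcon
  push Not at hcon
  set ε : ℝ := (1/2 : ℝ) ^ (w * (σ ^ J * S₀ * τ)) with hε
  have hε0 : 0 < ε := by positivity
  have hε1 : ε * 2 ^ (w * (σ ^ J * S₀ * τ)) = 1 := by rw [hε, ← mul_pow]; norm_num
  have hM : ∀ j < J, σ ^ (j+1) * S₀ ≤ σ ^ J * S₀ := fun j hj =>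
    Nat.mul_le_mul_right _ (Nat.pow_le_pow_right (by omega) (by omega))
  have hMS : ∀ j, σ ^ (j+1) * S₀ = σ * (σ ^ j * S₀) := fun j => by ring
  have hSp : ∀ j, 1 ≤ σ ^ j * S₀ := fun j => Nat.mul_pos (pow_pos (by omega) _) hS0
  set P := Fintype.card (BI A L) * ((2 ^ bB) ^ (2 * T) * (200 ^ A) ^ S₀) with hP
  have hw3 : 3 ≤ w := by
    by_contra h
    have : 2 ^ w ≤ 2 ^ 2 := Nat.pow_le_pow_right (by norm_num) (by omega)
    omega
  have H1' : ∀ j < J, 4 * (bZ A L T P (2 ^ bB) (σ ^ (j+1) * S₀)) ^ (D + 2) *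
      Real.exp (6 * A * (9 * ((σ ^ (j+1) * S₀ : ℕ) : ℝ))) ≤ 8 ^ (σ ^ j * S₀ * τ) := by
    intro j hj
    have hz := bZ_le A L T c bB S₀ (σ ^ (j+1) * S₀) P (by rw [BI_card]; exact hcard2) hP
    have hz0 : 0 ≤ bZ A L T P (2 ^ bB) (σ ^ (j+1) * S₀) := by unfold bZ; positivity
    set M := σ ^ (j+1) * S₀ with hMdef
    have hexp : Real.exp (6 * A * (9 * (M:ℝ))) ≤ 2 ^ (81 * A * M) := by
      have h2 : (2:ℝ) ^ (81 * A * M) = Real.exp (Real.log 2 * (81 * A * M : ℕ)) := by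
        rw [Real.exp_mul, Real.exp_log (by norm_num), Real.rpow_natCast]
      rw [h2]
      apply Real.exp_le_exp.mpr
      have h3 := Real.log_two_gt_d9
      have h4 : (0:ℝ) ≤ A * M := by positivity
      push_cast
      nlinarith
    have hexpn : 2 + (2 * c + 4 * T * bB + 8 * A * (S₀ + M)) * (D+2) + 81 * A * M ≤ 3 * (σ ^ j * S₀ * τ) := by
      have hs1 : 1 ≤ σ ^ j := Nat.pos_of_ne_zero (pow_ne_zero _ (by omega))
      have e1 : M = σ ^ j * (σ * S₀) := by rw [hMdef]; ring
      have h5 := Nat.mul_le_mul_left (σ ^ j) hC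
      have h6 : 2 + (D+2) * (2 * c + 4 * T * bB + 8 * A * S₀) ≤ σ ^ j * (2 + (D+2) * (2 * c + 4 * T * bB + 8 * A * S₀)) :=
        Nat.le_mul_of_pos_left _ hs1
      calc 2 + (2 * c + 4 * T * bB + 8 * A * (S₀ + M)) * (D+2) + 81 * A * M
          = 2 + (D+2) * (2 * c + 4 * T * bB + 8 * A * S₀) + σ ^ j * ((8 * (D+2) + 81) * A * σ * S₀) := by rw [e1]; ring
        _ ≤ σ ^ j * (2 + (D+2) * (2 * c + 4 * T * bB + 8 * A * S₀)) + σ ^ j * ((8 * (D+2) + 81) * A * σ * S₀) := by gcongr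
        _ = σ ^ j * (2 + (D+2) * (2 * c + 4 * T * bB + 8 * A * S₀) + (8 * (D+2) + 81) * A * σ * S₀) := by ring
        _ ≤ σ ^ j * (3 * S₀ * τ) := h5
        _ = _ := by ring
    calc 4 * (bZ A L T P (2 ^ bB) M) ^ (D + 2) * Real.exp (6 * A * (9 * (M:ℝ)))
        ≤ 2 ^ 2 * (2 ^ (2 * c + 4 * T * bB + 8 * A * (S₀ + M))) ^ (D+2) * 2 ^ (81 * A * M) := by
          gcongr; norm_num
      _ = 2 ^ (2 + (2 * c + 4 * T * bB + 8 * A * (S₀ + M)) * (D+2) + 81 * A * M) := by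
          rw [← pow_mul, ← pow_add, ← pow_add]
      _ ≤ 2 ^ (3 * (σ ^ j * S₀ * τ)) := pow_le_pow_right₀ (by norm_num) hexpn
      _ = 8 ^ (σ ^ j * S₀ * τ) := by rw [pow_mul]; norm_num
  have hw2r : (6:ℝ) * L * ((σ ^ J * S₀ : ℕ) : ℝ) ≤ 2 ^ w := by exact_mod_cast hw2
  have hbig : w * (σ ^ (J-1) * S₀ * τ + 1) + 2 * τ ≤ w * (σ ^ J * S₀ * τ) := by
    have e : σ ^ J = σ * σ ^ (J-1) := by
      rw [← pow_succ']; congr 1; omega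
    have h1 := hSp (J-1)
    rw [e]
    set S := σ ^ (J-1) * S₀
    have h2 : S * τ + S * τ + S * τ ≤ σ * σ ^ (J-1) * S₀ * τ := by
      have : 3 * (S * τ) ≤ σ * (S * τ) := Nat.mul_le_mul_right _ hσ
      calc S * τ + S * τ + S * τ = 3 * (S * τ) := by ring
        _ ≤ σ * (S * τ) := this
        _ = _ := by simp only [S]; ring
    have h3 : τ ≤ S * τ := Nat.le_mul_of_pos_left _ h1
    have h4 : w * (S * τ + 1 + τ) ≤ w * (σ * σ ^ (J-1) * S₀ * τ) := Nat.mul_le_mul_left _ (by omega)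
    nlinarith
  refine baker_core α γ ε D g L A n d (2 ^ bB) T P S₀ σ J τ G1 G2 hL hα1 hα2 hind hA hg hL1 hG1 hG2 hG2p hγ hγ0 hγ2 hγ3
    hB1 hB2 hAn hP (by rw [BI_card]; exact hcard) hS0 hσ hT.ge (by rw [BI_card]; exact hJ) hcon ?_ H1' ?_
  · intro j hj
    have h1 : ((σ ^ (j+1) * S₀ : ℕ) : ℝ) ≤ ((σ ^ J * S₀ : ℕ) : ℝ) := by exact_mod_cast hM j hj
    have h2 : (2:ℝ) ^ w ≤ 2 ^ (w * (σ ^ J * S₀ * τ)) := pow_le_pow_right₀ (by norm_num)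
      (Nat.le_mul_of_pos_right _ (Nat.mul_pos (hSp J) hτ))
    have h0 : (0:ℝ) ≤ L * ((σ ^ J * S₀ : ℕ) : ℝ) := by positivity
    calc L * ((σ ^ (j+1) * S₀ : ℕ) : ℝ) * ε ≤ L * ((σ ^ J * S₀ : ℕ) : ℝ) * ε := by gcongr
      _ ≤ 2 ^ w * ε := by gcongr; linarith
      _ ≤ 2 ^ (w * (σ ^ J * S₀ * τ)) * ε := by gcongr
      _ = 1 := by rw [mul_comm]; exact hε1
  · intro j hj
    have hH := H1' j hj
    have h1 : ((σ ^ (j+1) * S₀ : ℕ) : ℝ) ≤ ((σ ^ J * S₀ : ℕ) : ℝ) := by exact_mod_cast hM j hj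
    have hz0 : 0 ≤ bZ A L T P (2 ^ bB) (σ ^ (j+1) * S₀) := by unfold bZ; positivity
    have hS : σ ^ j * S₀ ≤ σ ^ (J-1) * S₀ := Nat.mul_le_mul_right _ (Nat.pow_le_pow_right (by omega) (by omega))
    have hZ4 : 4 * (bZ A L T P (2 ^ bB) (σ ^ (j+1) * S₀)) ^ (D + 2) ≤ 8 ^ (σ ^ j * S₀ * τ) := by
      refine le_trans ?_ hH
      exact le_mul_of_one_le_right (by positivity) (Real.one_le_exp (by positivity))
    set M := σ ^ (j+1) * S₀ with hMdef
    set Z := bZ A L T P (2 ^ bB) M with hZ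
    set S := σ ^ j * S₀ with hSdef
    have hw1r : (8:ℝ) * ((M:ℝ) * (τ + 2) + 1) ≤ 2 ^ w := by
      have : (8:ℝ) * (((σ ^ J * S₀ : ℕ) : ℝ) * (τ + 2) + 1) ≤ 2 ^ w := by exact_mod_cast hw1
      refine le_trans ?_ this
      gcongr
    have hLM : 6 * (L:ℝ) * M ≤ 2 ^ w := le_trans (by gcongr) hw2r
    calc ε * (2 * L * (M:ℝ)) * (12 * Z ^ (D + 2) * ((M:ℝ) * (τ + 2) + 1 : ℝ) ^ (S * τ) * 4 ^ τ)
        = ε * (6 * L * M) * ((4 * Z ^ (D+2)) * ((M:ℝ) * (τ + 2) + 1 : ℝ) ^ (S * τ)) * 4 ^ τ := by ring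
      _ ≤ ε * 2 ^ w * (8 ^ (S * τ) * ((M:ℝ) * (τ + 2) + 1 : ℝ) ^ (S * τ)) * 4 ^ τ := by gcongr
      _ = ε * 2 ^ w * (8 * ((M:ℝ) * (τ + 2) + 1 : ℝ)) ^ (S * τ) * (2 ^ 2) ^ τ := by rw [mul_pow]; norm_num
      _ ≤ ε * 2 ^ w * (2 ^ w) ^ (S * τ) * (2 ^ 2) ^ τ := by gcongr
      _ = ε * 2 ^ (w * (S * τ + 1) + 2 * τ) := by
          rw [← pow_mul, ← pow_mul, mul_assoc, mul_assoc, ← pow_add, ← pow_add]; congr 2; ring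
      _ ≤ ε * 2 ^ (w * (σ ^ J * S₀ * τ)) := by
          gcongr
          · norm_num
          · refine le_trans ?_ hbig
            gcongr
      _ = 1 := hε1

end

section

lemma lucasK_zero (k : ℕ) : lucasK k 0 = 2 := by rw [lucasK]
lemma lucasK_one (k : ℕ) : lucasK k 1 = 1 := by rw [lucasK]
lemma lucasK_rec (k n : ℕ) : lucasK k (n+2) = ∑ j ∈ Finset.range k, if j ≤ n + 1 then lucasK k (n + 1 - j) else 0 := by
  rw [lucasK]; simp

/-- shifted sequence, starting at index 2-k -/
def lucA (k : ℕ) (n : ℕ) : ℕ := if k ≤ n + 2 then lucasK k (n + 2 - k) else 0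

lemma lucA_shift (k n : ℕ) (hk : 2 ≤ k) : lucA k (n + (k - 2)) = lucasK k n := by
  unfold lucA
  rw [if_pos (by omega)]; congr 1; omega

lemma lucA_rec (k n : ℕ) (hk : 2 ≤ k) : lucA k (n + k) = ∑ j ∈ Finset.range k, lucA k (n + j) := by
  have h1 : lucA k (n + k) = lucasK k (n + 2) := by
    unfold lucA; rw [if_pos (by omega)]; congr 1; omega
  rw [h1, lucasK_rec, ← Finset.sum_range_reflect]
  apply Finset.sum_congr rfl
  intro j hj
  have := Finset.mem_range.mp hj
  unfold lucA
  by_cases h : k ≤ n + j + 2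
  · rw [if_pos h, if_pos (by omega)]; congr 1; omega
  · rw [if_neg h, if_neg (by omega)]

lemma lucA_double (k n : ℕ) (hk : 2 ≤ k) : lucA k (n + k + 1) + lucA k n = 2 * lucA k (n + k) := by
  have h1 := lucA_rec k (n+1) hk
  have h2 := lucA_rec k n hk
  have h3 := Finset.sum_range_succ (fun j => lucA k (n + j)) k
  have h4 := Finset.sum_range_succ' (fun j => lucA k (n + j)) k
  have e : ∑ j ∈ Finset.range k, lucA k (n + (j+1)) = ∑ j ∈ Finset.range k, lucA k (n + 1 + j) := by
    apply Finset.sum_congr rfl; intro j _; congr 1; ring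
  rw [e] at h4
  rw [show n + k + 1 = n + 1 + k by ring]
  simp only [add_zero] at h4
  omega

lemma lucasK_double (k n : ℕ) (hk : 2 ≤ k) (hn : 2 ≤ n) (hkn : k ≤ n) :
    lucasK k (n+1) + lucasK k (n - k) = 2 * lucasK k n := by
  have h := lucA_double k (n - 2) hk
  have e1 : lucA k (n - 2 + k + 1) = lucasK k (n+1) := by
    rw [← lucA_shift k (n+1) hk]; congr 1; omega
  have e2 : lucA k (n - 2 + k) = lucasK k n := by
    rw [← lucA_shift k n hk]; congr 1; omega
  have e3 : lucA k (n-2) = lucasK k (n - k) := by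
    rw [← lucA_shift k (n-k) hk]; congr 1; omega
  rw [e1, e2, e3] at h
  exact h

lemma lucasK_double' (k n : ℕ) (hk : 2 ≤ k) (hn : 2 ≤ n) (hkn : n < k) :
    lucasK k (n+1) = 2 * lucasK k n := by
  have h := lucA_double k (n - 2) hk
  have e1 : lucA k (n - 2 + k + 1) = lucasK k (n+1) := by
    rw [← lucA_shift k (n+1) hk]; congr 1; omega
  have e2 : lucA k (n - 2 + k) = lucasK k n := by
    rw [← lucA_shift k n hk]; congr 1; omega
  have e3 : lucA k (n-2) = 0 := by
    unfold lucA; rw [if_neg (by omega)]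
  rw [e1, e2, e3] at h
  exact h

lemma lucasK_two (k : ℕ) (hk : 2 ≤ k) : lucasK k 2 = 3 := by
  rw [show 2 = 0 + 2 by rfl, lucasK_rec]
  obtain ⟨k, rfl⟩ : ∃ j, k = j + 2 := ⟨k - 2, by omega⟩
  rw [Finset.sum_range_succ', Finset.sum_range_succ']
  have : ∑ j ∈ Finset.range k, (if j + 1 + 1 ≤ 0 + 1 then lucasK (k+2) (0 + 1 - (j+1+1)) else 0) = 0 := by
    apply Finset.sum_eq_zero; intro j _; rw [if_neg (by omega)]
  rw [this]
  simp [lucasK_zero, lucasK_one]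

lemma lucasK_small (k n : ℕ) (hk : 2 ≤ k) (hn : n + 2 ≤ k) : lucasK k (n+2) = 3 * 2 ^ n := by
  induction n with
  | zero => simpa using lucasK_two k hk
  | succ n ih =>
    rw [lucasK_double' k (n+2) hk (by omega) (by omega), ih (by omega)]; ring

lemma lucasK_pos (k n : ℕ) (hk : 2 ≤ k) : 1 ≤ lucasK k n := by
  induction n using Nat.strong_induction_on with
  | _ n ih =>
    match n with
    | 0 => rw [lucasK_zero]; norm_num
    | 1 => rw [lucasK_one]
    | n+2 =>
      rw [lucasK_rec]
      have h0 : (0:ℕ) ∈ Finset.range k := Finset.mem_range.mpr (by omega)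
      have := Finset.single_le_sum (f := fun j => if j ≤ n + 1 then lucasK k (n + 1 - j) else 0) (fun _ _ => Nat.zero_le _) h0
      simp only [Nat.zero_le, if_true, Nat.sub_zero] at this
      exact (ih (n+1) (by omega)).trans this

end

section

open Polynomial

/-- e = 2 - alpha -/
def IsE (k : ℕ) (e : ℝ) : Prop := 2 ≤ k ∧ 0 < e ∧ k * e ≤ 1 ∧ e * (2 - e) ^ k = 1

lemma pow_ge_self (k : ℕ) (hk : 2 ≤ k) : (k:ℝ) ≤ (3/2:ℝ)^k := by
  induction k, hk using Nat.le_induction with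
  | base => norm_num
  | succ k hk ih =>
    rw [pow_succ]; push_cast
    have : (2:ℝ) ≤ k := by exact_mod_cast hk
    linarith

lemma exists_e (k : ℕ) (hk : 2 ≤ k) : ∃ e, IsE k e := by
  have hk' : (2:ℝ) ≤ k := by exact_mod_cast hk
  have hk0 : (0:ℝ) < k := by linarith
  have hi : (1:ℝ)/k ≤ 1/2 := one_div_le_one_div_of_le (by norm_num) hk'
  have hc : ContinuousOn (fun e : ℝ => e * (2 - e)^k) (Set.Icc 0 (1/k)) := by fun_prop
  have h := intermediate_value_Icc (by positivity : (0:ℝ) ≤ 1/k) hc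
  have h1 : (1:ℝ) ∈ Set.Icc ((fun e : ℝ => e * (2 - e)^k) 0) ((fun e : ℝ => e * (2 - e)^k) (1/k)) := by
    constructor
    · simp
    · have h2 : (3/2:ℝ)^k ≤ (2 - 1/(k:ℝ))^k := pow_le_pow_left₀ (by norm_num) (by linarith) k
      have h3 := (pow_ge_self k hk).trans h2
      show (1:ℝ) ≤ 1/k * (2 - 1/(k:ℝ))^k
      calc (1:ℝ) = 1/k * k := by field_simp
        _ ≤ _ := by gcongr
  obtain ⟨e, ⟨he0, he1⟩, he⟩ := h h1
  refine ⟨e, hk, ?_, ?_, he⟩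
  · rcases he0.lt_or_eq with h | h
    · exact h
    · rw [← h] at he; simp at he
  · rw [le_div_iff₀ hk0] at he1; linarith

namespace IsE
variable {k : ℕ} {e : ℝ}

lemma kpos (h : IsE k e) : (2:ℝ) ≤ k := by exact_mod_cast h.1

lemma half (h : IsE k e) : e ≤ 1/2 := by
  have := h.kpos; have h1 := h.2.2.1; have h2 := h.2.1; nlinarith

lemma lower (h : IsE k e) : (1/2:ℝ)^k ≤ e := by
  have h1 : (2 - e)^k ≤ 2^k := pow_le_pow_left₀ (by linarith [h.half]) (by linarith [h.2.1]) k
  have h2 := h.2.2.2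
  have h3 : 1 ≤ e * 2^k := by rw [← h2]; exact mul_le_mul_of_nonneg_left h1 h.2.1.le
  rw [one_div, inv_pow, inv_le_iff_one_le_mul₀ (by positivity)]
  exact h3

lemma upper (h : IsE k e) : e ≤ 2 * (1/2:ℝ)^k := by
  have h1 := one_add_mul_le_pow (a := -(e/2)) (by linarith [h.half]) k
  have h2 : (2 - e)^k = 2^k * (1 + -(e/2))^k := by rw [← mul_pow]; congr 1; ring
  have h3 := h.2.2.2
  have h4 : (1/2:ℝ) ≤ (1 + -(e/2))^k := by have := h.2.2.1; linarith
  rw [h2] at h3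
  have hp : (0:ℝ) < 2^k := by positivity
  rw [one_div, inv_pow, ← div_eq_mul_inv, le_div_iff₀ hp]
  have h5 : 0 < e * 2^k := mul_pos h.2.1 hp
  nlinarith

/-- the dominant coefficient -/
noncomputable def Cst (k : ℕ) (e : ℝ) : ℝ := (1-e)*(3-2*e)/((2-e)*(2-(k+1)*e))

lemma den_pos (h : IsE k e) : 1/2 ≤ 2 - (k+1)*e := by
  have := h.2.2.1; have := h.half; linarith

lemma den_pos' (h : IsE k e) : 1 - e ≤ 2 - (k+1)*e := by
  have := h.2.2.1; linarith

lemma Cst_lower (h : IsE k e) : 1/3 ≤ Cst k e := by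
  have h1 := h.den_pos; have h2 := h.half; have h3 := h.2.1
  have hk := h.kpos
  unfold Cst
  rw [le_div_iff₀ (by apply mul_pos <;> linarith)]
  nlinarith [mul_pos h3 h3]

lemma Cst_upper (h : IsE k e) : Cst k e ≤ 2 := by
  have h1 := h.den_pos; have h2 := h.half; have h3 := h.2.1
  have h4 := h.den_pos'
  unfold Cst
  rw [div_le_iff₀ (by apply mul_pos <;> linarith)]
  nlinarith

lemma Cst_al (h : IsE k e) : Cst k e * (2 - e) ≤ 3 := by
  have h1 := h.den_pos; have h2 := h.half; have h3 := h.2.1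
  have h4 := h.den_pos'
  unfold Cst
  have : (1-e)*(3-2*e)/((2-e)*(2-(k+1)*e)) * (2-e) = (1-e)*(3-2*e)/(2-(k+1)*e) := by
    have : 2 - e ≠ 0 := by linarith
    field_simp
  rw [this, div_le_iff₀ (by linarith)]
  nlinarith

lemma binv (h : IsE k e) : ((2-e)⁻¹)^k = e := by
  have := h.2.2.2
  have hp : (0:ℝ) < (2-e)^k := by have := h.half; apply pow_pos; linarith
  rw [inv_pow]; field_simp; linarith

lemma poly (h : IsE k e) : (2-e)^k = ∑ j ∈ Finset.range k, (2-e)^j := by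
  have h1 := geom_sum_mul (2-e) k
  have h2 := h.2.2.2
  have : (2 - e - 1) ≠ 0 := by linarith [h.half]
  apply mul_right_cancel₀ this
  rw [h1]; linarith

lemma wsum (h : IsE k e) : ∑ j ∈ Finset.range k, ((2-e)⁻¹)^(j+1) = 1 := by
  have hp : (0:ℝ) < 2-e := by linarith [h.half]
  set b := (2-e)⁻¹ with hb
  have h1 := geom_sum_mul b k
  have h2 := h.binv
  have hb1 : b * (2-e) = 1 := by rw [hb]; field_simp
  have hne : b ≠ 1 := by intro h; rw [h] at hb1; linarith [h.trans rfl, ‹IsE k e›.half]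
  simp only [pow_succ, ← Finset.sum_mul]
  apply mul_right_cancel₀ (sub_ne_zero.mpr hne)
  rw [mul_assoc, mul_comm b, ← mul_assoc, h1, show b^k = e from h2]
  nlinarith

/-- Recurrence invariants -/
lemma Jstep (h : IsE k e) (s : ℕ → ℝ) (hs : ∀ n, s (n+k) = ∑ j ∈ Finset.range k, s (n+j)) (n : ℕ) :
    ∑ j ∈ Finset.range k, (1 - ((2-e)⁻¹)^(j+1)) * s (n+1+j) = (2-e) * ∑ j ∈ Finset.range k, (1 - ((2-e)⁻¹)^(j+1)) * s (n+j) := by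
  have hp : (0:ℝ) < 2-e := by linarith [h.half]
  have h2 := h.binv
  set b := (2-e)⁻¹ with hb
  have hb1 : (2-e) * b = 1 := by rw [hb]; field_simp
  have e1 := Finset.sum_range_succ' (fun j => (1 - b^j) * s (n+j)) k
  have e2 := Finset.sum_range_succ (fun j => (1 - b^j) * s (n+j)) k
  rw [e2] at e1
  have e3 : ∑ j ∈ Finset.range k, (1 - b^(j+1)) * s (n+1+j) = ∑ j ∈ Finset.range k, (1 - b^(j+1)) * s (n+(j+1)) := by
    apply Finset.sum_congr rfl; intro j _; congr 2; ring
  rw [e3]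
  have e4 : (2-e) * ∑ j ∈ Finset.range k, (1 - b^(j+1)) * s (n+j) = ∑ j ∈ Finset.range k, (1 - b^j) * s (n+j) + (1-e) * ∑ j ∈ Finset.range k, s (n+j) := by
    rw [Finset.mul_sum, Finset.mul_sum, ← Finset.sum_add_distrib]
    apply Finset.sum_congr rfl; intro j _
    rw [pow_succ]
    linear_combination (-b^j * s (n+j)) * hb1
  rw [e4, ← hs, ]
  simp only [pow_zero, sub_self, zero_mul, add_zero] at e1
  rw [← e1, h2]

lemma Jzero (h : IsE k e) (s : ℕ → ℝ) (hs : ∀ n, s (n+k) = ∑ j ∈ Finset.range k, s (n+j))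
    (h0 : ∑ j ∈ Finset.range k, (1 - ((2-e)⁻¹)^(j+1)) * s j = 0) (n : ℕ) :
    ∑ j ∈ Finset.range k, (1 - ((2-e)⁻¹)^(j+1)) * s (n+j) = 0 := by
  induction n with
  | zero => simpa using h0
  | succ n ih => rw [h.Jstep s hs, ih, mul_zero]

lemma bounded (h : IsE k e) (s : ℕ → ℝ) (hs : ∀ n, s (n+k) = ∑ j ∈ Finset.range k, s (n+j))
    (h0 : ∑ j ∈ Finset.range k, (1 - ((2-e)⁻¹)^(j+1)) * s j = 0) (B : ℝ) (hB : ∀ j < k, |s j| ≤ B) (n : ℕ) :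
    |s n| ≤ B := by
  have hp : (0:ℝ) < 2-e := by linarith [h.half]
  induction n using Nat.strong_induction_on with
  | _ n ih =>
    by_cases hn : n < k
    · exact hB n hn
    · obtain ⟨n, rfl⟩ : ∃ i, n = i + k := ⟨n - k, by omega⟩
      have h1 := h.Jzero s hs h0 n
      have h2 : s (n+k) = ∑ j ∈ Finset.range k, ((2-e)⁻¹)^(j+1) * s (n+j) := by
        rw [hs]
        have : ∀ j ∈ Finset.range k, (1 - ((2-e)⁻¹)^(j+1)) * s (n+j) = s (n+j) - ((2-e)⁻¹)^(j+1) * s (n+j) := by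
          intro j _; ring
        rw [Finset.sum_congr rfl this, Finset.sum_sub_distrib] at h1
        linarith
      rw [h2]
      calc |∑ j ∈ Finset.range k, ((2-e)⁻¹)^(j+1) * s (n+j)| ≤ ∑ j ∈ Finset.range k, |((2-e)⁻¹)^(j+1) * s (n+j)| := Finset.abs_sum_le_sum_abs _ _
        _ ≤ ∑ j ∈ Finset.range k, ((2-e)⁻¹)^(j+1) * B := by
          apply Finset.sum_le_sum; intro j hj
          have hjk := Finset.mem_range.mp hj
          rw [abs_mul, abs_of_pos (by positivity)]
          exact mul_le_mul_of_nonneg_left (ih _ (by omega)) (by positivity)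
        _ = B := by rw [← Finset.sum_mul, h.wsum, one_mul]

lemma binet (h : IsE k e) (n : ℕ) : |(lucasK k n : ℝ) - Cst k e * (2-e)^n| ≤ 3 := by
  obtain ⟨k, rfl⟩ : ∃ j, k = j + 2 := ⟨k - 2, by have := h.1; omega⟩
  have hp : (0:ℝ) < 2-e := by linarith [h.half]
  have hp1 : (1:ℝ) ≤ 2-e := by linarith [h.half]
  have hd := h.den_pos
  have hbi := h.binv
  have hx := h.2.2.2
  set b := (2-e)⁻¹ with hb
  have hb1 : (2-e) * b = 1 := by rw [hb]; field_simp
  set Ca := Cst (k+2) e / (2-e)^k with hCa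
  have hC0 : 0 < Cst (k+2) e := by linarith [h.Cst_lower]
  have hCp : 0 < Ca := by positivity
  have hCm : Ca * (2-e)^k = Cst (k+2) e := by rw [hCa]; field_simp
  have key := h.bounded (fun n => (lucA (k+2) n : ℝ) - Ca * (2-e)^n) (by
    intro n
    have h1 := lucA_rec (k+2) n h.1
    have h2 := h.poly
    rw [Finset.sum_sub_distrib, ← Finset.mul_sum]
    congr 1
    · exact_mod_cast h1
    · rw [pow_add, h2, Finset.mul_sum]; congr 1; apply Finset.sum_congr rfl; intro j _; rw [pow_add]) (by
    have h1 : ∑ j ∈ Finset.range (k+2), (1 - b^(j+1)) * (lucA (k+2) j : ℝ) = (1-e)*(3-2*e) := by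
      rw [Finset.sum_range_succ, Finset.sum_range_succ]
      have z : ∑ j ∈ Finset.range k, (1 - b^(j+1)) * (lucA (k+2) j : ℝ) = 0 := by
        apply Finset.sum_eq_zero; intro j hj
        have := Finset.mem_range.mp hj
        have : lucA (k+2) j = 0 := by unfold lucA; rw [if_neg (by omega)]
        rw [this]; simp
      have a0 : lucA (k+2) k = 2 := by have := lucA_shift (k+2) 0 h.1; simpa [lucasK_zero] using this
      have a1 : lucA (k+2) (k+1) = 1 := by have := lucA_shift (k+2) 1 h.1; simpa [lucasK_one, add_comm] using this
      have hbk : b^(k+1) = (2-e) * e := by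
        have hbi' : b^(k+1) * b = e := by rw [← pow_succ]; exact hbi
        linear_combination (2-e) * hbi' - b^(k+1) * hb1
      rw [z, a0, a1, hbk, show k+1+1 = k+2 by ring, hbi]; push_cast; ring
    have h2 : ∑ j ∈ Finset.range (k+2), (1 - b^(j+1)) * (2-e)^j = (2-e)^(k+2) - (k+2) * b := by
      have : ∀ j ∈ Finset.range (k+2), (1 - b^(j+1)) * (2-e)^j = (2-e)^j - b := by
        intro j _
        have : b^(j+1) * (2-e)^j = b := by
          rw [pow_succ, mul_comm (b^j), mul_assoc, ← mul_pow, mul_comm b (2-e), hb1, one_pow, mul_one]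
        linear_combination -this
      rw [Finset.sum_congr rfl this, Finset.sum_sub_distrib, ← h.poly]; simp
    have : ∀ j ∈ Finset.range (k+2), (1 - b^(j+1)) * ((lucA (k+2) j : ℝ) - Ca * (2-e)^j) = (1 - b^(j+1)) * (lucA (k+2) j : ℝ) - Ca * ((1 - b^(j+1)) * (2-e)^j) := by
      intro j _; ring
    rw [Finset.sum_congr rfl this, Finset.sum_sub_distrib, ← Finset.mul_sum, h1, h2]
    have h3 : Ca * ((2-e)^(k+2) - (k+2)*b) = Ca * (2-e)^k * ((2-e)^2 - (k+2)*e*(2-e)) := by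
      have : b = (2-e)^k * (e * (2-e)) := by
        have : (2-e)^k * (e*(2-e)) * (2-e) = 1 := by rw [← hx]; ring
        apply mul_right_cancel₀ hp.ne'; rw [this, mul_comm]; exact hb1
      rw [this]; ring
    rw [h3, hCm]
    have hq : (2-e)^2 - (k+2)*e*(2-e) = (2-e)*(2-(((k+2:ℕ):ℝ)+1)*e) := by push_cast; ring
    rw [hq]
    unfold Cst
    rw [div_mul_cancel₀ _ (mul_pos hp (by linarith)).ne', sub_self]) 3 (by
    intro j hj
    have hl : (lucA (k+2) j : ℝ) ≤ 2 := by
      unfold lucA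
      split_ifs with hh
      · have : j + 2 - (k+2) = 0 ∨ j + 2 - (k+2) = 1 := by omega
        rcases this with h | h <;> rw [h]
        · rw [lucasK_zero]; norm_num
        · rw [lucasK_one]; norm_num
      · norm_num
    have hl0 : (0:ℝ) ≤ lucA (k+2) j := Nat.cast_nonneg _
    have hu : Ca * (2-e)^j ≤ 3 := by
      calc Ca * (2-e)^j ≤ Ca * (2-e)^(k+1) := by
            apply mul_le_mul_of_nonneg_left _ hCp.le
            exact pow_le_pow_right₀ hp1 (by omega)
        _ = Cst (k+2) e * (2-e) := by rw [← hCm]; ring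
        _ ≤ 3 := h.Cst_al
    have hu0 : 0 < Ca * (2-e)^j := by positivity
    rw [abs_le]; constructor <;> linarith) (n + (k+2-2))
  simp only [Nat.add_sub_cancel] at key
  have h1 := lucA_shift (k+2) n h.1
  simp only [Nat.add_sub_cancel] at h1
  rw [h1, show Ca * (2-e)^(n+k) = Cst (k+2) e * (2-e)^n by rw [← hCm]; ring] at key
  exact key

end IsE

end

section

open Polynomial
namespace IsE
variable {k : ℕ} {e : ℝ}

noncomputable def psi (k : ℕ) : ℤ[X] := X^k - ∑ j ∈ Finset.range k, X^j

lemma psi_deg (k : ℕ) : (∑ j ∈ Finset.range k, (X:ℤ[X])^j).degree < (k:WithBot ℕ) := by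
  rw [← mem_degreeLT]
  apply Submodule.sum_mem
  intro j hj
  rw [mem_degreeLT, degree_X_pow]
  exact_mod_cast Finset.mem_range.mp hj

lemma psi_monic (k : ℕ) : (psi k).Monic := by
  unfold psi
  exact monic_X_pow_sub (psi_deg k)

lemma psi_natDegree (k : ℕ) : (psi k).natDegree = k := by
  unfold psi
  apply natDegree_eq_of_degree_eq_some
  rw [degree_sub_eq_left_of_degree_lt, degree_X_pow]
  rw [degree_X_pow]; exact psi_deg k

lemma psi_root (h : IsE k e) : aeval (2-e) (psi k) = 0 := by
  unfold psi; simp only [map_sub, map_pow, map_sum, aeval_X]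
  rw [h.poly, sub_self]

lemma psi_bd (k : ℕ) (z : ℂ) (hz : aeval z (psi k) = 0) : ‖z‖ ≤ 2 := by
  unfold psi at hz; simp only [map_sub, map_pow, map_sum, aeval_X] at hz
  by_contra hc
  push Not at hc
  have h1 : z^k = ∑ j ∈ Finset.range k, z^j := sub_eq_zero.mp hz
  have h2 : ‖z‖^k ≤ ∑ j ∈ Finset.range k, ‖z‖^j := by
    rw [← norm_pow, h1]
    exact (norm_sum_le _ _).trans (le_of_eq (Finset.sum_congr rfl fun j _ => norm_pow _ _))
  have h3 := geom_sum_mul ‖z‖ k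
  have h4 : 0 < ‖z‖^k := by positivity
  have h5 : 0 ≤ ∑ j ∈ Finset.range k, ‖z‖^j := Finset.sum_nonneg fun j _ => by positivity
  nlinarith

lemma liou (h : IsE k e) : Liou (2-e) (k-1) := by
  have := liou_of_root (2-e) (psi k) (psi_monic k) h.psi_root (psi_bd k)
  rwa [psi_natDegree] at this

lemma integ (h : IsE k e) : IsIntegral ℤ (2-e) := ⟨psi k, psi_monic k, by
  have := h.psi_root; rwa [aeval_def] at this⟩

lemma integ_inv (h : IsE k e) : IsIntegral ℤ (2-e)⁻¹ := by
  have hp : (0:ℝ) < 2-e := by linarith [h.half]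
  have hi := h.integ
  obtain ⟨j, rfl⟩ : ∃ j, k = j + 1 := ⟨k - 1, by have := h.1; omega⟩
  have h1 := h.poly
  rw [Finset.sum_range_succ'] at h1
  have : (2-e)⁻¹ = (2-e)^j - ∑ i ∈ Finset.range j, (2-e)^i := by
    rw [inv_eq_iff_eq_inv, eq_comm, inv_eq_of_mul_eq_one_left]
    rw [mul_sub, Finset.mul_sum]
    simp only [pow_succ, pow_zero] at h1
    rw [mul_comm, h1, Finset.sum_congr rfl (fun i _ => mul_comm (2-e) ((2-e)^i))]; ring
  rw [this]
  exact (hi.pow j).sub (IsIntegral.sum _ fun i _ => hi.pow i)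

lemma integ_zpow (h : IsE k e) (i : ℤ) : IsIntegral ℤ ((2-e)^i) := by
  rcases i with i | i
  · simpa using h.integ.pow i
  · rw [zpow_negSucc, ← inv_pow]; exact h.integ_inv.pow _

lemma ten_not (j : ℕ) (h : IsIntegral ℤ (((10:ℝ)^j)⁻¹)) : j = 0 := by
  have h1 : IsIntegral ℤ (algebraMap ℚ ℝ (((10:ℚ)^j)⁻¹)) := by simpa using h
  rw [isIntegral_algebraMap_iff (algebraMap ℚ ℝ).injective] at h1
  obtain ⟨y, hy⟩ := (IsIntegrallyClosed.isIntegral_iff (R := ℤ)).mp h1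
  have h2 : (y:ℚ) * 10^j = 1 := by
    have : (y:ℚ) = ((10:ℚ)^j)⁻¹ := by simpa using hy
    rw [this]; field_simp
  have h3 : y * 10^j = 1 := by exact_mod_cast h2
  by_contra hj
  have h4 : (10:ℤ) ∣ 1 := by rw [← h3]; exact Dvd.dvd.mul_left (dvd_pow_self _ hj) _
  norm_num at h4

lemma hind (h : IsE k e) (i j : ℤ) (hij : (2-e)^i * 10^j = 1) : i = 0 ∧ j = 0 := by
  have hp : (1:ℝ) < 2-e := by linarith [h.half]
  have hj : j = 0 := by
    rcases j with j | j
    · have : ((10:ℝ)^j)⁻¹ = (2-e)^i := by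
        rw [inv_eq_iff_eq_inv]; simp only [Int.ofNat_eq_natCast, zpow_natCast] at hij
        rw [eq_comm]; exact inv_eq_of_mul_eq_one_right hij
      have := ten_not j (this ▸ h.integ_zpow i)
      simp [this]
    · exfalso
      have : ((10:ℝ)^(j+1))⁻¹ = (2-e)^(-i) := by
        rw [zpow_neg]; rw [zpow_negSucc] at hij
        rw [eq_comm]; exact inv_eq_of_mul_eq_one_right hij
      have := ten_not (j+1) (this ▸ h.integ_zpow (-i))
      omega
  subst hj
  simp only [zpow_zero, mul_one] at hij
  refine ⟨?_, rfl⟩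
  rcases lt_trichotomy i 0 with h1 | h1 | h1
  · exact absurd hij (zpow_lt_one_of_neg₀ hp h1).ne
  · exact h1
  · exact absurd hij (one_lt_zpow₀ hp h1).ne'

end IsE

end

section

open Polynomial

/-- the equation -/
def RepD (k n m d a : ℕ) : Prop := 2 ≤ k ∧ m ≤ n ∧ 2 ≤ d ∧ 1 ≤ a ∧ a ≤ 9 ∧ 9 * (lucasK k n * lucasK k m) + a = a * 10^d

lemma rep_of (k n m d a : ℕ) (hk : 2 ≤ k) (hmn : m ≤ n) (hd : 2 ≤ d) (h1 : 1 ≤ a) (h9 : a ≤ 9)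
    (h : lucasK k n * lucasK k m = a * ((10 ^ d - 1) / 9)) : RepD k n m d a := by
  refine ⟨hk, hmn, hd, h1, h9, ?_⟩
  have hdv : 9 ∣ 10^d - 1 := by simpa using Nat.sub_dvd_pow_sub_pow 10 1 d
  obtain ⟨c, hc⟩ := hdv
  have hp : 1 ≤ 10^d := Nat.one_le_pow _ _ (by norm_num)
  rw [h, hc, Nat.mul_div_cancel_left _ (by norm_num)]
  have : 10^d = 9 * c + 1 := by omega
  rw [this]; ring

lemma abs_log_le (u x : ℝ) (h : |u - 1| ≤ x) (hx : x ≤ 1/2) : |Real.log u| ≤ 2 * x := by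
  have h1 := abs_le.mp h
  have hu : 0 < u := by linarith
  have h2 := Real.log_le_sub_one_of_pos hu
  have h3 := Real.one_sub_inv_le_log_of_pos hu
  have h4 : -(2*x) ≤ 1 - u⁻¹ := by
    have : u⁻¹ ≤ 1 + 2*x := by
      rw [inv_le_iff_one_le_mul₀ hu]; nlinarith
    linarith
  rw [abs_le]; constructor <;> linarith

lemma lf_eq (n d : ℕ) (x g : ℝ) (hx : 0 < x) (hg : 0 < g) :
    n * Real.log x - d * Real.log 10 + Real.log g = Real.log (x^n * g / 10^d) := by
  rw [Real.log_div (by positivity) (by positivity), Real.log_mul (by positivity) (by positivity), Real.log_pow, Real.log_pow]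
  ring

namespace IsE
variable {k : ℕ} {e : ℝ}

lemma al_pow (h : IsE k e) (n : ℕ) : (3/2:ℝ)^n ≤ (2-e)^n := pow_le_pow_left₀ (by norm_num) (by linarith [h.half]) n

lemma pow_mono' {x : ℝ} (hx : 1 ≤ x) {n : ℕ} (c : ℕ) (hc : c ≤ n) : x^c ≤ x^n := pow_le_pow_right₀ hx hc

lemma L_ge (h : IsE k e) (n : ℕ) (hn : 8 ≤ n) : (2-e)^n ≤ 6 * lucasK k n := by
  have h1 := abs_le.mp (h.binet n)
  have h2 := h.al_pow n
  have h3 := pow_mono' (x := 3/2) (by norm_num) 8 hn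
  have h4 := h.Cst_lower
  have h5 : (18:ℝ) ≤ (3/2)^8 := by norm_num
  nlinarith

lemma Lpos (h : IsE k e) (n : ℕ) : (1:ℝ) ≤ lucasK k n := by exact_mod_cast lucasK_pos k n h.1

lemma formX (h : IsE k e) {n m d a : ℕ} (hr : RepD k n m d a) (hn : 10 ≤ n) :
    |n * Real.log (2-e) - d * Real.log 10 + Real.log (9 * lucasK k m * Cst k e / a)| ≤ 48 / (2-e)^n := by
  obtain ⟨_, hmn, hd, ha1, ha9, hr⟩ := hr
  have ha1' : (1:ℝ) ≤ a := by exact_mod_cast ha1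
  have ha9' : (a:ℝ) ≤ 9 := by exact_mod_cast ha9
  have hr' : 9 * ((lucasK k n : ℝ) * lucasK k m) + a = a * 10^d := by exact_mod_cast hr
  have hC := h.Cst_lower
  have hm := h.Lpos m
  have hL := h.L_ge n (by omega)
  have hp : (0:ℝ) < (2-e)^n := by have := h.half; apply pow_pos; linarith
  have hb := abs_le.mp (h.binet n)
  have h2 := h.al_pow n
  have h3 := pow_mono' (x := 3/2) (by norm_num) 10 hn
  have h5 : (48:ℝ) ≤ (3/2)^10 := by norm_num
  have e1 : n * Real.log (2-e) - d * Real.log 10 + Real.log (9 * lucasK k m * Cst k e / a) = Real.log (9 * (lucasK k m * (Cst k e * (2-e)^n)) / (a * 10^d)) := by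
    rw [show 9 * (lucasK k m * (Cst k e * (2-e)^n)) / (a * 10^d) = (2-e)^n * (9 * lucasK k m * Cst k e / a) / 10^d by field_simp]
    exact lf_eq _ _ _ _ (by linarith [h.half]) (by positivity)
  rw [e1]
  have h48 : 48 / (2-e)^n = 2 * (24/(2-e)^n) := by ring
  rw [h48]
  apply abs_log_le
  · rw [← hr']
    set x : ℝ := (lucasK k n : ℝ)
    set y : ℝ := (lucasK k m : ℝ)
    set c := Cst k e * (2-e)^n
    have hxp : 0 < x := by linarith
    have hD : 0 < 9 * (x*y) + a := by positivity
    have : 9 * (y * c) / (9 * (x*y) + a) - 1 = (9 * y * (c - x) - a) / (9 * (x*y)+a) := by field_simp; ring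
    rw [this, abs_div, abs_of_pos hD, div_le_div_iff₀ hD hp]
    have hnum : |9 * y * (c - x) - a| ≤ 36 * y := by
      rw [abs_le]; constructor <;> nlinarith
    calc _ ≤ 36 * y * (2-e)^n := by gcongr
      _ ≤ 36 * y * (6 * x) := by gcongr
      _ ≤ _ := by nlinarith
  · rw [div_le_iff₀ hp]; linarith

lemma formY (h : IsE k e) {n m d a : ℕ} (hr : RepD k n m d a) (hm : 12 ≤ m) :
    |(n+m:ℕ) * Real.log (2-e) - d * Real.log 10 + Real.log (9 * (Cst k e)^2 / a)| ≤ 120 / (2-e)^m := by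
  obtain ⟨_, hmn, hd, ha1, ha9, hr⟩ := hr
  have ha1' : (1:ℝ) ≤ a := by exact_mod_cast ha1
  have ha9' : (a:ℝ) ≤ 9 := by exact_mod_cast ha9
  have hr' : 9 * ((lucasK k n : ℝ) * lucasK k m) + a = a * 10^d := by exact_mod_cast hr
  have hC := h.Cst_lower
  have hLm := h.L_ge m (by omega)
  have hLn := h.L_ge n (by omega)
  have hp : (0:ℝ) < (2-e)^m := by have := h.half; apply pow_pos; linarith
  have hpn : (0:ℝ) < (2-e)^n := by have := h.half; apply pow_pos; linarith
  have hmono : (2-e)^m ≤ (2-e)^n := pow_mono' (by linarith [h.half]) m hmn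
  have hb := abs_le.mp (h.binet n)
  have hb' := abs_le.mp (h.binet m)
  have h2 := h.al_pow m
  have h3 := pow_mono' (x := 3/2) (by norm_num) 12 hm
  have h5 : (120:ℝ) ≤ (3/2)^12 := by norm_num
  have e1 : (n+m:ℕ) * Real.log (2-e) - d * Real.log 10 + Real.log (9 * (Cst k e)^2 / a) = Real.log (9 * ((Cst k e * (2-e)^n) * (Cst k e * (2-e)^m)) / (a * 10^d)) := by
    rw [show 9 * ((Cst k e * (2-e)^n) * (Cst k e * (2-e)^m)) / (a * 10^d) = (2-e)^(n+m) * (9 * (Cst k e)^2 / a) / 10^d by rw [pow_add]; field_simp]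
    exact lf_eq _ _ _ _ (by linarith [h.half]) (by positivity)
  rw [e1]
  have h48 : 120 / (2-e)^m = 2 * (60/(2-e)^m) := by ring
  rw [h48]
  apply abs_log_le
  · rw [← hr']
    set x : ℝ := (lucasK k n : ℝ)
    set y : ℝ := (lucasK k m : ℝ)
    set c := Cst k e * (2-e)^n
    set c' := Cst k e * (2-e)^m
    have hxp : 20 ≤ x := by linarith
    have hyp : 20 ≤ y := by linarith
    have hD : 0 < 9 * (x*y) + a := by positivity
    have : 9 * (c * c') / (9 * (x*y) + a) - 1 = (9 * (c * c' - x * y) - a) / (9 * (x*y)+a) := by field_simp; ring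
    rw [this, abs_div, abs_of_pos hD, div_le_div_iff₀ hD hp]
    have hcc : |c * c' - x * y| ≤ 3 * x + 3 * y + 9 := by
      have : c * c' - x * y = (c - x) * (c' - y) + x * (c' - y) + (c - x) * y := by ring
      have a1 : |c - x| ≤ 3 := by rw [abs_le]; constructor <;> linarith
      have a2 : |c' - y| ≤ 3 := by rw [abs_le]; constructor <;> linarith
      rw [this]
      calc _ ≤ |(c - x) * (c' - y)| + |x * (c' - y)| + |(c - x) * y| := abs_add_three _ _ _
        _ = |c - x| * |c' - y| + x * |c' - y| + |c - x| * y := by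
          rw [abs_mul, abs_mul, abs_mul, abs_of_pos (by linarith : 0 < x), abs_of_pos (by linarith : 0 < y)]
        _ ≤ 3 * 3 + x * 3 + 3 * y := by gcongr
        _ = _ := by ring
    have hnum : |9 * (c * c' - x * y) - a| ≤ 32 * x + 27 * y := by
      have := abs_le.mp hcc
      rw [abs_le]; constructor <;> nlinarith
    calc _ ≤ (32 * x + 27 * y) * (2-e)^m := by gcongr
      _ = 32 * x * (2-e)^m + 27 * y * (2-e)^m := by ring
      _ ≤ 32 * x * (6 * y) + 27 * y * (6 * x) := by
        have : (2-e)^m ≤ 6 * x := by linarith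
        gcongr
      _ ≤ _ := by nlinarith
  · rw [div_le_iff₀ hp]; linarith

end IsE

lemma lucasK_le (k n : ℕ) (hk : 2 ≤ k) : lucasK k n ≤ 2^(n+1) := by
  induction n using Nat.strong_induction_on with
  | _ n ih =>
    match n with
    | 0 => rw [lucasK_zero]; norm_num
    | 1 => rw [lucasK_one]; norm_num
    | 2 => rw [lucasK_two k hk]; norm_num
    | n+3 =>
      have h2 : lucasK k (n+3) ≤ 2 * lucasK k (n+2) := by
        by_cases hc : k ≤ n + 2
        · have this : lucasK k (n+3) + lucasK k (n+2-k) = 2 * lucasK k (n+2) := lucasK_double k (n+2) hk (by omega) hc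
          omega
        · exact (lucasK_double' k (n+2) hk (by omega) (by omega)).le
      have := ih (n+2) (by omega)
      have h3 : 2^(n+3+1) = 2 * 2^(n+2+1) := by ring
      omega

lemma RepD.d_le {k n m d a : ℕ} (hr : RepD k n m d a) : d ≤ n + m + 2 := by
  obtain ⟨hk, hmn, hd, ha1, ha9, hr⟩ := hr
  have h1 := lucasK_le k n hk
  have h2 := lucasK_le k m hk
  have h3 : lucasK k n * lucasK k m ≤ 2^(n+1) * 2^(m+1) := Nat.mul_le_mul h1 h2
  rw [← pow_add] at h3
  by_contra hc
  have h4 : 10^(n+1+(m+1)+1) ≤ 10^d := Nat.pow_le_pow_right (by norm_num) (by omega)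
  have h5 : 2^(n+1+(m+1)) ≤ 10^(n+1+(m+1)) := Nat.pow_le_pow_left (by norm_num) _
  have h6 : 1 ≤ 10^(n+1+(m+1)) := Nat.one_le_pow _ _ (by norm_num)
  rw [pow_succ] at h4
  have h7 : 10^2 ≤ 10^(n+1+(m+1)) := Nat.pow_le_pow_right (by norm_num) (by omega)
  obtain ⟨b, rfl⟩ : ∃ b, a = b + 1 := ⟨a - 1, by omega⟩
  have h8 : b * 1 ≤ b * 10^d := Nat.mul_le_mul_left b (by omega)
  rw [add_mul, one_mul] at hr
  omega

end

section

/-- residues of the sequence modulo 2^(k-1), up to sign -/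
def lucP : ℕ → ℕ → ℕ
  | _, 0 => 2
  | 0, 1 => 1
  | 0, r+2 => 3*2^r
  | q+1, r+1 => 2 * lucP (q+1) r + lucP q (r+1)

lemma lucP_zero (q : ℕ) : lucP q 0 = 2 := by cases q <;> simp [lucP]

lemma lucP_pos (q r : ℕ) : 1 ≤ lucP q r := by
  induction q generalizing r with
  | zero =>
    match r with
    | 0 => simp [lucP]
    | 1 => simp [lucP]
    | r+2 => simp only [lucP]; have : 1 ≤ 2^r := Nat.one_le_two_pow; omega
  | succ q ih =>
    cases r with
    | zero => simp [lucP]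
    | succ r => simp only [lucP]; have := ih (r+1); omega

lemma lucP_two (q r : ℕ) : 2 ≤ lucP (q+1) r := by
  cases r with
  | zero => simp [lucP]
  | succ r => simp only [lucP]; have := lucP_pos (q+1) r; omega

lemma lucP_dvd (q r : ℕ) : 2^(r-2) ∣ lucP q r := by
  induction q generalizing r with
  | zero =>
    match r with
    | 0 => simp [lucP]
    | 1 => simp [lucP]
    | r+2 => simp only [lucP, Nat.add_sub_cancel]; exact Dvd.intro_left _ rfl
  | succ q ih =>
    induction r with
    | zero => simp [lucP]
    | succ r ih2 =>
      simp only [lucP]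
      apply dvd_add _ (ih (r+1))
      rcases Nat.lt_or_ge r 2 with h | h
      · rw [show r + 1 - 2 = 0 by omega]; simp
      · rw [show r + 1 - 2 = (r - 2) + 1 by omega, pow_succ, mul_comm]
        exact Nat.mul_dvd_mul_left 2 ih2

lemma lucP_le (q r : ℕ) : lucP q r ≤ 3 * (2*(q+1))^r := by
  induction q generalizing r with
  | zero =>
    match r with
    | 0 => simp [lucP]
    | 1 => simp [lucP]
    | r+2 => simp only [lucP, zero_add, mul_one]; rw [pow_add]; omega
  | succ q ih =>
    induction r with
    | zero => simp [lucP]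
    | succ r ih2 =>
      simp only [lucP]
      have h1 := ih (r+1)
      have h2 : (2*(q+1))^r ≤ (2*(q+1+1))^r := Nat.pow_le_pow_left (by omega) _
      rw [pow_succ] at h1 ⊢
      have h3 : (2*(q+1))^r * (2*(q+1)) ≤ (2*(q+1+1))^r * (2*(q+1)) := Nat.mul_le_mul_right _ h2
      nlinarith

lemma lucasK_modeq (k : ℕ) (hk : 2 ≤ k) (q r : ℕ) (hr : r ≤ k) :
    (lucasK k (q*(k+1)+r) : ℤ) ≡ (-1)^q * lucP q r [ZMOD 2^(k-1)] := by
  induction q generalizing r with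
  | zero =>
    match r, hr with
    | 0, _ => simp [lucP, lucasK_zero]
    | 1, _ => simp [lucP, lucasK_one]
    | r+2, hr =>
      simp only [lucP, zero_mul, zero_add, pow_zero, one_mul]
      rw [lucasK_small k r hk hr]
  | succ q ih =>
    induction r with
    | zero =>
      have h1 := lucasK_double k (q*(k+1)+k) hk (by nlinarith) (by omega)
      have e1 : q*(k+1)+k - k = q*(k+1)+0 := by omega
      have e2 : (q+1)*(k+1)+0 = q*(k+1)+k+1 := by ring
      rw [e1] at h1
      rw [e2, lucP_zero]
      have h2 : (lucasK k (q*(k+1)+k+1) : ℤ) = 2 * lucasK k (q*(k+1)+k) - lucasK k (q*(k+1)+0) := by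
        have : (lucasK k (q*(k+1)+k+1) : ℤ) + lucasK k (q*(k+1)+0) = 2 * lucasK k (q*(k+1)+k) := by exact_mod_cast h1
        linarith
      rw [h2]
      have h3 := ih 0 (by omega)
      rw [lucP_zero] at h3
      have h4 := (ih k le_rfl).mul_left 2
      have h5 : (2:ℤ) * ((-1)^q * lucP q k) ≡ 0 [ZMOD 2^(k-1)] := by
        rw [Int.modEq_zero_iff_dvd]
        obtain ⟨c, hc⟩ := lucP_dvd q k
        rw [hc, show k - 1 = (k-2) + 1 by omega]
        refine ⟨(-1)^q * c, ?_⟩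
        push_cast; ring
      have h6 := (h4.trans h5).sub h3
      refine h6.trans ?_
      rw [pow_succ]; ring_nf; rfl
    | succ r ih2 =>
      have h1 := lucasK_double k ((q+1)*(k+1)+r) hk (by nlinarith) (by nlinarith)
      have e1 : (q+1)*(k+1)+r - k = q*(k+1)+(r+1) := by
        have : (q+1)*(k+1)+r = q*(k+1)+(r+1) + k := by ring
        omega
      rw [e1] at h1
      rw [← add_assoc]
      have h2 : (lucasK k ((q+1)*(k+1)+r+1) : ℤ) = 2 * lucasK k ((q+1)*(k+1)+r) - lucasK k (q*(k+1)+(r+1)) := by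
        have : (lucasK k ((q+1)*(k+1)+r+1) : ℤ) + lucasK k (q*(k+1)+(r+1)) = 2 * lucasK k ((q+1)*(k+1)+r) := by exact_mod_cast h1
        linarith
      rw [h2]
      have h6 := ((ih2 (by omega)).mul_left 2).sub (ih (r+1) hr)
      refine h6.trans ?_
      simp only [lucP]; push_cast; rw [pow_succ]; ring_nf; rfl

lemma lucasK_modeq' (k : ℕ) (hk : 2 ≤ k) (n : ℕ) :
    (lucasK k n : ℤ) ≡ (-1)^(n/(k+1)) * lucP (n/(k+1)) (n%(k+1)) [ZMOD 2^(k-1)] := by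
  have h := lucasK_modeq k hk (n/(k+1)) (n%(k+1)) (by have := Nat.mod_lt n (show 0 < k+1 by omega); omega)
  have e : n/(k+1)*(k+1) + n%(k+1) = n := by rw [mul_comm]; exact Nat.div_add_mod n (k+1)
  rwa [e] at h

lemma lucasK_dvd (k : ℕ) (hk : 2 ≤ k) (n : ℕ) : 2^(n%(k+1)-2) ∣ lucasK k n := by
  have h := lucasK_modeq' k hk n
  have hlt := Nat.mod_lt n (show 0 < k+1 by omega)
  have h1 : (2:ℤ)^(n%(k+1)-2) ∣ 2^(k-1) := pow_dvd_pow _ (by omega)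
  have h2 : (2:ℤ)^(n%(k+1)-2) ∣ lucP (n/(k+1)) (n%(k+1)) := by
    have := lucP_dvd (n/(k+1)) (n%(k+1)); exact_mod_cast this
  have h3 := (h.of_dvd h1)
  have h4 : (2:ℤ)^(n%(k+1)-2) ∣ (lucasK k n : ℤ) := by
    rw [← Int.modEq_zero_iff_dvd]
    exact h3.trans (Int.modEq_zero_iff_dvd.mpr (h2.mul_left _))
  exact_mod_cast h4

lemma RepD.res {k n m d a : ℕ} (h : RepD k n m d a) : (n%(k+1)-2) + (m%(k+1)-2) ≤ 3 := by
  obtain ⟨hk, hmn, hd, ha1, ha9, hr⟩ := h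
  have h1 : 2^((n%(k+1)-2) + (m%(k+1)-2)) ∣ a := by
    set x := (n%(k+1)-2) + (m%(k+1)-2) with hx
    have h2 : 2^x ∣ 9 * (lucasK k n * lucasK k m) := by
      rw [hx, pow_add]; exact (Nat.mul_dvd_mul (lucasK_dvd k hk n) (lucasK_dvd k hk m)).mul_left _
    have h3 : 9 * (lucasK k n * lucasK k m) = a * (10^d - 1) := by
      rw [Nat.mul_sub]; omega
    rw [h3] at h2
    refine Nat.Coprime.dvd_of_dvd_mul_right ?_ h2
    apply Nat.Coprime.pow_left
    rw [Nat.coprime_two_left, Nat.odd_iff]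
    have : 10^d = 2 * (5 * 10^(d-1)) := by
      obtain ⟨d, rfl⟩ : ∃ j, d = j + 1 := ⟨d - 1, by omega⟩
      rw [Nat.add_sub_cancel, pow_succ]; ring
    have hp : 1 ≤ 10^(d-1) := Nat.one_le_pow _ _ (by norm_num)
    omega
  have h2 := (Nat.le_of_dvd (by omega) h1).trans ha9
  by_contra hc
  have : 2^4 ≤ 2^((n%(k+1)-2) + (m%(k+1)-2)) := Nat.pow_le_pow_right (by norm_num) (by omega)
  omega

lemma RepD.m_small {k n m d a : ℕ} (h : RepD k n m d a) (hm : m ≤ k) : m ≤ 5 := by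
  have := h.res
  rw [Nat.mod_eq_of_lt (show m < k+1 by omega)] at this
  omega

lemma RepD.n_gt {k n m d a : ℕ} (h : RepD k n m d a) : k < n := by
  by_contra hc
  push Not at hc
  have h1 := h.res
  obtain ⟨hk, hmn, hd, ha1, ha9, hr⟩ := h
  rw [Nat.mod_eq_of_lt (show m < k+1 by omega), Nat.mod_eq_of_lt (show n < k+1 by omega)] at h1
  have hs : ∀ j ≤ k, j ≤ 5 → lucasK k j = if j = 0 then 2 else if j = 1 then 1 else 3 * 2^(j-2) := by
    intro j hj _
    match j, hj with
    | 0, _ => simp [lucasK_zero]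
    | 1, _ => simp [lucasK_one]
    | j+2, hj => simpa using lucasK_small k j hk hj
  rw [hs n hc (by omega), hs m (by omega) (by omega)] at hr
  have hd3 : d < 4 := by
    by_contra hd'
    have h4 : 10^4 ≤ 10^d := Nat.pow_le_pow_right (by norm_num) (by omega)
    have hn : n ≤ 5 := by omega
    have h5 : a * 10^4 ≤ a * 10^d := Nat.mul_le_mul_left a h4
    have : m ≤ 5 := by omega
    interval_cases n <;> interval_cases m <;> simp at hr <;> omega
  have hn : n ≤ 5 := by omega
  have : m ≤ 5 := by omega
  clear hs
  interval_cases d <;> interval_cases n <;> interval_cases m <;> simp at hr h1 <;> omega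

lemma RepD.two_adic {k n m d a : ℕ} (h : RepD k n m d a) :
    2^(min d (k-1)) ≤ 81 * (2*(n/(k+1)+1))^7 + 9 := by
  have hgt := h.n_gt
  have hres := h.res
  obtain ⟨hk, hmn, hd, ha1, ha9, hr⟩ := h
  set x := min d (k-1) with hx
  have hr' : 9 * ((lucasK k n : ℤ) * lucasK k m) + a = a * 10^d := by exact_mod_cast hr
  have hdvd : (2:ℤ)^x ∣ 2^(k-1) := pow_dvd_pow _ (min_le_right _ _)
  have h1 := (lucasK_modeq' k hk n).of_dvd hdvd
  have h2 := (lucasK_modeq' k hk m).of_dvd hdvd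
  have hq : n/(k+1) = (n/(k+1) - 1) + 1 := by
    have : 1 ≤ n/(k+1) := (Nat.one_le_div_iff (by omega)).mpr (by omega)
    omega
  set P := lucP (n/(k+1)) (n%(k+1)) with hP
  set Q := lucP (m/(k+1)) (m%(k+1)) with hQ
  have hP2 : 2 ≤ P := by rw [hP, hq]; exact lucP_two _ _
  have hQ1 : 1 ≤ Q := lucP_pos _ _
  have h3 := ((h1.mul h2).mul_left 9).add_right (a:ℤ)
  rw [hr'] at h3
  have h4 : (2:ℤ)^x ∣ a * 10^d := by
    have h5 : (2:ℤ)^x ∣ 2^d := pow_dvd_pow _ (min_le_left _ _)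
    have h6 : (2:ℤ)^d ∣ 10^d := pow_dvd_pow_of_dvd (by norm_num) d
    exact (h5.trans h6).mul_left _
  have h5 := (h3.symm.trans (Int.modEq_zero_iff_dvd.mpr h4))
  rw [Int.modEq_zero_iff_dvd] at h5
  have hPQ : (2:ℤ) ≤ (P:ℤ) * Q := by
    have : 2 ≤ P * Q := by nlinarith
    exact_mod_cast this
  have ha9' : (a:ℤ) ≤ 9 := by exact_mod_cast ha9
  have ha1' : (1:ℤ) ≤ a := by exact_mod_cast ha1
  have h6 : (2:ℤ)^x ≤ 9 * ((P:ℤ)*Q) + 9 := by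
    rcases neg_one_pow_eq_or ℤ (n/(k+1)) with s | s <;> rcases neg_one_pow_eq_or ℤ (m/(k+1)) with t | t <;> rw [s, t] at h5
    · exact (Int.le_of_dvd (by nlinarith) h5).trans (by linarith)
    · rw [← dvd_neg] at h5
      exact (Int.le_of_dvd (by linarith) h5).trans (by linarith)
    · rw [← dvd_neg] at h5
      exact (Int.le_of_dvd (by linarith) h5).trans (by linarith)
    · exact (Int.le_of_dvd (by linarith) h5).trans (by linarith)
  have h7 : 2^x ≤ 9 * (P*Q) + 9 := by exact_mod_cast h6
  refine h7.trans ?_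
  have hPl := lucP_le (n/(k+1)) (n%(k+1))
  have hQl := lucP_le (m/(k+1)) (m%(k+1))
  have hdiv : m/(k+1) ≤ n/(k+1) := Nat.div_le_div_right hmn
  have hQl' : Q ≤ 3 * (2*(n/(k+1)+1))^(m%(k+1)) := hQl.trans (Nat.mul_le_mul_left 3 (Nat.pow_le_pow_left (by omega) _))
  have h8 := Nat.mul_le_mul hPl hQl'
  have h9 : (2*(n/(k+1)+1))^(n%(k+1) + m%(k+1)) ≤ (2*(n/(k+1)+1))^7 := Nat.pow_le_pow_right (by omega) (by omega)
  rw [pow_add] at h9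
  have : P * Q ≤ 9 * (2*(n/(k+1)+1))^7 := by nlinarith
  omega

end

section

lemma RepD.d_small {k n m d a : ℕ} (h : RepD k n m d a) (hd : d < k - 1) : k ≤ 181 := by
  by_contra hk181
  push Not at hk181
  have hgt := h.n_gt
  have h2 := h.two_adic
  obtain ⟨e, he⟩ := exists_e k h.1
  have hL := he.L_ge n (by omega)
  have hal := he.al_pow n
  have hm := lucasK_pos k m h.1
  obtain ⟨hk, hmn, hd2, ha1, ha9, hr⟩ := h
  have hl : lucasK k n < 10^d := by
    have h3 : a * 10^d ≤ 9 * 10^d := Nat.mul_le_mul_right _ ha9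
    have h4 : lucasK k n * 1 ≤ lucasK k n * lucasK k m := Nat.mul_le_mul_left _ hm
    omega
  have hl' : (lucasK k n : ℝ) ≤ 10^d := by exact_mod_cast hl.le
  have hn6 : (3/2:ℝ)^n ≤ 6 * 10^d := by linarith
  have hnb : n < 6 * (k+1) := by
    by_contra hc
    push Not at hc
    have h3 : (3/2:ℝ)^(6*(d+1)) ≤ (3/2)^n := pow_le_pow_right₀ (by norm_num) (by omega)
    rw [pow_mul] at h3
    have h4 : (10:ℝ)^(d+1) ≤ ((3/2)^6)^(d+1) := pow_le_pow_left₀ (by norm_num) (by norm_num) _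
    rw [pow_succ] at h4
    have : (0:ℝ) < 10^d := by positivity
    linarith
  have hq : n/(k+1) ≤ 5 := by
    have : n/(k+1) < 6 := by rw [Nat.div_lt_iff_lt_mul (by omega)]; omega
    omega
  have h3 : (2*(n/(k+1)+1))^7 ≤ 12^7 := Nat.pow_le_pow_left (by omega) 7
  rw [min_eq_left (by omega)] at h2
  have hd31 : d ≤ 31 := by
    by_contra hc
    have : 2^32 ≤ 2^d := Nat.pow_le_pow_right (by norm_num) (by omega)
    omega
  have h5 : (3/2:ℝ)^182 ≤ (3/2)^n := pow_le_pow_right₀ (by norm_num) (by omega)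
  have h6 : (10:ℝ)^d ≤ 10^31 := pow_le_pow_right₀ (by norm_num) hd31
  have h7 : (6:ℝ) * 10^31 < (3/2)^182 := by norm_num
  linarith

lemma RepD.two_adic' {k n m d a : ℕ} (h : RepD k n m d a) (hk : 182 ≤ k) :
    2^(k-1) ≤ 81 * (2*(n/(k+1)+1))^7 + 9 := by
  have h2 := h.two_adic
  rw [min_eq_right] at h2
  · exact h2
  · by_contra hc
    have := h.d_small (by omega)
    omega

lemma RepD.k_le {k n m d a : ℕ} (h : RepD k n m d a) (b : ℕ) (hn : n < 2^b) : k ≤ max 181 (7*b+15) := by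
  by_cases hk : k ≤ 181
  · exact hk.trans (le_max_left _ _)
  apply le_trans _ (le_max_right _ _)
  have h2 := h.two_adic' (by omega)
  have hgt := h.n_gt
  have h3 : n/(k+1) + 1 ≤ n := by
    have : n/(k+1) ≤ n/2 := Nat.div_le_div_left (by omega) (by norm_num)
    omega
  have h4 : (2*(n/(k+1)+1))^7 ≤ (2^(b+1))^7 := Nat.pow_le_pow_left (by rw [pow_succ]; omega) 7
  rw [← pow_mul] at h4
  by_contra hc
  have h5 : 2^((b+1)*7 + 7 + 1) ≤ 2^(k-1) := Nat.pow_le_pow_right (by norm_num) (by omega)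
  have h6 : 2^((b+1)*7 + 7 + 1) = 256 * 2^((b+1)*7) := by rw [pow_add, pow_add]; ring
  have : 1 ≤ 2^((b+1)*7) := Nat.one_le_two_pow
  omega

end

section

open Polynomial

/-- admissible parameters for the linear form estimate -/
def BParam (D g L S₀ σ J τ c bB w : ℕ) : Prop :=
  1 ≤ g ∧ 1 ≤ L ∧ 1 ≤ S₀ ∧ 3 ≤ σ ∧ 1 ≤ J ∧ 1 ≤ τ ∧
  (2*D+5)*((L+1+J*τ)*((L+1+J*τ)*S₀)) ≤ (g*L+1)*((g*L+1)*(L+1)) ∧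
  (g*L+1)*((g*L+1)*(L+1)) ≤ 2^c ∧
  (g*L+1)*((g*L+1)*(L+1)) ≤ σ^J*S₀ ∧
  2 + (D+2)*(2*c + 4*(L+1+J*τ)*bB + 8*(g*L)*S₀) + (8*(D+2)+81)*(g*L)*σ*S₀ ≤ 3*S₀*τ ∧
  8*(σ^J*S₀*(τ+2)+1) ≤ 2^w ∧ 6*L*(σ^J*S₀) ≤ 2^w

lemma Liou.mono {α : ℝ} {D D' : ℕ} (h : Liou α D) (hD : D ≤ D') : Liou α D' := by
  intro Q Bd h1 h2 h3
  refine (h Q Bd h1 h2 h3).trans ?_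
  exact mul_le_mul_of_nonneg_left (pow_le_pow_right₀ h1 hD) (abs_nonneg _)

lemma bound_of (k : ℕ) (e : ℝ) (h : IsE k e) (m W c : ℕ) (C : ℝ) (hC : C ≤ 2^c) (x : ℝ)
    (h1 : (1/2:ℝ)^W < x) (h2 : x ≤ C / (2-e)^m) : m ≤ 2*(W+c) := by
  have hp : (0:ℝ) < (2-e)^m := by have := h.half; apply pow_pos; linarith
  have h3 : (1/2:ℝ)^W < 2^c/(2-e)^m := h1.trans_le (h2.trans (by gcongr))
  rw [lt_div_iff₀ hp, one_div, inv_pow, inv_mul_lt_iff₀ (by positivity), ← pow_add] at h3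
  by_contra hc
  push Not at hc
  have h4 : (2-e)^(2*(W+c)) ≤ (2-e)^m := pow_le_pow_right₀ (by linarith [h.half]) hc.le
  have h5 : (2:ℝ)^(W+c) ≤ (2-e)^(2*(W+c)) := by
    rw [pow_mul]; apply pow_le_pow_left₀ (by norm_num); nlinarith [h.half]
  linarith

namespace IsE
variable {k : ℕ} {e : ℝ}

lemma norm_lin (z : ℂ) (hz : ‖z‖ ≤ 2) (p q : ℕ) : ‖(p:ℂ) * z - q‖ ≤ 2 * p + q := by
  calc ‖(p:ℂ) * z - q‖ ≤ ‖(p:ℂ) * z‖ + ‖(q:ℂ)‖ := norm_sub_le _ _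
    _ = p * ‖z‖ + q := by rw [norm_mul]; simp
    _ ≤ _ := by nlinarith [(Nat.cast_nonneg p : (0:ℝ) ≤ p)]

set_option maxHeartbeats 1600000 in
lemma bakerX (h : IsE k e) {n m d a : ℕ} (hr : RepD k n m d a) (hn : 10 ≤ n)
    {D g L S₀ σ J τ c bB w : ℕ} (hp : BParam D g L S₀ σ J τ c bB w) (hD : k ≤ D + 1)
    (hg1 : 270 * 2^m ≤ 10^g) (hg2 : 72 * (k+1) ≤ 10^g) (hB : g*L + (2*n+2)*L ≤ 2^bB) (hA : g*L < n) :
    n ≤ 2*(w*(σ^J*S₀*τ) + 6) := by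
  have hX := h.formX hr hn
  have hdl := hr.d_le
  obtain ⟨_, hmn, hd, ha1, ha9, _⟩ := hr
  obtain ⟨p1, p2, p3, p4, p5, p6, p7, p8, p9, p10, p11, p12⟩ := hp
  have ha1' : (1:ℝ) ≤ a := by exact_mod_cast ha1
  have ha9' : (a:ℝ) ≤ 9 := by exact_mod_cast ha9
  have he := h.half
  have he0 := h.2.1
  have hden := h.den_pos
  have hg1' : 270 * (2:ℝ)^m ≤ 10^g := by exact_mod_cast hg1
  have hg2' : 72 * ((k:ℝ)+1) ≤ 10^g := by exact_mod_cast hg2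
  have hLm : (lucasK k m : ℝ) ≤ 2 * 2^m := by
    have := lucasK_le k m h.1
    rw [pow_succ] at this
    have h2 : (lucasK k m : ℝ) ≤ 2^m * 2 := by exact_mod_cast this
    linarith
  have hL1 := h.Lpos m
  have hCl := h.Cst_lower
  have hCu := h.Cst_upper
  have h2m : (1:ℝ) ≤ 2^m := one_le_pow₀ (by norm_num)
  have key := baker_param (2-e) (9 * lucasK k m * Cst k e / a) D g L (g*L) n d (L+1+J*τ) S₀ σ J τ c bB w
    (C ((9 * lucasK k m : ℕ):ℤ) * ((C 2 * X - C 1) * (C 1 * X - C 1))) (C (a:ℤ) * (X * (C ((k+1:ℕ):ℤ) * X - C ((2*k:ℕ):ℤ))))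
    (h.liou.mono (by omega)) (by linarith) (by linarith) h.hind rfl p1 p2
    (by
      intro z hz
      have n1 := norm_lin z hz 2 1
      have n2 := norm_lin z hz 1 1
      simp only [map_mul, map_sub, aeval_X, aeval_C, norm_mul]
      simp only [algebraMap_int_eq, eq_intCast, Int.cast_natCast, Complex.norm_natCast]
      push_cast at n1 n2 ⊢
      calc _ ≤ 9 * (lucasK k m : ℝ) * ((2*2+1) * (2*1+1)) := by gcongr
        _ ≤ _ := by linarith)
    (by
      intro z hz
      have n1 := norm_lin z hz (k+1) (2*k)
      simp only [map_mul, map_sub, aeval_X, aeval_C, norm_mul]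
      simp only [algebraMap_int_eq, eq_intCast, Int.cast_natCast, Complex.norm_natCast]
      push_cast at n1 ⊢
      calc _ ≤ (9:ℝ) * (2 * (2*(k+1)+2*k)) := by gcongr
        _ ≤ _ := by linarith)
    (by
      simp only [map_mul, map_sub, aeval_X, aeval_C]
      simp only [algebraMap_int_eq, eq_intCast, Int.cast_natCast]
      have : ((k+1:ℕ):ℝ) * (2-e) - ((2*k:ℕ):ℝ) = 2 - (k+1)*e := by push_cast; ring
      rw [this]
      have h1 : (0:ℝ) < a := by linarith
      have h2 : 0 < 2 - e := by linarith
      have h3 : 0 < 2 - (k+1)*e := by linarith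
      positivity)
    (by
      simp only [map_mul, map_sub, aeval_X, aeval_C]
      simp only [algebraMap_int_eq, eq_intCast, Int.cast_natCast]
      have : ((k+1:ℕ):ℝ) * (2-e) - ((2*k:ℕ):ℝ) = 2 - (k+1)*e := by push_cast; ring
      rw [this]
      unfold Cst
      have h2 : 2 - e ≠ 0 := by linarith
      have h3 : 2 - (k+1)*e ≠ 0 := by linarith
      push_cast
      field_simp
      ring)
    (by positivity)
    (by
      rw [div_le_iff₀ (by linarith)]
      calc 9 * (lucasK k m : ℝ) * Cst k e ≤ 9 * (2 * 2^m) * 2 := by gcongr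
        _ ≤ 10^g * 1 := by linarith
        _ ≤ 10^g * a := by gcongr)
    (by
      have : 1/3 ≤ 9 * (lucasK k m : ℝ) * Cst k e / a := by
        rw [le_div_iff₀ (by linarith)]; nlinarith
      nlinarith)
    (le_trans (Nat.add_le_add_left (Nat.mul_le_mul_right L (by omega)) _) hB) (le_trans (Nat.add_le_add_left (Nat.mul_le_mul_right L (by omega)) _) hB) hA p7 p8 p3 p4 rfl p5 p6 p9 p10 p11 p12
  exact bound_of k e h n _ 6 48 (by norm_num) _ key hX

set_option maxHeartbeats 1600000 in
lemma bakerY (h : IsE k e) {n m d a : ℕ} (hr : RepD k n m d a) (hm : 12 ≤ m)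
    {D g L S₀ σ J τ c bB w : ℕ} (hp : BParam D g L S₀ σ J τ c bB w) (hD : k ≤ D + 1)
    (hg : 2025 * (k+1)^2 ≤ 10^g) (hB : g*L + (2*n+2)*L ≤ 2^bB) (hA : g*L < n) :
    m ≤ 2*(w*(σ^J*S₀*τ) + 7) := by
  have hX := h.formY hr hm
  have hdl := hr.d_le
  obtain ⟨_, hmn, hd, ha1, ha9, _⟩ := hr
  obtain ⟨p1, p2, p3, p4, p5, p6, p7, p8, p9, p10, p11, p12⟩ := hp
  have ha1' : (1:ℝ) ≤ a := by exact_mod_cast ha1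
  have ha9' : (a:ℝ) ≤ 9 := by exact_mod_cast ha9
  have he := h.half
  have he0 := h.2.1
  have hden := h.den_pos
  have hk := h.kpos
  have hg' : 2025 * ((k:ℝ)+1)^2 ≤ 10^g := by exact_mod_cast hg
  have hCl := h.Cst_lower
  have hCu := h.Cst_upper
  have key := baker_param (2-e) (9 * (Cst k e)^2 / a) D g L (g*L) (n+m) d (L+1+J*τ) S₀ σ J τ c bB w
    (C 9 * ((C 2 * X - C 1) * (C 1 * X - C 1))^2) (C (a:ℤ) * (X * (C ((k+1:ℕ):ℤ) * X - C ((2*k:ℕ):ℤ)))^2)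
    (h.liou.mono (by omega)) (by linarith) (by linarith) h.hind rfl p1 p2
    (by
      intro z hz
      have n1 := norm_lin z hz 2 1
      have n2 := norm_lin z hz 1 1
      simp only [map_mul, map_sub, map_pow, aeval_X, aeval_C, norm_mul, norm_pow]
      simp only [algebraMap_int_eq, eq_intCast]
      push_cast at n1 n2 ⊢
      have n9 : ‖(9:ℂ)‖ = 9 := by simp
      rw [n9]
      calc _ ≤ 9 * (((2:ℝ)*2+1) * (2*1+1))^2 := by gcongr
        _ ≤ _ := by nlinarith)
    (by
      intro z hz
      have n1 := norm_lin z hz (k+1) (2*k)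
      simp only [map_mul, map_sub, map_pow, aeval_X, aeval_C, norm_mul, norm_pow]
      simp only [algebraMap_int_eq, eq_intCast, Int.cast_natCast, Complex.norm_natCast]
      push_cast at n1 ⊢
      calc _ ≤ (9:ℝ) * (2 * (2*(k+1)+2*k))^2 := by gcongr
        _ ≤ _ := by nlinarith)
    (by
      simp only [map_mul, map_sub, map_pow, aeval_X, aeval_C]
      simp only [algebraMap_int_eq, eq_intCast, Int.cast_natCast]
      have : ((k+1:ℕ):ℝ) * (2-e) - ((2*k:ℕ):ℝ) = 2 - (k+1)*e := by push_cast; ring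
      rw [this]
      have h1 : (0:ℝ) < a := by linarith
      have h2 : 0 < 2 - e := by linarith
      have h3 : 0 < 2 - (k+1)*e := by linarith
      positivity)
    (by
      simp only [map_mul, map_sub, map_pow, aeval_X, aeval_C]
      simp only [algebraMap_int_eq, eq_intCast, Int.cast_natCast]
      have : ((k+1:ℕ):ℝ) * (2-e) - ((2*k:ℕ):ℝ) = 2 - (k+1)*e := by push_cast; ring
      rw [this]
      unfold Cst
      have h2 : 2 - e ≠ 0 := by linarith
      have h3 : 2 - (k+1)*e ≠ 0 := by linarith
      push_cast
      field_simp
      ring)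
    (by positivity)
    (by
      rw [div_le_iff₀ (by linarith)]
      calc 9 * (Cst k e)^2 ≤ 9 * 2^2 := by gcongr
        _ ≤ 10^g * 1 := by nlinarith
        _ ≤ 10^g * a := by gcongr)
    (by
      have : 1/9 ≤ 9 * (Cst k e)^2 / a := by
        rw [le_div_iff₀ (by linarith)]; nlinarith
      nlinarith)
    (le_trans (Nat.add_le_add_left (Nat.mul_le_mul_right L (by omega)) _) hB) (le_trans (Nat.add_le_add_left (Nat.mul_le_mul_right L (by omega)) _) hB) (by omega) p7 p8 p3 p4 rfl p5 p6 p9 p10 p11 p12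
  exact bound_of k e h m _ 7 120 (by norm_num) _ key hX

end IsE

end

section

lemma lin_le_two_pow (s : ℕ) (hs : 13 ≤ s) : 300 * s ≤ 2^(s-1) := by
  induction s, hs using Nat.le_induction with
  | base => norm_num
  | succ s hs ih =>
    have : 2^(s+1-1) = 2 * 2^(s-1) := by
      rw [show s + 1 - 1 = (s-1) + 1 by omega, pow_succ]; ring
    omega

lemma pow_le_two_pow (b c : ℕ) (hb : 4096 ≤ b) (hc : c ≤ 300) : b^c ≤ 2^b := by
  set s := Nat.size b with hs
  have h1 : b < 2^s := Nat.lt_size_self b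
  have h2 : 13 ≤ s := by
    have : 12 < s := Nat.lt_size.mpr (by norm_num; omega)
    omega
  have h3 : 2^(s-1) ≤ b := Nat.lt_size.mp (by omega)
  calc b^c ≤ (2^s)^c := Nat.pow_le_pow_left h1.le c
    _ = 2^(s*c) := by rw [pow_mul]
    _ ≤ 2^b := Nat.pow_le_pow_right (by norm_num) (by
      calc s * c ≤ s * 300 := Nat.mul_le_mul_left s hc
        _ = 300 * s := by ring
        _ ≤ _ := (lin_le_two_pow s h2).trans h3)

lemma genParam (b g J : ℕ) (hb : 4096 ≤ b) (hJ1 : 1 ≤ J) (hJ2 : J ≤ 148) (hg : 1 ≤ g) (hg2 : g ≤ b^57)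
    (hJ : (g*b^12+1)*((g*b^12+1)*(b^12+1)) ≤ b^J*b^3) :
    BParam (8*b) g (b^12) (b^3) b J (g*b^15) b (2*b) b := by
  have hb0 : 0 < b := by omega
  have hp : ∀ c, 1 ≤ b^c := fun c => Nat.one_le_pow _ _ hb0
  have hT : b^12+1+J*(g*b^15) ≤ 149 * (g * b^15) := by
    have h1 : b^12 + 1 ≤ b^15 := by
      have : b^15 = b^12 * b^3 := by rw [← pow_add]
      have h3 : 2 ≤ b^3 := by
        calc 2 ≤ b := by omega
          _ ≤ b^3 := Nat.le_self_pow (by norm_num) b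
      have := hp 12
      nlinarith
    have h2 : 1 * b^15 ≤ g * b^15 := Nat.mul_le_mul_right _ hg
    have h3 : J * (g*b^15) ≤ 148 * (g*b^15) := Nat.mul_le_mul_right _ hJ2
    omega
  have hbJ : b^J * b^3 ≤ b^151 := by
    rw [← pow_add]; exact Nat.pow_le_pow_right hb0 (by omega)
  have hgt : g * b^15 ≤ b^72 := by
    calc g * b^15 ≤ b^57 * b^15 := Nat.mul_le_mul_right _ hg2
      _ = b^72 := by rw [← pow_add]
  refine ⟨hg, hp _, hp _, by omega, hJ1, by have := hp 15; nlinarith, ?_, ?_, hJ, ?_, ?_, ?_⟩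
  · calc (2*(8*b)+5)*((b^12+1+J*(g*b^15))*((b^12+1+J*(g*b^15))*b^3))
        ≤ (17*b)*((149 * (g * b^15))*((149 * (g * b^15))*b^3)) := by gcongr; omega
      _ = 377417 * (g*g*b^34) := by ring
      _ ≤ (b*b) * (g*g*b^34) := by gcongr; nlinarith
      _ = (g*b^12)*((g*b^12)*b^12) := by ring
      _ ≤ _ := by gcongr <;> omega
  · exact hJ.trans (hbJ.trans (pow_le_two_pow b 151 hb (by norm_num)))
  · set G := g * b^15 with hG
    have h1 : (8*b+2)*(4*(b^12+1+J*G)*(2*b)) ≤ (8*b+2)*(4*(149*G)*(2*b)) := by gcongr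
    have e2 : g*b^12*b^3 = G := by rw [hG]; ring
    have e3 : b^3 * G = b * b * b * G := by ring
    have hGb : b ≤ G := by
      calc b = 1 * b^1 := by ring
        _ ≤ g * b^15 := by gcongr; omega
    have e4 : (8*(8*b+2)+81)*(g*b^12)*b*b^3 = (8*(8*b+2)+81)*b*G := by rw [← e2]; ring
    have e5 : (8*b+2)*(2*b + 4*(b^12+1+J*G)*(2*b) + 8*(g*b^12)*b^3) = (8*b+2)*(2*b) + (8*b+2)*(4*(b^12+1+J*G)*(2*b)) + (8*b+2)*8*G := by rw [← e2]; ring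
    rw [e5, e4, show 3 * b^3*G = 3*(b*b*b*G) by ring]
    have k1 : 4096 * (b*b*G) ≤ b*b*b*G := by
      calc 4096 * (b*b*G) ≤ b * (b*b*G) := Nat.mul_le_mul_right _ hb
        _ = _ := by ring
    have k2 : 4096 * (b*G) ≤ b*b*G := by
      calc 4096 * (b*G) ≤ b * (b*G) := Nat.mul_le_mul_right _ hb
        _ = _ := by ring
    have k3 : 4096 * G ≤ b * G := Nat.mul_le_mul_right _ hb
    have k4 : b * b ≤ b * G := Nat.mul_le_mul_left _ hGb
    have h1' : (8*b+2)*(4*(149*G)*(2*b)) = 9536 * (b*b*G) + 2384 * (b*G) := by ring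
    have h2' : (8*b+2)*(2*b) = 16*(b*b) + 4 * b := by ring
    have h3' : (8*b+2)*8*G = 64 * (b*G) + 16 * G := by ring
    have h4' : (8*(8*b+2)+81)*b*G = 64 * (b*b*G) + 97*(b*G) := by ring
    rw [h1'] at h1
    rw [h2', h3', h4']
    omega
  · calc 8*(b^J*b^3*(g*b^15+2)+1) ≤ 8*(b^151*(b^72+2)+1) := by gcongr
      _ ≤ b^224 := by
        have : b^224 = b^151 * (b^72 * b) := by rw [← pow_succ, ← pow_add]
        rw [this]
        have h1 := hp 151
        have h2 : b^72 * 4096 ≤ b^72 * b := Nat.mul_le_mul_left _ hb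
        have h3 := hp 72
        have h4 : b^151 * (b^72*4096) ≤ b^151 * (b^72*b) := Nat.mul_le_mul_left _ h2
        have h5 : b^151 * 1 ≤ b^151 * b^72 := Nat.mul_le_mul_left _ h3
        have e1 : b^151 * (b^72 * 4096) = 4096 * (b^151 * b^72) := by ring
        have e2 : 8*(b^151*(b^72+2)+1) = 8 * (b^151*b^72) + 16 * b^151 + 8 := by ring
        rw [e2]
        omega
      _ ≤ _ := pow_le_two_pow b 224 hb (by norm_num)
  · calc 6*b^12*(b^J*b^3) ≤ b*b^12*b^151 := by gcongr; omega
      _ = b^164 := by ring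
      _ ≤ _ := pow_le_two_pow b 164 hb (by norm_num)

lemma pow_big (b x y : ℕ) (hb : 4096 ≤ b) (hxy : x < y) (c : ℕ) (hc : c ≤ 4096) : c * b^x ≤ b^y := by
  calc c * b^x ≤ b * b^x := Nat.mul_le_mul_right _ (by omega)
    _ = b^(x+1) := by ring
    _ ≤ b^y := Nat.pow_le_pow_right (by omega) hxy

theorem RepD.generic {k n m d a : ℕ} (hr : RepD k n m d a) : n < 2^4096 := by
  by_contra hc
  push Not at hc
  set b := Nat.size n with hbdef
  have hnb : n < 2^b := Nat.lt_size_self n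
  have hb' : 4096 < b := Nat.lt_size.mpr hc
  have hb : 4096 ≤ b := hb'.le
  have hnl : 2^(b-1) ≤ n := Nat.lt_size.mp (by omega)
  have hb2 : 2^b = 2 * 2^(b-1) := by rw [← pow_succ']; congr 1; omega
  obtain ⟨e, he⟩ := exists_e k hr.1
  have hk : k ≤ 8*b := by
    have := hr.k_le b hnb
    rcases le_max_iff.mp this with h | h <;> omega
  have hp : ∀ c, 1 ≤ b^c := fun c => Nat.one_le_pow _ _ (by omega)
  have hn100 : b^290 ≤ n := by
    have h1 := pow_le_two_pow b 291 hb (by norm_num)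
    have h2 := pow_big b 290 291 hb (by norm_num) 2 (by norm_num)
    omega
  have hn10 : b ≤ n := (Nat.le_self_pow (by norm_num) b).trans hn100
  have hBB : ∀ g, g ≤ b^57 → g*b^12 + (2*n+2)*b^12 ≤ 2^(2*b) := by
    intro g hg
    have h1 : b^70 ≤ 2^b := pow_le_two_pow b 70 hb (by norm_num)
    have h2 : g*b^12 ≤ b^69 := by
      calc g * b^12 ≤ b^57 * b^12 := Nat.mul_le_mul_right _ hg
        _ = b^69 := by rw [← pow_add]
    have h3 := pow_big b 69 70 hb (by norm_num) 4 (by norm_num)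
    have h4 := pow_big b 12 70 hb (by norm_num) 4 (by norm_num)
    have h5 : (2*n+2) ≤ 2 * 2^b := by omega
    have h6 : (2*n+2)*b^12 ≤ 2*2^b * b^12 := Nat.mul_le_mul_right _ h5
    have h7 : 2^b * (4*b^12) ≤ 2^b * 2^b := Nat.mul_le_mul_left _ (h4.trans h1)
    have h8 : 2^(2*b) = 2^b * 2^b := by rw [two_mul, pow_add]
    have h9 : 2^b * 1 ≤ 2^b * 2^b := Nat.mul_le_mul_left _ Nat.one_le_two_pow
    have e1 : 2^b * (4*b^12) = 4 * (2^b * b^12) := by ring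
    have e2 : 2*2^b*b^12 = 2 * (2^b*b^12) := by ring
    omega
  have hAA : ∀ g, g ≤ b^57 → g*b^12 < n := by
    intro g hg
    have h2 : g*b^12 ≤ b^69 := by
      calc g * b^12 ≤ b^57 * b^12 := Nat.mul_le_mul_right _ hg
        _ = b^69 := by rw [← pow_add]
    have h3 := pow_big b 69 290 hb (by norm_num) 2 (by norm_num)
    have := hp 69
    omega
  have hm : m ≤ b^57 := by
    by_cases hm12 : m < 12
    · have : b ≤ b^57 := Nat.le_self_pow (by norm_num) b
      omega
    have hP := genParam b b 36 hb (by norm_num) (by norm_num) (by omega) (Nat.le_self_pow (by norm_num) b) (by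
      have e : b * b^12 = b^13 := by ring
      rw [e]
      have h1 : b^13+1 ≤ 2*b^13 := by have := hp 13; omega
      have h2 : b^12+1 ≤ 2*b^12 := by have := hp 12; omega
      calc (b^13+1)*((b^13+1)*(b^12+1)) ≤ (2*b^13)*((2*b^13)*(2*b^12)) := by gcongr
        _ = 8 * b^38 := by ring
        _ ≤ b^39 := pow_big b 38 39 hb (by norm_num) 8 (by norm_num)
        _ = b^36*b^3 := by rw [← pow_add])
    have hY := he.bakerY hr (by omega) hP (by omega) (by
      have h1 : k + 1 ≤ 9*b := by omega
      have h2 : b < 2^b := Nat.lt_two_pow_self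
      have h3 : 2025 * (k+1)^2 ≤ 2025 * (9*b)^2 := by gcongr
      have h4 := pow_le_two_pow b 4 hb (by norm_num)
      have h5 : 2^b ≤ 10^b := Nat.pow_le_pow_left (by norm_num) b
      have h6 : 2025*(9*b)^2 = 164025 * (b*b) := by ring
      have h7 : b^4 = (b*b)*(b*b) := by ring
      have h8 : 4096*4096 ≤ b*b := Nat.mul_le_mul hb hb
      have h9 : 4096*4096*(b*b) ≤ (b*b)*(b*b) := Nat.mul_le_mul_right _ h8
      omega) (hBB b (Nat.le_self_pow (by norm_num) b)) (hAA b (Nat.le_self_pow (by norm_num) b))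
    have e : 2*(b*(b^36*b^3*(b*b^15))+7) = 2*b^56+14 := by ring
    rw [e] at hY
    have h1 := pow_big b 56 57 hb (by norm_num) 16 (by norm_num)
    have := hp 56
    omega
  have hP := genParam b (b^57) 148 hb (by norm_num) (by norm_num) (hp _) le_rfl (by
      have e : b^57 * b^12 = b^69 := by rw [← pow_add]
      rw [e]
      have h1 : b^69+1 ≤ 2*b^69 := by have := hp 69; omega
      have h2 : b^12+1 ≤ 2*b^12 := by have := hp 12; omega
      calc (b^69+1)*((b^69+1)*(b^12+1)) ≤ (2*b^69)*((2*b^69)*(2*b^12)) := by gcongr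
        _ = 8 * b^150 := by ring
        _ ≤ b^151 := pow_big b 150 151 hb (by norm_num) 8 (by norm_num)
        _ = b^148*b^3 := by rw [← pow_add])
  have hbb : b ≤ b^57 := Nat.le_self_pow (by norm_num) b
  have hX := he.bakerX hr (by omega) hP (by omega) (by
      have h1 : 2^m ≤ 2^(b^57) := Nat.pow_le_pow_right (by norm_num) hm
      have h2 : 10^(b^57) = 2^(b^57) * 5^(b^57) := by rw [← mul_pow, show 2 * 5 = 10 by norm_num]
      rw [h2, mul_comm]
      apply Nat.mul_le_mul h1
      calc 270 ≤ 5^4 := by norm_num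
        _ ≤ _ := Nat.pow_le_pow_right (by norm_num) (by omega)) (by
      have h1 : b^57 < 2^(b^57) := Nat.lt_two_pow_self
      have h2 : 10^(b^57) = 2^(b^57) * 5^(b^57) := by rw [← mul_pow, show 2 * 5 = 10 by norm_num]
      rw [h2, mul_comm]
      apply Nat.mul_le_mul
      · have h3 := pow_big b 1 57 hb (by norm_num) 10 (by norm_num)
        rw [pow_one] at h3
        omega
      · calc 72 ≤ 5^4 := by norm_num
          _ ≤ _ := Nat.pow_le_pow_right (by norm_num) (by omega)) (hBB _ le_rfl) (hAA _ le_rfl)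
  have e : 2*(b*(b^148*b^3*(b^57*b^15))+6) = 2*b^224+12 := by
    rw [show b*(b^148*b^3*(b^57*b^15)) = b^224 by ring]; ring
  rw [e] at hX
  have h1 := pow_big b 224 290 hb (by norm_num) 16 (by norm_num)
  have := hp 224
  omega

end

section

lemma RepD.passY {k n m d a : ℕ} (hr : RepD k n m d a) {D g L S₀ σ J τ c bB w bn M : ℕ} (hn : n < 2^bn) (hD : k ≤ D + 1)
    (hp : BParam D g L S₀ σ J τ c bB w) (hg : 2025*(D+2)^2 ≤ 10^g) (hB : g*L + (2*2^bn+2)*L ≤ 2^bB)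
    (h1 : g*L < M ∧ 12 ≤ M) (h2 : 2*(w*(σ^J*S₀*τ)+7) < M) : m < M := by
  obtain ⟨e, he⟩ := exists_e k hr.1
  have hmn := hr.2.1
  by_cases hm : m < 12
  · omega
  by_cases hA : g*L < n
  · have := he.bakerY hr (by omega) hp hD (le_trans (Nat.mul_le_mul_left _ (Nat.pow_le_pow_left (by omega) 2)) hg)
      (le_trans (Nat.add_le_add_left (Nat.mul_le_mul_right L (by omega)) _) hB) hA
    omega
  · omega

lemma RepD.passX {k n m d a : ℕ} (hr : RepD k n m d a) {D g L S₀ σ J τ c bB w bn M N : ℕ} (hn : n < 2^bn) (hm : m < M)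
    (hD : k ≤ D + 1)
    (hp : BParam D g L S₀ σ J τ c bB w) (hg : 72*(D+2) ≤ 10^7 ∧ 7 ≤ g ∧ M ≤ 3*(g-3)) (hB : g*L + (2*2^bn+2)*L ≤ 2^bB)
    (h1 : g*L < N ∧ 10 ≤ N) (h2 : 2*(w*(σ^J*S₀*τ)+6) < N) : n < N := by
  obtain ⟨e, he⟩ := exists_e k hr.1
  by_cases hn10 : n < 10
  · omega
  by_cases hA : g*L < n
  · have := he.bakerX hr (by omega) hp hD (by
        have h3 : 2^m ≤ 2^(3*(g-3)) := Nat.pow_le_pow_right (by norm_num) (by omega)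
        rw [pow_mul] at h3
        have h4 : (2^3)^(g-3) ≤ 10^(g-3) := Nat.pow_le_pow_left (by norm_num) _
        have h5 : 10^g = 10^3 * 10^(g-3) := by rw [← pow_add]; congr 1; omega
        omega) (by
        have h3 : 10^7 ≤ 10^g := Nat.pow_le_pow_right (by norm_num) hg.2.1
        omega)
      (le_trans (Nat.add_le_add_left (Nat.mul_le_mul_right L (by omega)) _) hB) hA
    omega
  · omega

lemma RepD.pass1 {k n m d a : ℕ} (hr : RepD k n m d a) (hn : n < 2^4096) : n < 2^1847 := by
  have hk : k ≤ 28687 := by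
    have := hr.k_le 4096 hn
    norm_num at this; omega
  have hm : m < 2^459 := hr.passY (D := 28686) (g := 13) (L := 25389909913768629208900945575938) (S₀ := 58659845377) (σ := 5) (J := 123) (τ := 231915576090037218829783785697927676071) (c := 321) (bB := 4202) (w := 452)
    hn (by omega) (by unfold BParam; decide +kernel) (by decide +kernel) (by decide +kernel) (by decide +kernel) (by decide +kernel)
  exact hr.passX (D := 28686) (g := 2^459/3+4) (L := 1929563141984953269738471780515842) (S₀ := 248469751553) (σ := 5) (J := 521) (τ := 672715068192444742325436794046555051949143951406736978635627414519217629161037105031762172083934756152504600015015014797249898380492201727010447471685183723592159656397875498736) (c := 1247) (bB := 4208) (w := 1838)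
    hn hm (by omega) (by unfold BParam; decide +kernel) (by decide +kernel) (by decide +kernel) (by decide +kernel) (by decide +kernel)

lemma RepD.pass2 {k n m d a : ℕ} (hr : RepD k n m d a) (hn : n < 2^1847) : n < 2^1744 := by
  have hk : k ≤ 12944 := by
    have := hr.k_le 1847 hn
    norm_num at this; omega
  have hm : m < 2^433 := hr.passY (D := 12943) (g := 12) (L := 405435541211281218386597511170) (S₀ := 11454357361) (σ := 5) (J := 116) (τ := 1543069609467957536131717279375435271) (c := 303) (bB := 1947) (w := 426)
    hn (by omega) (by unfold BParam; decide +kernel) (by decide +kernel) (by decide +kernel) (by decide +kernel) (by decide +kernel)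
  exact hr.passX (D := 12943) (g := 2^433/3+4) (L := 33579254403597740094283828953090) (S₀ := 56383086661) (σ := 4) (J := 571) (τ := 65618728352335947638115805498508388422251480958251835537599116429685389240933217340458498936677602052909553480903110494115326530506366475285180283106382185863886944264) (c := 1178) (bB := 1953) (w := 1735)
    hn hm (by omega) (by unfold BParam; decide +kernel) (by decide +kernel) (by decide +kernel) (by decide +kernel) (by decide +kernel)

end

section

/-- Forcing the evaluation of a natural number before passing it on. -/
noncomputable def fz (n : ℕ) (f : ℕ → Bool) : Bool := Nat.rec (f 0) (fun m _ => f (Nat.succ m)) n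
noncomputable def bA (b t : Bool) : Bool := Bool.rec false t b
noncomputable def bO (b t : Bool) : Bool := Bool.rec t true b

lemma fz_eq (n : ℕ) (f : ℕ → Bool) : fz n f = f n := by cases n <;> rfl
lemma bA_eq {b t : Bool} : bA b t = true ↔ b = true ∧ t = true := by cases b <;> cases t <;> simp [bA]
lemma bO_eq {b t : Bool} : bO b t = true ↔ b = true ∨ t = true := by cases b <;> cases t <;> simp [bO]
lemma nadd (a b : ℕ) : Nat.add a b = a + b := rfl
lemma nsub (a b : ℕ) : Nat.sub a b = a - b := rfl
lemma nmul (a b : ℕ) : Nat.mul a b = a * b := rfl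
lemma ndiv (a b : ℕ) : Nat.div a b = a / b := rfl
lemma nmod (a b : ℕ) : Nat.mod a b = a % b := rfl
lemma nble {a b : ℕ} : Nat.ble a b = true ↔ a ≤ b := by rw [Nat.ble_eq]

/-- `X` is a fixed point approximation of `x`. -/
def Ap (P : ℕ) (x : ℝ) (X E : ℕ) : Prop := |x * 2^P - X| ≤ E

namespace Ap
variable {P : ℕ} {x y : ℝ} {X Y E F : ℕ}

lemma mono (h : Ap P x X E) (hE : E ≤ F) : Ap P x X F := le_trans h (by exact_mod_cast hE)

lemma add (h : Ap P x X E) (h' : Ap P y Y F) : Ap P (x+y) (X+Y) (E+F) := by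
  unfold Ap at *
  rw [abs_le] at *
  push_cast
  constructor <;> linarith [h.1, h.2, h'.1, h'.2]

lemma sub (h : Ap P x X E) (h' : Ap P y Y F) (hl : Y ≤ X) : Ap P (x-y) (X-Y) (E+F) := by
  unfold Ap at *
  rw [abs_le] at *
  push_cast [Nat.cast_sub hl]
  constructor <;> linarith [h.1, h.2, h'.1, h'.2]

lemma nmul (c : ℕ) (h : Ap P x X E) : Ap P (c*x) (c*X) (c*E) := by
  unfold Ap at *
  push_cast
  rw [show (c:ℝ)*x*2^P - c*X = c*(x*2^P-X) by ring, abs_mul, abs_of_nonneg (Nat.cast_nonneg c)]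
  gcongr

lemma div (c : ℕ) (hc : 1 ≤ c) (h : Ap P x X E) : Ap P (x/c) (X/c) (E+1) := by
  unfold Ap at *
  have hc' : (1:ℝ) ≤ c := by exact_mod_cast hc
  have h1 : ((X/c : ℕ):ℝ) ≤ (X:ℝ)/c := Nat.cast_div_le
  have h2 : (X:ℝ)/c < (X/c : ℕ) + 1 := by
    rw [div_lt_iff₀ (by linarith)]
    have := Nat.lt_succ_iff.mp (Nat.lt_succ_self X)
    have h3 := Nat.div_add_mod X c
    have h4 := Nat.mod_lt X (show 0 < c by omega)
    have : X < (X/c+1)*c := by rw [add_mul, mul_comm (X/c)]; omega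
    exact_mod_cast this
  have h5 : |x/c*2^P - (X:ℝ)/c| ≤ E := by
    rw [show x/c*2^P - (X:ℝ)/c = (x*2^P-X)/c by ring, abs_div, abs_of_nonneg (by linarith : (0:ℝ) ≤ c)]
    exact (div_le_self (abs_nonneg _) hc').trans h
  rw [abs_le] at *
  push_cast
  constructor <;> linarith [h5.1, h5.2]

lemma shift {s : ℕ} (h : Ap (P+s) x X E) : Ap P x (X/2^s) (E+1) := by
  have := (h.nmul 1).div (2^s) Nat.one_le_two_pow
  unfold Ap at *
  rw [pow_add] at this
  have h2 : (2:ℝ)^s ≠ 0 := by positivity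
  convert this using 3
  · push_cast; field_simp
  · simp
  · simp

lemma up {s : ℕ} (h : Ap P x X E) : Ap (P+s) x (X*2^s) (E*2^s) := by
  unfold Ap at *
  push_cast
  rw [pow_add, show x*(2^P*2^s)-(X:ℝ)*2^s = (x*2^P-X)*2^s by ring, abs_mul, abs_of_pos (by positivity : (0:ℝ) < 2^s)]
  gcongr

end Ap

/-- Taylor series of `-log(1-x)` in fixed point arithmetic. -/
noncomputable def ser (Q X : ℕ) (cont : ℕ → Bool) (fuel : ℕ) : ℕ → ℕ → ℕ → Bool :=
  Nat.rec (fun _ _ _ => false) (fun _ ih i t acc =>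
    Nat.rec (cont acc) (fun _ _ => fz (Nat.add acc (Nat.div t i)) fun acc' =>
      fz (Nat.div (Nat.mul t X) Q) fun t' => fz (Nat.succ i) fun i' => ih i' t' acc') t) fuel

lemma ser_succ (Q X : ℕ) (cont : ℕ → Bool) (fuel i t acc : ℕ) :
    ser Q X cont (fuel+1) i t acc = if t = 0 then cont acc else ser Q X cont fuel (i+1) (t*X/Q) (acc + t/i) := by
  cases t with
  | zero => rfl
  | succ t =>
    rw [if_neg (by omega)]
    change fz (Nat.add acc (Nat.div (t+1) i)) (fun acc' => fz (Nat.div (Nat.mul (t+1) X) Q) fun t' => fz (Nat.succ i) fun i' => ser Q X cont fuel i' t' acc') = _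
    simp only [fz_eq]
    rfl

lemma fdiv (a b : ℕ) (hb : 0 < b) : ((a/b : ℕ):ℝ) ≤ (a:ℝ)/b ∧ (a:ℝ)/b ≤ (a/b : ℕ) + 1 := by
  refine ⟨Nat.cast_div_le, ?_⟩
  have hb' : (0:ℝ) < b := by exact_mod_cast hb
  rw [div_le_iff₀ hb']
  have h3 := Nat.div_add_mod a b
  have h4 := Nat.mod_lt a hb
  have : a ≤ (a/b+1)*b := by rw [add_mul, mul_comm (a/b)]; omega
  exact_mod_cast this

lemma ser_spec (Q X : ℕ) (hQ : 0 < Q) (hX : 4*X ≤ 3*Q) (cont : ℕ → Bool) : ∀ fuel j t acc : ℕ,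
    (t:ℝ) ≤ Q*((X:ℝ)/Q)^(j+1) → Q*((X:ℝ)/Q)^(j+1) ≤ t + (j+1) →
    (acc:ℝ) ≤ Q*∑ l ∈ Finset.range j, ((X:ℝ)/Q)^(l+1)/(l+1) → 
    Q*∑ l ∈ Finset.range j, ((X:ℝ)/Q)^(l+1)/(l+1) ≤ acc + 2*j →
    ser Q X cont fuel (j+1) t acc = true →
    ∃ acc' : ℕ, cont acc' = true ∧ |(-Real.log (1-(X:ℝ)/Q))*Q - acc'| ≤ 6*(j+fuel) := by
  intro fuel
  have hQ' : (0:ℝ) < Q := by exact_mod_cast hQ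
  set x : ℝ := (X:ℝ)/Q with hx
  have hx0 : 0 ≤ x := by positivity
  have hx1 : x ≤ 3/4 := by
    rw [hx, div_le_iff₀ hQ']
    have : (4:ℝ)*X ≤ 3*Q := by exact_mod_cast hX
    linarith
  induction fuel with
  | zero => intro j t acc _ _ _ _ h; exact absurd h (by simp [ser])
  | succ fuel ih =>
    intro j t acc h1 h2 h3 h4 h
    rw [ser_succ] at h
    by_cases ht : t = 0
    · rw [if_pos ht] at h
      refine ⟨acc, h, ?_⟩
      subst ht
      have h5 := Real.abs_log_sub_add_sum_range_le (x := x) (by rw [abs_of_nonneg hx0]; linarith) j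
      rw [abs_of_nonneg hx0] at h5
      have h6 : x^(j+1)/(1-x) ≤ 4*x^(j+1) := by
        rw [div_le_iff₀ (by linarith)]
        nlinarith [pow_nonneg hx0 (j+1)]
      have h7 : Q*x^(j+1) ≤ j+1 := by simpa using h2
      have h8 := h5.trans h6
      set S := ∑ l ∈ Finset.range j, x^(l+1)/(l+1) with hS
      have h9 : |(-Real.log (1-x))*Q - Q*S| ≤ 4*(j+1) := by
        rw [show (-Real.log (1-x))*Q - Q*S = -(Q*(S+Real.log (1-x))) by ring, abs_neg, abs_mul, abs_of_pos hQ']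
        nlinarith
      rw [abs_le] at *
      push_cast
      have : (0:ℝ) ≤ fuel := Nat.cast_nonneg _
      constructor <;> linarith [h9.1, h9.2]
    · rw [if_neg ht] at h
      obtain ⟨d1, d2⟩ := fdiv (t*X) Q hQ
      obtain ⟨d3, d4⟩ := fdiv t (j+1) (by omega)
      push_cast at d1 d2 d3 d4
      have e1 : (t:ℝ)*X/Q = t*x := by rw [hx]; ring
      rw [e1] at d1 d2
      have hj : (0:ℝ) < j+1 := by positivity
      have e2 : Q*(x^(j+1)/(j+1)) ≤ (t:ℝ)/(j+1) + 1 := by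
        rw [← mul_div_assoc, div_add_one hj.ne']
        gcongr
      have e3 : (t:ℝ)/(j+1) ≤ Q*(x^(j+1)/(j+1)) := by
        rw [← mul_div_assoc]; gcongr
      obtain ⟨acc', g1, g2⟩ := ih (j+1) (t*X/Q) (acc + t/(j+1)) (by
          rw [pow_succ, ← mul_assoc]
          exact d1.trans (mul_le_mul_of_nonneg_right h1 hx0)) (by
          rw [pow_succ, ← mul_assoc]
          have : Q*x^(j+1)*x ≤ (t+(j+1))*x := mul_le_mul_of_nonneg_right h2 hx0
          push_cast
          nlinarith) (by
          rw [Finset.sum_range_succ, mul_add]; push_cast; linarith) (by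
          rw [Finset.sum_range_succ, mul_add]; push_cast; linarith) h
      refine ⟨acc', g1, g2.trans (by push_cast; linarith)⟩

lemma log_lip {x y : ℝ} (hx : x ≤ 3/4) (hy : y ≤ 3/4) : |Real.log (1-x) - Real.log (1-y)| ≤ 4*|x-y| := by
  have key : ∀ x y : ℝ, x ≤ 3/4 → y ≤ 3/4 → Real.log (1-x) - Real.log (1-y) ≤ 4*|x-y| := by
    intro x y hx hy
    rw [← Real.log_div (by linarith) (by linarith)]
    have h1 := Real.log_le_sub_one_of_pos (show 0 < (1-x)/(1-y) from div_pos (by linarith) (by linarith))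
    refine h1.trans ?_
    rw [div_sub_one (by linarith), div_le_iff₀ (by linarith)]
    have := le_abs_self (y-x)
    rw [abs_sub_comm] at this
    nlinarith [abs_nonneg (x-y)]
  rw [abs_le]
  have h1 := key x y hx hy
  have h2 := key y x hy hx
  rw [abs_sub_comm y x] at h2
  constructor <;> linarith

/-- Series evaluation, packaged. -/
noncomputable def lg (Q fuel X : ℕ) (cont : ℕ → Bool) : Bool :=
  bA (Nat.ble (Nat.mul 4 X) (Nat.mul 3 Q)) (ser Q X cont fuel 1 X 0)

lemma lg_spec {P fuel X E : ℕ} {x : ℝ} {cont : ℕ → Bool} (h : lg (2^P) fuel X cont = true) (hA : Ap P x X E) (hx : x ≤ 3/4) :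
    ∃ Y, cont Y = true ∧ Ap P (-Real.log (1-x)) Y (4*E+6*fuel) := by
  unfold lg at h
  rw [bA_eq, nble, nmul, nmul] at h
  obtain ⟨h1, h2⟩ := h
  have hQ : (0:ℝ) < 2^P := by positivity
  obtain ⟨Y, g1, g2⟩ := ser_spec (2^P) X (by positivity) h1 cont fuel 0 X 0 (by push_cast; rw [pow_one, mul_div_cancel₀ _ hQ.ne'])
    (by push_cast; rw [pow_one, mul_div_cancel₀ _ hQ.ne']; simp) (by simp) (by simp) h2
  refine ⟨Y, g1, ?_⟩
  unfold Ap at *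
  push_cast at *
  set x0 : ℝ := (X:ℝ)/2^P with hx0
  have hx1 : x0 ≤ 3/4 := by
    rw [hx0, div_le_iff₀ hQ]
    have : (4:ℝ)*X ≤ 3*2^P := by exact_mod_cast h1
    linarith
  have h3 := log_lip hx hx1
  have h4 : |x-x0| * 2^P ≤ E := by
    rw [← abs_of_pos hQ, ← abs_mul, sub_mul, hx0, div_mul_cancel₀ _ hQ.ne']
    exact hA
  have h5 : |(-Real.log (1-x))*2^P - (-Real.log (1-x0))*2^P| ≤ 4*E := by
    rw [show (-Real.log (1-x))*2^P - (-Real.log (1-x0))*2^P = -((Real.log (1-x) - Real.log (1-x0))*2^P) by ring, abs_neg, abs_mul, abs_of_pos hQ]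
    calc _ ≤ (4*|x-x0|)*2^P := by gcongr
      _ ≤ _ := by linarith
  rw [abs_le] at *
  constructor <;> linarith [h5.1, h5.2, g2.1, g2.2]

end

section

/-- Rounded powers in fixed point arithmetic (rounded down for `c = 0`, up for `c = 1`). -/
noncomputable def pw (Q x c : ℕ) (fuel : ℕ) : ℕ → (ℕ → Bool) → Bool :=
  Nat.rec (fun _ _ => false) (fun _ ih n cont =>
    Nat.rec (cont Q) (fun _ _ => fz (Nat.div n 2) fun n2 => ih n2 fun h =>
      fz (Nat.add (Nat.div (Nat.mul h h) Q) c) fun h2 =>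
        Bool.rec (cont h2) (fz (Nat.add (Nat.div (Nat.mul h2 x) Q) c) cont) (Nat.beq (Nat.mod n 2) 1)) n) fuel

lemma pw_succ (Q x c fuel n : ℕ) (cont : ℕ → Bool) :
    pw Q x c (fuel+1) n cont = if n = 0 then cont Q else
      pw Q x c fuel (n/2) fun h => if n % 2 = 1 then cont ((h*h/Q+c)*x/Q+c) else cont (h*h/Q+c) := by
  cases n with
  | zero => rfl
  | succ n =>
    rw [if_neg (by omega)]
    change fz (Nat.div (n+1) 2) (fun n2 => pw Q x c fuel n2 fun h =>
      fz (Nat.add (Nat.div (Nat.mul h h) Q) c) fun h2 =>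
        Bool.rec (cont h2) (fz (Nat.add (Nat.div (Nat.mul h2 x) Q) c) cont) (Nat.beq (Nat.mod (n+1) 2) 1)) = _
    simp only [fz_eq, nadd, nmul, ndiv, nmod]
    congr 1
    funext h
    by_cases hn : (n+1) % 2 = 1
    · rw [if_pos hn, hn]; rfl
    · rw [if_neg hn, show (n+1) % 2 = 0 by omega]; rfl

lemma pw_lower (Q x : ℕ) (hQ : 0 < Q) : ∀ fuel n cont, pw Q x 0 fuel n cont = true →
    ∃ h : ℕ, cont h = true ∧ (h:ℝ) ≤ Q*((x:ℝ)/Q)^n := by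
  intro fuel
  have hQ' : (0:ℝ) < Q := by exact_mod_cast hQ
  induction fuel with
  | zero => intro n cont h; exact absurd h (by simp [pw])
  | succ fuel ih =>
    intro n cont h
    rw [pw_succ] at h
    by_cases hn : n = 0
    · rw [if_pos hn] at h
      exact ⟨Q, h, by simp [hn]⟩
    rw [if_neg hn] at h
    obtain ⟨y, hy, hy2⟩ := ih _ _ h
    have h2 : ((y*y/Q+0 : ℕ):ℝ) ≤ Q*((x:ℝ)/Q)^(2*(n/2)) := by
      refine (fdiv (y*y) Q hQ).1.trans ?_
      rw [div_le_iff₀ hQ', mul_comm 2, pow_mul]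
      push_cast
      have : (0:ℝ) ≤ y := Nat.cast_nonneg _
      nlinarith [mul_le_mul hy2 hy2 this (this.trans hy2)]
    by_cases h1 : n % 2 = 1
    · rw [if_pos h1] at hy
      refine ⟨_, hy, ?_⟩
      refine (fdiv _ Q hQ).1.trans ?_
      rw [show n = 2*(n/2)+1 by omega, pow_succ, ← mul_assoc]
      rw [div_le_iff₀ hQ', mul_assoc, div_mul_cancel₀ _ hQ'.ne']
      push_cast at h2 ⊢
      gcongr
    · rw [if_neg h1] at hy
      refine ⟨_, hy, ?_⟩
      rwa [show 2*(n/2) = n by omega] at h2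

lemma pw_upper (Q x : ℕ) (hQ : 0 < Q) : ∀ fuel n cont, pw Q x 1 fuel n cont = true →
    ∃ h : ℕ, cont h = true ∧ Q*((x:ℝ)/Q)^n ≤ (h:ℝ) := by
  intro fuel
  have hQ' : (0:ℝ) < Q := by exact_mod_cast hQ
  induction fuel with
  | zero => intro n cont h; exact absurd h (by simp [pw])
  | succ fuel ih =>
    intro n cont h
    rw [pw_succ] at h
    by_cases hn : n = 0
    · rw [if_pos hn] at h
      exact ⟨Q, h, by simp [hn]⟩
    rw [if_neg hn] at h
    obtain ⟨y, hy, hy2⟩ := ih _ _ h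
    have h2 : Q*((x:ℝ)/Q)^(2*(n/2)) ≤ ((y*y/Q+1 : ℕ):ℝ) := by
      have := (fdiv (y*y) Q hQ).2
      push_cast at this ⊢
      refine le_trans ?_ this
      rw [le_div_iff₀ hQ', mul_comm 2, pow_mul]
      have : (0:ℝ) ≤ Q*((x:ℝ)/Q)^(n/2) := by positivity
      nlinarith [mul_le_mul hy2 hy2 this (this.trans hy2)]
    by_cases h1 : n % 2 = 1
    · rw [if_pos h1] at hy
      refine ⟨_, hy, ?_⟩
      have h3 := (fdiv ((y*y/Q+1)*x) Q hQ).2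
      push_cast at h3 h2 ⊢
      refine le_trans ?_ h3
      rw [show n = 2*(n/2)+1 by omega, pow_succ, ← mul_assoc]
      rw [le_div_iff₀ hQ', mul_assoc, div_mul_cancel₀ _ hQ'.ne']
      gcongr
    · rw [if_neg h1] at hy
      refine ⟨_, hy, ?_⟩
      rwa [show 2*(n/2) = n by omega] at h2

/-- Fixed point iteration for `e`. -/
noncomputable def itE (Q k : ℕ) (cont : ℕ → Bool) (fuel : ℕ) : ℕ → Bool :=
  Nat.rec (fun _ => false) (fun _ ih E => pw Q (Nat.sub (Nat.mul 2 Q) E) 0 16 k fun h =>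
    fz (Nat.div (Nat.mul Q Q) h) fun E' => Bool.rec (ih E') (cont E') (Nat.beq E' E)) fuel

lemma itE_spec (Q k : ℕ) (hQ : 0 < Q) (cont : ℕ → Bool) : ∀ fuel E, itE Q k cont fuel E = true → ∃ E', cont E' = true := by
  intro fuel
  induction fuel with
  | zero => intro E h; exact absurd h (by simp [itE])
  | succ fuel ih =>
    intro E h
    change pw Q (Nat.sub (Nat.mul 2 Q) E) 0 16 k (fun h =>
      fz (Nat.div (Nat.mul Q Q) h) fun E' => Bool.rec (itE Q k cont fuel E') (cont E') (Nat.beq E' E)) = true at h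
    obtain ⟨h, hh, _⟩ := pw_lower _ _ hQ _ _ _ h
    rw [fz_eq] at hh
    generalize Nat.beq _ E = b at hh
    cases b with
    | false => exact ih _ hh
    | true => exact ⟨_, hh⟩

/-- Verified computation of `e`. -/
noncomputable def chkE (Q k fuel : ℕ) (cont : ℕ → Bool) : Bool :=
  itE Q k (fun E => bA (Nat.ble (Nat.mul (Nat.add k 1) (Nat.add E 4)) (Nat.mul 2 Q))
    (pw Q (Nat.sub (Nat.mul 2 Q) (Nat.sub E 4)) 1 16 k fun h => bA (Nat.ble (Nat.mul (Nat.sub E 4) h) (Nat.mul Q Q))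
      (pw Q (Nat.sub (Nat.mul 2 Q) (Nat.add E 4)) 0 16 k fun h => bA (Nat.ble (Nat.mul Q Q) (Nat.mul (Nat.add E 4) h)) (cont E)))) fuel 0

lemma f_mono {k : ℕ} {x y : ℝ} (hx : 0 ≤ x) (hxy : x < y) (hy : (k+1)*y ≤ 2) : x*(2-x)^k < y*(2-y)^k := by
  have hk : (0:ℝ) ≤ k := Nat.cast_nonneg _
  have h2 : y ≤ 2 := by nlinarith
  have hx2 : 0 < 2 - x := by linarith
  have h1 := one_add_mul_le_pow (a := -((y-x)/(2-x))) (by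
    have : (y-x)/(2-x) ≤ 1 := by rw [div_le_one hx2]; linarith
    linarith) k
  have h3 : 1 + -((y-x)/(2-x)) = (2-y)/(2-x) := by field_simp; ring
  rw [h3, div_pow, le_div_iff₀ (by positivity)] at h1
  have h4 : x < y*(1 + k * -((y-x)/(2-x))) := by
    have h5 : (y-x)/(2-x)*(k*y) < y - x := by
      rw [div_mul_eq_mul_div, div_lt_iff₀ hx2]
      exact mul_lt_mul_of_pos_left (by linarith) (by linarith)
    nlinarith
  have hp : 0 < (2-x)^k := by positivity
  calc x*(2-x)^k < (y*(1 + k * -((y-x)/(2-x))))*(2-x)^k := by gcongr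
    _ = y*((1 + k * -((y-x)/(2-x)))*(2-x)^k) := by ring
    _ ≤ _ := by gcongr; linarith

lemma chkE_spec {P k fuel : ℕ} {cont : ℕ → Bool} {e : ℝ} (he : IsE k e) (h : chkE (2^P) k fuel cont = true) :
    ∃ E, cont E = true ∧ Ap P e E 4 := by
  have hQ : 0 < 2^P := by positivity
  obtain ⟨E, h⟩ := itE_spec _ _ hQ _ _ _ h
  rw [bA_eq] at h
  obtain ⟨h1, h⟩ := h
  obtain ⟨u, h, hu⟩ := pw_upper _ _ hQ _ _ _ h
  rw [bA_eq] at h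
  obtain ⟨h2, h⟩ := h
  obtain ⟨v, h, hv⟩ := pw_lower _ _ hQ _ _ _ h
  rw [bA_eq] at h
  obtain ⟨h3, h⟩ := h
  refine ⟨E, h, ?_⟩
  rw [nble] at h1 h2 h3
  simp only [nsub, nmul, nadd] at h1 h2 h3 hu hv
  have hQ' : (0:ℝ) < 2^P := by positivity
  have hk2 := he.1
  have h4 : E + 4 ≤ 2*2^P := le_trans (Nat.le_mul_of_pos_left _ (by omega)) h1
  rw [Nat.cast_sub (by omega)] at hu hv
  have he0 := he.2.1
  have hke := he.2.2.1
  have hf := he.2.2.2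
  have hkr : (2:ℝ) ≤ k := by exact_mod_cast hk2
  have h1' : ((k:ℝ)+1)*(E+4) ≤ 2*2^P := by exact_mod_cast h1
  have h2' : ((E-4:ℕ):ℝ)*u ≤ 2^P*2^P := by exact_mod_cast h2
  have h3' : (2^P*2^P:ℝ) ≤ (E+4)*v := by exact_mod_cast h3
  push_cast at hu hv
  have low : ((E-4:ℕ):ℝ)/2^P ≤ e := by
    by_contra hc
    push Not at hc
    have h5 := f_mono (k := k) he0.le hc (by
      rw [mul_div_assoc', div_le_iff₀ hQ']
      refine le_trans ?_ h1'
      have : ((E-4:ℕ):ℝ) ≤ E+4 := by exact_mod_cast (by omega : E-4 ≤ E+4)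
      gcongr)
    rw [hf] at h5
    have h6 : 2 - ((E-4:ℕ):ℝ)/2^P = (2*2^P - ((E-4:ℕ):ℝ))/2^P := by field_simp
    rw [h6] at h5
    have h7 : ((E-4:ℕ):ℝ)/2^P * ((2*2^P - ((E-4:ℕ):ℝ))/2^P)^k ≤ 1 := by
      have : ((E-4:ℕ):ℝ)/2^P * ((2*2^P - ((E-4:ℕ):ℝ))/2^P)^k = ((E-4:ℕ):ℝ) * (2^P * ((2*2^P - ((E-4:ℕ):ℝ))/2^P)^k)/(2^P*2^P) := by
        field_simp
      rw [this, div_le_one (by positivity)]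
      exact le_trans (mul_le_mul_of_nonneg_left hu (Nat.cast_nonneg _)) h2'
    linarith
  have upp : e ≤ ((E:ℝ)+4)/2^P := by
    by_contra hc
    push Not at hc
    have h5 := f_mono (k := k) (x := ((E:ℝ)+4)/2^P) (by positivity) hc (by nlinarith)
    rw [hf] at h5
    have h6 : 2 - ((E:ℝ)+4)/2^P = (2*2^P - ((E:ℝ)+4))/2^P := by field_simp
    rw [h6] at h5
    have h7 : 1 ≤ ((E:ℝ)+4)/2^P * ((2*2^P - ((E:ℝ)+4))/2^P)^k := by
      have : ((E:ℝ)+4)/2^P * ((2*2^P - ((E:ℝ)+4))/2^P)^k = ((E:ℝ)+4) * (2^P * ((2*2^P - ((E:ℝ)+4))/2^P)^k)/(2^P*2^P) := by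
        field_simp
      rw [this, one_le_div (by positivity)]
      exact le_trans h3' (mul_le_mul_of_nonneg_left hv (by positivity))
    linarith
  rw [div_le_iff₀ hQ'] at low
  rw [le_div_iff₀ hQ'] at upp
  unfold Ap
  rw [abs_le]
  have : (E:ℝ) ≤ ((E-4:ℕ):ℝ)+4 := by exact_mod_cast (by omega : E ≤ E-4+4)
  push_cast
  constructor <;> linarith

/-- Dujella-Petho reduction, core inequality. -/
lemma dp_core {P q p A T G W Wg w N' s R : ℕ} {la t0 g ρ N d : ℝ} {z : ℤ} (hq : 0 < q) (hA : Ap P la A W) (hT : Ap P t0 T W) (hG : Ap P g G Wg)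
    (hw : |(q:ℝ)*A - p*T| ≤ w) (hR : q*G = T*s + R) (hz : (p:ℝ)*N - q*d = z) (hN : |N| ≤ N')
    (h : |N*la - d*t0 + g| ≤ ρ) (lo : ℕ)
    (h1 : lo ≤ R) (h2 : R + lo ≤ T) : 
    (lo:ℝ) - (q*Wg + (s+1)*W + N'*(w + (q+p)*W)) ≤ q*ρ*2^P := by
  unfold Ap at *
  have hq' : (0:ℝ) < q := by exact_mod_cast hq
  have hR' : (q:ℝ)*G = T*s + R := by exact_mod_cast hR
  have h1' : (lo:ℝ) ≤ R := by exact_mod_cast h1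
  have h2' : (R:ℝ) + lo ≤ T := by exact_mod_cast h2
  have hQ : (0:ℝ) < 2^P := by positivity
  obtain ⟨la', hla⟩ : ∃ y, y = la*2^P := ⟨_, rfl⟩
  obtain ⟨t', ht'⟩ : ∃ y, y = t0*2^P := ⟨_, rfl⟩
  obtain ⟨g', hg'⟩ : ∃ y, y = g*2^P := ⟨_, rfl⟩
  rw [← hla] at hA
  rw [← ht'] at hT
  rw [← hg'] at hG
  -- ε
  have e1 : |q*la' - p*t'| ≤ w + (q+p)*W := by
    have : q*la' - p*t' = (q*A - p*T) + q*(la'-A) - p*(t'-T) := by ring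
    rw [this]
    refine (abs_sub _ _).trans ?_
    refine (add_le_add_left (abs_add_le _ _) _).trans ?_
    rw [abs_mul, abs_mul, abs_of_pos hq', abs_of_nonneg (Nat.cast_nonneg p : (0:ℝ) ≤ p)]
    have := mul_le_mul_of_nonneg_left hA hq'.le
    have := mul_le_mul_of_nonneg_left hT (Nat.cast_nonneg p : (0:ℝ) ≤ p)
    linarith
  have e2 : |N*(q*la' - p*t')| ≤ N'*(w + (q+p)*W) := by
    rw [abs_mul]
    exact mul_le_mul hN e1 (abs_nonneg _) (Nat.cast_nonneg _)
  have e3 : |q*g' - s*t' - R| ≤ q*Wg + s*W := by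
    have : q*g' - s*t' - R = q*(g'-G) - s*(t'-T) := by linear_combination hR'
    rw [this]
    refine (abs_sub _ _).trans ?_
    rw [abs_mul, abs_mul, abs_of_pos hq', abs_of_nonneg (Nat.cast_nonneg s : (0:ℝ) ≤ s)]
    have := mul_le_mul_of_nonneg_left hG hq'.le
    have := mul_le_mul_of_nonneg_left hT (Nat.cast_nonneg s : (0:ℝ) ≤ s)
    linarith
  have e4 : |q*((N*la - d*t0 + g)*2^P)| ≤ q*ρ*2^P := by
    rw [abs_mul, abs_mul, abs_of_pos hq', abs_of_pos hQ, mul_assoc]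
    gcongr
  have e5 : q*((N*la - d*t0 + g)*2^P) = N*(q*la' - p*t') + (q*g' - s*t') + (z+s)*t' := by
    rw [← hz, hla, ht', hg']; ring
  rw [e5] at e4
  have hsW : (0:ℝ) ≤ s*W := by positivity
  have hW : (0:ℝ) ≤ W := by positivity
  have hWg : (0:ℝ) ≤ q*Wg := by positivity
  rw [abs_le] at *
  have hT0 : 0 ≤ t' ∨ (lo:ℝ) ≤ 0 + W := by
    rcases le_or_gt 0 t' with h | h
    · exact Or.inl h
    · right; linarith [hT.1, (Nat.cast_nonneg R : (0:ℝ) ≤ R)]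
  rcases hT0 with hT0 | hlo
  · rcases le_or_gt 0 (z+s) with hc | hc
    · have : (0:ℝ) ≤ (z+s) := by exact_mod_cast hc
      have h5 := mul_nonneg this hT0
      linarith only [h5, e4.2, e2.1, e3.1, h1', hW]
    · have : ((z+s:ℤ):ℝ) ≤ -1 := by exact_mod_cast (by omega : z+s ≤ -1)
      push_cast at this
      have h5 := mul_le_mul_of_nonneg_right this hT0
      linarith only [h5, e4.1, e2.2, e3.2, h2', hT.1, hW, hT.2]
  · have hρ : 0 ≤ ρ := by linarith
    have : 0 ≤ q*ρ*2^P := by positivity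
    have : (0:ℝ) ≤ N'*(w + (q+p)*W) := by positivity
    linarith

end

section

/-- Approximations of the logarithms of small primes. -/
structure CK (P l2 l3 l5 l7 W0 : ℕ) : Prop where
  h2 : Ap P (Real.log 2) l2 W0
  h3 : Ap P (Real.log 3) l3 W0
  h5 : Ap P (Real.log 5) l5 W0
  h7 : Ap P (Real.log 7) l7 W0

lemma log_ten : Real.log 10 = Real.log 2 + Real.log 5 := by
  rw [← Real.log_mul (by norm_num) (by norm_num)]; norm_num

lemma Ap.congr {P : ℕ} {x y : ℝ} {X E F : ℕ} (h : Ap P x X E) (hxy : y = x) (hE : E ≤ F) : Ap P y X F := by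
  rw [hxy]; exact h.mono hE

lemma IsE.k1e {k : ℕ} {e : ℝ} (he : IsE k e) : ((k:ℝ)+1)*e/2 ≤ 3/4 := by linarith [he.den_pos]

lemma logs_core {P l2 l3 l5 l7 W0 k s1 s2 s3 s4 F : ℕ} {e : ℝ} (he : IsE k e) (hc : CK P l2 l3 l5 l7 W0)
    (h1 : Ap P (-Real.log (1-e/2)) s1 F) (h2 : Ap P (-Real.log (1-e)) s2 F) (h3 : Ap P (-Real.log (1-2*e/3)) s3 F)
    (h4 : Ap P (-Real.log (1-((k:ℝ)+1)*e/2)) s4 F) (b1 : s1 ≤ l2) (b2 : 2*l2+s2+s3 ≤ 2*l3+s1+s4) :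
    Ap P (Real.log (2-e)) (l2-s1) (W0+F) ∧ Ap P (Real.log (3*IsE.Cst k e)) (2*l3+s1+s4-(2*l2+s2+s3)) (4*W0+4*F) := by
  have hh := he.half
  have h0 := he.2.1
  have hd := he.den_pos
  have hk := he.k1e
  constructor
  · refine (hc.h2.sub h1 b1).congr ?_ le_rfl
    rw [sub_neg_eq_add, ← Real.log_mul (by norm_num) (by linarith)]
    congr 1; ring
  · refine (((hc.h3.nmul 2).add h1).add h4 |>.sub (((hc.h2.nmul 2).add h2).add h3) b2).congr ?_ (by omega)
    have e1 : 3*IsE.Cst k e = (3^2*((1-e)*(1-2*e/3)))/(2^2*((1-e/2)*(1-((k:ℝ)+1)*e/2))) := by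
      unfold IsE.Cst
      have : (2-e) ≠ 0 := by linarith
      have : (2-((k:ℝ)+1)*e) ≠ 0 := by linarith
      have : (1-e/2) ≠ 0 := by linarith
      have : (1-((k:ℝ)+1)*e/2) ≠ 0 := by linarith
      rw [mul_div_assoc', div_eq_div_iff (by positivity) (by positivity)]
      ring
    have p1 : (1-e) ≠ 0 := by linarith
    have p2 : (1-2*e/3) ≠ 0 := by linarith
    have p3 : (1-e/2) ≠ 0 := by linarith
    have p4 : (1-((k:ℝ)+1)*e/2) ≠ 0 := by linarith
    rw [e1, Real.log_div (by positivity) (by positivity), Real.log_mul (by norm_num : (3:ℝ)^2 ≠ 0) (by positivity),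
      Real.log_mul (by norm_num : (2:ℝ)^2 ≠ 0) (by positivity), Real.log_mul p1 p2, Real.log_mul p3 p4, Real.log_pow, Real.log_pow]
    push_cast
    ring

/-- The logarithms of `α` and of `3 C`. -/
noncomputable def logs (Q k fuel l2 l3 : ℕ) (cont : ℕ → ℕ → Bool) : Bool :=
  chkE Q k fuel fun E => fz (Nat.div E 2) fun x1 => fz (Nat.div (Nat.mul 2 E) 3) fun x3 => fz (Nat.div (Nat.mul (Nat.add k 1) E) 2) fun x4 =>
    lg Q fuel x1 fun s1 => lg Q fuel E fun s2 => lg Q fuel x3 fun s3 => lg Q fuel x4 fun s4 =>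
    bA (Nat.ble s1 l2) (fz (Nat.add (Nat.mul 2 l2) (Nat.add s2 s3)) fun u => fz (Nat.add (Nat.mul 2 l3) (Nat.add s1 s4)) fun v =>
      bA (Nat.ble u v) (fz (Nat.sub l2 s1) fun A => fz (Nat.sub v u) fun H => cont A H))

lemma logs_spec {P l2 l3 l5 l7 W0 k fuel W : ℕ} {e : ℝ} {cont : ℕ → ℕ → Bool} (he : IsE k e) (hc : CK P l2 l3 l5 l7 W0)
    (hW : 4*W0 + 24*fuel + 64*k + 400 ≤ W)
    (h : logs (2^P) k fuel l2 l3 cont = true) :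
    ∃ A H, cont A H = true ∧ Ap P (Real.log (2-e)) A W ∧ Ap P (Real.log (3*IsE.Cst k e)) H W := by
  have hh := he.half
  have h0 := he.2.1
  have hk := he.k1e
  obtain ⟨E, h, hE⟩ := chkE_spec he h
  simp only [fz_eq] at h
  have a1 : Ap P (e/2) (E/2) 5 := by simpa using hE.div 2 (by norm_num)
  have a3 : Ap P (2*e/3) (2*E/3) 9 := by simpa using (hE.nmul 2).div 3 (by norm_num)
  have a4 : Ap P (((k:ℝ)+1)*e/2) ((k+1)*E/2) ((k+1)*4+1) := by simpa using (hE.nmul (k+1)).div 2 (by norm_num)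
  obtain ⟨s1, h, r1⟩ := lg_spec h a1 (by linarith)
  obtain ⟨s2, h, r2⟩ := lg_spec h hE (by linarith)
  obtain ⟨s3, h, r3⟩ := lg_spec h a3 (by linarith)
  obtain ⟨s4, h, r4⟩ := lg_spec h a4 (by linarith)
  rw [bA_eq, nble, bA_eq, nble] at h
  simp only [nadd, nmul, nsub] at h
  obtain ⟨b1, b2, h⟩ := h
  have := logs_core (F := 6*fuel+16*k+40) he hc (r1.mono (by omega)) (r2.mono (by omega)) (r3.mono (by omega)) (r4.mono (by omega)) b1 (by omega)
  refine ⟨_, _, h, this.1.mono (by omega), ?_⟩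
  have e1 : 2*l3+(s1+s4)-(2*l2+(s2+s3)) = 2*l3+s1+s4-(2*l2+s2+s3) := by omega
  rw [e1]
  exact this.2.mono (by omega)

lemma Ap_log0 {P : ℕ} {x : ℝ} (h : Ap P x 0 1) (hx : x ≤ 3/4) : Ap P (-Real.log (1-x)) 0 4 := by
  unfold Ap at *
  have hQ : (0:ℝ) < 2^P := by positivity
  have h1 := log_lip hx (show (0:ℝ) ≤ 3/4 by norm_num)
  simp only [sub_zero, Real.log_one, Nat.cast_zero] at h1 h ⊢
  rw [abs_mul, abs_of_pos hQ] at h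
  rw [abs_mul, abs_neg, abs_of_pos hQ]
  push_cast at *
  nlinarith

lemma logs_large {P l2 l3 l5 l7 W0 k W : ℕ} {e : ℝ} (he : IsE k e) (hc : CK P l2 l3 l5 l7 W0)
    (hW : 4*W0 + 400 ≤ W) (hP : P + 17 ≤ 2^16) (hk : P + 16 ≤ k) (hl : 2*l2 ≤ 2*l3) :
    Ap P (Real.log (2-e)) l2 W ∧ Ap P (Real.log (3*IsE.Cst k e)) (2*l3-2*l2) W := by
  have hh := he.half
  have h0 := he.2.1
  have hk1 := he.k1e
  have hQ : (0:ℝ) < 2^P := by positivity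
  have key : ((k:ℝ)+1)*e*2^P ≤ 2 := by
    obtain ⟨j, rfl⟩ : ∃ j, k = P + 16 + j := ⟨k-(P+16), by omega⟩
    have h1 : P + 16 + j + 1 ≤ 2^(16+j) := by
      have : j + 1 ≤ 2^j := Nat.lt_two_pow_self
      rw [pow_add]
      nlinarith
    have h2 : e ≤ 2*(1/2)^(P+16+j) := he.upper
    have h3 : ((P+16+j:ℕ):ℝ)+1 ≤ 2^(16+j) := by exact_mod_cast h1
    calc (((P+16+j:ℕ):ℝ)+1)*e*2^P ≤ 2^(16+j)*(2*(1/2)^(P+16+j))*2^P := by gcongr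
      _ = 2*(2^(P+16+j)*(1/2)^(P+16+j)) := by ring
      _ = 2 := by rw [← mul_pow]; norm_num
  have hk0 : (2:ℝ) ≤ k := by exact_mod_cast he.1
  have small : ∀ x : ℝ, 0 ≤ x → x ≤ ((k:ℝ)+1)*e/2 → Ap P x 0 1 := by
    intro x h0 h1
    unfold Ap
    rw [Nat.cast_zero, sub_zero, abs_of_nonneg (by positivity)]
    push_cast
    nlinarith
  have b : (3:ℝ)*e ≤ (k+1)*e := by gcongr; linarith
  have := logs_core (F := 4) he hc (Ap_log0 (small (e/2) (by linarith) (by linarith)) (by linarith))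
    (Ap_log0 (small e (by linarith) (by linarith)) (by linarith)) (Ap_log0 (small (2*e/3) (by linarith) (by linarith)) (by linarith))
    (Ap_log0 (small _ (by positivity) le_rfl) hk1) (by omega) (by omega)
  exact ⟨this.1.mono (by omega), this.2.mono (by omega)⟩

end

section

/-- A tester: a positive answer on `G ≈ g` bounds small values of the linear form. -/
def TG (P T Wg N' M' : ℕ) (la : ℝ) (t : ℕ → Bool) : Prop :=
  ∀ (G : ℕ) (g : ℝ), t G = true → Ap P g G Wg → G ≤ 1000*T → ∀ (N d : ℕ) (y : ℝ), 0 < y → N ≤ N' →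
    |N*la - (d+1)*Real.log 10 + g| ≤ 120/y → y < 2^M'

/-- Test with the denominator `q`. -/
noncomputable def tq (T q lo G : ℕ) : Bool :=
  bA (Nat.ble 1 q) (fz (Nat.mod (Nat.mul q G) T) fun R => bA (Nat.ble lo R) (Nat.ble (Nat.add R lo) T))

noncomputable def mkT (A T N W K q : ℕ) (t : ℕ → Bool) (cont : (ℕ → Bool) → Bool) : Bool :=
  fz (Nat.mul q A) fun u => fz (Nat.div (Nat.add u (Nat.div T 2)) T) fun p => fz (Nat.mul p T) fun v =>
  fz (Nat.add (Nat.sub u v) (Nat.sub v u)) fun w =>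
  fz (Nat.add (Nat.add (Nat.mul q K) (Nat.mul N (Nat.add w (Nat.mul (Nat.add q p) W)))) 1) fun lo =>
  cont fun G => bO (tq T q lo G) (t G)

lemma mkT_spec {P A T N' W Wg K M' q : ℕ} {la : ℝ} {t : ℕ → Bool} {cont : (ℕ → Bool) → Bool} (hA : Ap P la A W)
    (hT : Ap P (Real.log 10) T W) (hK : Wg + 1001*W + 120*2^(P-M') ≤ K) (hM : M' ≤ P) (ht : TG P T Wg N' M' la t)
    (h : mkT A T N' W K q t cont = true) : ∃ t', cont t' = true ∧ TG P T Wg N' M' la t' := by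
  unfold mkT at h
  simp only [fz_eq, nadd, nmul, nsub, ndiv] at h
  refine ⟨_, h, ?_⟩
  clear h
  generalize (q*A+T/2)/T = p
  intro G g hG hg hGT N d y hy hN hf
  rw [bO_eq] at hG
  rcases hG with hG | hG
  swap
  · exact ht G g hG hg hGT N d y hy hN hf
  unfold tq at hG
  simp only [fz_eq, bA_eq, nble, nmul, nmod, nadd] at hG
  obtain ⟨hq, h1, h2⟩ := hG
  have hw : |(q:ℝ)*A - p*T| ≤ ((q*A - p*T + (p*T - q*A) : ℕ):ℝ) := by
    rcases le_total (q*A) (p*T) with hc | hc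
    · rw [Nat.sub_eq_zero_of_le hc, zero_add, Nat.cast_sub hc, abs_sub_comm]
      push_cast
      rw [abs_of_nonneg]
      have : ((q*A:ℕ):ℝ) ≤ (p*T:ℕ) := by exact_mod_cast hc
      push_cast at this; linarith
    · rw [Nat.sub_eq_zero_of_le hc, add_zero, Nat.cast_sub hc]
      push_cast
      rw [abs_of_nonneg]
      have : ((p*T:ℕ):ℝ) ≤ (q*A:ℕ) := by exact_mod_cast hc
      push_cast at this; linarith
  generalize q*A - p*T + (p*T - q*A) = w at *
  have hT0 : 0 < T := by omega
  have key := dp_core (z := (p:ℤ)*N - q*(d+1)) (N' := N') (N := (N:ℝ)) (s := q*G/T) (d := (d:ℝ)+1) hq hA hT hg hw (Nat.div_add_mod (q*G) T).symm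
    (by push_cast; ring) (by rw [abs_of_nonneg (Nat.cast_nonneg _)]; exact_mod_cast hN) hf _ h1 h2
  have hs : q*G/T + 1 ≤ 1001*q := by
    have : q*G/T ≤ 1000*q := by
      rw [Nat.div_le_iff_le_mul_add_pred hT0]
      nlinarith
    omega
  have hs' : ((q*G/T:ℕ):ℝ) + 1 ≤ 1001*q := by exact_mod_cast hs
  have hK' : (Wg:ℝ) + 1001*W + 120*2^(P-M') ≤ K := by exact_mod_cast hK
  have hq' : (0:ℝ) < q := by exact_mod_cast hq
  have e1 := mul_le_mul_of_nonneg_left hK' hq'.le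
  have e2 := mul_le_mul_of_nonneg_right hs' (Nat.cast_nonneg W : (0:ℝ) ≤ W)
  push_cast at key
  have e3 : q*(120*(2:ℝ)^(P-M')) < q*(120/y)*2^P := by linarith only [key, e1, e2]
  rw [mul_assoc] at e3
  have e4 := lt_of_mul_lt_mul_left e3 hq'.le
  rw [div_mul_eq_mul_div, lt_div_iff₀ hy] at e4
  have e5 : (2:ℝ)^P = 2^(P-M')*2^M' := by rw [← pow_add]; congr 1; omega
  rw [e5] at e4
  have e6 : (0:ℝ) < 2^(P-M') := by positivity
  have : 2^(P-M')*y < (2:ℝ)^(P-M')*2^M' := by linarith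
  exact lt_of_mul_lt_mul_left this e6.le

/-- Euclid's algorithm (four steps per round); the answers need no justification. -/
noncomputable def euc (b : ℕ) (cont : ℕ → ℕ → Bool) (fuel : ℕ) : ℕ → ℕ → Bool :=
  Nat.rec (fun _ _ => false) (fun _ ih z0 z1 => fz (Nat.mod z0 z1) fun z2 => fz (Nat.mod z1 z2) fun z3 =>
    fz (Nat.mod z2 z3) fun z4 => fz (Nat.mod z3 z4) fun z5 => Bool.rec (ih z4 z5) (cont z4 z5) (Nat.ble z5 b)) fuel

lemma euc_spec (b : ℕ) (cont : ℕ → ℕ → Bool) : ∀ fuel z0 z1, euc b cont fuel z0 z1 = true → ∃ u v, cont u v = true := by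
  intro fuel
  induction fuel with
  | zero => intro z0 z1 h; exact absurd h (by simp [euc])
  | succ fuel ih =>
    intro z0 z1 h
    change fz (Nat.mod z0 z1) (fun z2 => fz (Nat.mod z1 z2) fun z3 =>
      fz (Nat.mod z2 z3) fun z4 => fz (Nat.mod z3 z4) fun z5 => Bool.rec (euc b cont fuel z4 z5) (cont z4 z5) (Nat.ble z5 b)) = true at h
    simp only [fz_eq] at h
    generalize Nat.ble _ b = c at h
    cases c with
    | false => exact ih _ _ h
    | true => exact ⟨_, _, h⟩

/-- Decoding the denominator. -/
noncomputable def dec (S v z : ℕ) (cont : ℕ → Bool) : Bool :=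
  fz (Nat.mod z S) fun low => Bool.rec (fz (Nat.div (Nat.sub S low) v) cont) (fz (Nat.div low v) cont) (Nat.ble (Nat.mul 2 low) S)

lemma dec_spec {S v z : ℕ} {cont : ℕ → Bool} (h : dec S v z cont = true) : ∃ q, cont q = true := by
  unfold dec at h
  simp only [fz_eq] at h
  generalize Nat.ble _ S = c at h
  cases c <;> exact ⟨_, h⟩

/-- Absolute difference. -/
noncomputable def dst (a b : ℕ) : ℕ := Nat.add (Nat.sub a b) (Nat.sub b a)

noncomputable def prep (q0 p0 q1 p1 N W K S b1 b2 fuel A T : ℕ) (cont : (ℕ → Bool) → Bool) : Bool :=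
  fz (Nat.add (Nat.pow 2 64) (Nat.mod A (Nat.pow 2 64))) fun v =>
  fz (Nat.mul T S) fun y0 => fz (Nat.add (Nat.mul A S) v) fun y1 =>
  fz (dst (Nat.mul q0 y1) (Nat.mul p0 y0)) fun z0 => fz (dst (Nat.mul q1 y1) (Nat.mul p1 y0)) fun z1 =>
  euc b1 (fun z2 z3 => dec S v z3 fun q => mkT A T N W K q (fun _ => false) fun t =>
    euc b2 (fun _ z5 => dec S v z5 fun q => mkT A T N W K q t cont) fuel z2 z3) fuel z0 z1

lemma prep_spec {q0 p0 q1 p1 P A T N' W Wg K M' S b1 b2 fuel : ℕ} {la : ℝ} {cont : (ℕ → Bool) → Bool} (hA : Ap P la A W)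
    (hT : Ap P (Real.log 10) T W) (hK : Wg + 1001*W + 120*2^(P-M') ≤ K) (hM : M' ≤ P)
    (h : prep q0 p0 q1 p1 N' W K S b1 b2 fuel A T cont = true) : ∃ t', cont t' = true ∧ TG P T Wg N' M' la t' := by
  unfold prep at h
  simp only [fz_eq] at h
  obtain ⟨_, _, h⟩ := euc_spec _ _ _ _ _ h
  obtain ⟨_, h⟩ := dec_spec h
  obtain ⟨t, h, ht⟩ := mkT_spec (Wg := Wg) hA hT hK hM (by intro G g h; exact absurd h (by simp)) h
  obtain ⟨_, _, h⟩ := euc_spec _ _ _ _ _ h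
  obtain ⟨_, h⟩ := dec_spec h
  exact mkT_spec hA hT hK hM ht h

/-- Two consecutive convergents of `A / T`, used as a common starting point. -/
noncomputable def warm (S b fuel A T : ℕ) (cont : ℕ → ℕ → ℕ → ℕ → Bool) : Bool :=
  fz (Nat.add (Nat.pow 2 64) (Nat.mod A (Nat.pow 2 64))) fun v =>
  fz (Nat.mul T S) fun y0 => fz (Nat.add (Nat.mul A S) v) fun y1 =>
  euc b (fun z0 z1 => dec S v z0 fun q0 => dec S v z1 fun q1 =>
    fz (Nat.div (Nat.add (Nat.mul q0 A) (Nat.div T 2)) T) fun p0 =>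
    fz (Nat.div (Nat.add (Nat.mul q1 A) (Nat.div T 2)) T) fun p1 => cont q0 p0 q1 p1) fuel y0 y1

lemma warm_spec {S b fuel A T : ℕ} {cont : ℕ → ℕ → ℕ → ℕ → Bool} (h : warm S b fuel A T cont = true) :
    ∃ q0 p0 q1 p1, cont q0 p0 q1 p1 = true := by
  unfold warm at h
  simp only [fz_eq] at h
  obtain ⟨_, _, h⟩ := euc_spec _ _ _ _ _ h
  obtain ⟨_, h⟩ := dec_spec h
  obtain ⟨_, h⟩ := dec_spec h
  exact ⟨_, _, _, _, h⟩

lemma lucasK_two_rec (n : ℕ) : lucasK 2 (n+2) = lucasK 2 (n+1) + lucasK 2 n := by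
  rw [lucasK_rec]
  simp [Finset.sum_range_succ]

lemma lucas2_period (n : ℕ) : lucasK 2 (n+24) % 60 = lucasK 2 n % 60 ∧ lucasK 2 (n+25) % 60 = lucasK 2 (n+1) % 60 := by
  have hs : ∀ n, lucasK 2 (n+2) = lucasK 2 (n+1) + lucasK 2 n := fun n => lucasK_two_rec n
  induction n with
  | zero => simp [hs, lucasK_zero, lucasK_one]
  | succ n ih =>
    refine ⟨ih.2, ?_⟩
    have h1 := hs (n+24)
    have h2 := hs n
    rw [show n+1+25 = n+24+2 by ring, show n+1+1 = n+2 by ring, h1, h2, show n+24+1 = n+25 by ring]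
    omega

lemma lucas2_mod (n : ℕ) : (lucasK 2 n % 3 = 0 → lucasK 2 n % 5 = 3) ∧ (lucasK 2 n % 5 = 3 → lucasK 2 n % 4 = 2 ∨ lucasK 2 n % 4 = 3) ∧
    lucasK 2 n % 5 ≠ 0 := by
  have hs : ∀ n, lucasK 2 (n+2) = lucasK 2 (n+1) + lucasK 2 n := fun n => lucasK_two_rec n
  induction n using Nat.strong_induction_on with
  | _ n ih =>
    rcases Nat.lt_or_ge n 24 with h | h
    · interval_cases n <;> simp [hs, lucasK_zero, lucasK_one]
    · obtain ⟨j, rfl⟩ : ∃ j, n = j + 24 := ⟨n-24, by omega⟩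
      have h1 := ih j (by omega)
      have h2 := (lucas2_period j).1
      omega

lemma RepD.k2 {k n m d a : ℕ} (hr : RepD k n m d a) (hk : k = 2) : a ≤ 8 := by
  subst hk
  obtain ⟨_, _, hd, h1, h9, h⟩ := hr
  by_contra hc
  have ha : a = 9 := by omega
  subst ha
  have h2 : lucasK 2 n * lucasK 2 m + 1 = 10^d := by omega
  obtain ⟨j, rfl⟩ : ∃ j, d = j + 2 := ⟨d-2, by omega⟩
  have h3 : (lucasK 2 n * lucasK 2 m) % 4 = 3 := by rw [pow_add] at h2; omega
  have h5 : (lucasK 2 n * lucasK 2 m) % 5 = 4 := by rw [pow_add] at h2; omega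
  have h6 : (lucasK 2 n * lucasK 2 m) % 3 = 0 := by
    have : 10^(j+2) % 3 = 1 := by rw [Nat.pow_mod]; simp
    omega
  obtain ⟨a1, a2, a3⟩ := lucas2_mod n
  obtain ⟨b1, b2, b3⟩ := lucas2_mod m
  generalize lucasK 2 n = x at *
  generalize lucasK 2 m = y at *
  have key : x % 5 = 3 ∧ y % 5 = 3 := by
    rcases (Nat.Prime.dvd_mul Nat.prime_three).1 (Nat.dvd_of_mod_eq_zero h6) with h | h
    · have hx := a1 (Nat.mod_eq_zero_of_dvd h)
      refine ⟨hx, ?_⟩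
      rw [Nat.mul_mod, hx] at h5
      omega
    · have hx := b1 (Nat.mod_eq_zero_of_dvd h)
      refine ⟨?_, hx⟩
      rw [Nat.mul_mod, hx] at h5
      omega
  have hx := a2 key.1
  have hy := b2 key.2
  rw [Nat.mul_mod] at h3
  rcases hx with hx | hx <;> rcases hy with hy | hy <;> rw [hx, hy] at h3 <;> omega

noncomputable def sb (G la : ℕ) (t : ℕ → Bool) : Bool := fz la fun la => bA (Nat.ble la G) (fz (Nat.sub G la) t)

/-- Testing all nine digits. -/
noncomputable def all9 (sk : Bool) (l2 l3 l5 l7 T G : ℕ) (t : ℕ → Bool) : Bool :=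
  bA (Nat.ble G (Nat.mul 1000 T)) (bA (t G) (bA (sb G l2 t) (bA (sb G l3 t) (bA (sb G (Nat.mul 2 l2) t) (bA (sb G l5 t)
    (bA (sb G (Nat.add l2 l3) t) (bA (sb G l7 t) (bA (sb G (Nat.mul 3 l2) t) (bO sk (sb G (Nat.mul 2 l3) t))))))))))

lemma all9_spec {sk : Bool} {P l2 l3 l5 l7 W0 T G Wg : ℕ} {g : ℝ} {t : ℕ → Bool} (hc : CK P l2 l3 l5 l7 W0) (hG : Ap P g G Wg)
    (h : all9 sk l2 l3 l5 l7 T G t = true) (a : ℕ) (h1 : 1 ≤ a) (h9 : a ≤ 9)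
    (hsk : sk = true → a ≤ 8) :
    ∃ G', t G' = true ∧ G' ≤ 1000*T ∧ Ap P (g - Real.log a) G' (Wg + 3*W0) := by
  unfold all9 at h
  simp only [bA_eq, bO_eq, nble, nmul, nadd] at h
  obtain ⟨h0, q1, q2, q3, q4, q5, q6, q7, q8, q9⟩ := h
  have key : ∀ la (x : ℝ), sb G la t = true → Ap P x la (3*W0) → Real.log a = x →
      ∃ G', t G' = true ∧ G' ≤ 1000*T ∧ Ap P (g - Real.log a) G' (Wg + 3*W0) := by
    intro la x h h2 h3
    unfold sb at h
    simp only [fz_eq, bA_eq, nble, nsub] at h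
    exact ⟨_, h.2, by omega, h3 ▸ hG.sub h2 h.1⟩
  interval_cases a
  · exact ⟨G, q1, h0, by simpa using hG.mono (by omega)⟩
  · exact key _ _ q2 (hc.h2.mono (by omega)) rfl
  · exact key _ _ q3 (hc.h3.mono (by omega)) rfl
  · exact key _ _ q4 ((hc.h2.nmul 2).mono (by omega)) (by rw [show ((4:ℕ):ℝ) = 2^2 by norm_num, Real.log_pow])
  · exact key _ _ q5 (hc.h5.mono (by omega)) rfl
  · exact key _ _ q6 ((hc.h2.add hc.h3).mono (by omega)) (by rw [← Real.log_mul (by norm_num) (by norm_num)]; norm_num)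
  · exact key _ _ q7 (hc.h7.mono (by omega)) rfl
  · exact key _ _ q8 ((hc.h2.nmul 3).mono (by omega)) (by rw [show ((8:ℕ):ℝ) = 2^3 by norm_num, Real.log_pow])
  · have q9 : sb G (2*l3) t = true := q9.resolve_left (fun h => by have := hsk h; omega)
    exact key _ _ q9 ((hc.h3.nmul 2).mono (by omega)) (by rw [show ((9:ℕ):ℝ) = 3^2 by norm_num, Real.log_pow])

/-- The reduction step for the form in `n + m` followed by further tests. -/
noncomputable def tail (sk : Bool) (q0 p0 q1 p1 N W K S b1 b2 fuel l2 l3 l5 l7 T A H : ℕ) (X : ℕ → (ℕ → Bool) → Bool) : Bool :=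
  prep q0 p0 q1 p1 N W K S b1 b2 fuel A T fun t => bA (fz (Nat.add (Nat.mul 2 H) T) fun G => all9 sk l2 l3 l5 l7 T G t) (X H t)

lemma tail_spec {sk : Bool} {q0 p0 q1 p1 P A H T N' W W0 Wg K M' S b1 b2 fuel l2 l3 l5 l7 k : ℕ} {e : ℝ} {X : ℕ → (ℕ → Bool) → Bool}
    (he : IsE k e) (hc : CK P l2 l3 l5 l7 W0) (hA : Ap P (Real.log (2-e)) A W) (hH : Ap P (Real.log (3*IsE.Cst k e)) H W)
    (hT : T = l2 + l5) (hW : 2*W0 ≤ W) (hWg : 5*W ≤ Wg) (hK : Wg + 1001*W + 120*2^(P-M') ≤ K) (hM : M' ≤ P)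
    (hsk : sk = true → k = 2)
    (h : tail sk q0 p0 q1 p1 N' W K S b1 b2 fuel l2 l3 l5 l7 T A H X = true) :
    (∃ t, X H t = true ∧ TG P T Wg N' M' (Real.log (2-e)) t) ∧
    ∀ n m d a, RepD k n m d a → n + m ≤ N' → 12 ≤ m → (2-e)^m < 2^M' := by
  unfold tail at h
  have hT' : Ap P (Real.log 10) T W := by
    rw [hT]
    exact (hc.h2.add hc.h5).congr log_ten (by omega)
  obtain ⟨t, h, ht⟩ := prep_spec (Wg := Wg) hA hT' hK hM h
  simp only [bA_eq, fz_eq, nadd, nmul] at h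
  refine ⟨⟨t, h.2, ht⟩, ?_⟩
  intro n m d a hr hN hm
  have hf := he.formY hr hm
  obtain ⟨G, g1, g2, g3⟩ := all9_spec hc ((hH.nmul 2).add hT') h.1 a hr.2.2.2.1 hr.2.2.2.2.1 (fun h => hr.k2 (hsk h))
  have hC := he.Cst_lower
  have ha : (0:ℝ) < a := by exact_mod_cast hr.2.2.2.1
  refine ht G _ g1 (g3.mono (by omega)) g2 (n+m) d _ (pow_pos (by linarith [he.half]) _) hN ?_
  convert hf using 2
  rw [show 9*(IsE.Cst k e)^2/a = (3*IsE.Cst k e)^2/a by ring, Real.log_div (by positivity) (by positivity), Real.log_pow]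
  push_cast
  ring

end

section

/-- Approximations of `-log (1 - x)` for `x = 1/2, 1/4, 1/5, 1/8`, to 3600 binary digits. -/
def cA2 : ℕ := 3538423831550995201821522720349744606649855790423254819329374423438712198832513154669560393816957699764997204702896588138759290555370719904835689199750538535910162009950156273540838807909260031642432952699164440603435868345819828933158203653761265292012358279560528515591352158303243935083696943680875916953954460379591911616176448826945928651049830249199078863436733795551154552884403479187752313384341511170731409560162389541559194617797513990354982234575156988578621923551557318927846456596243602532814675507671662875353100049023164965481222044284835176849727428999756664470413782377219973763204262916973237327054302453565058294135600001104886356828318914932579501123778906905151332557689275164300712599625873078637992861885080764480972705817913072309550340449219875054464100686609270638444065233072681980704605576408704735126784588764872969031277948111023830878643424159079070785074920153033878720313795104372853952005947488884748057719884755945157775434286736967152480883776076786111190144982898645434004868792025493769355736670931721480435371765594212503702946362373568584025095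
def cA4 : ℕ := 1468578578435589952349776536984488422564527420128747007123026347822050936458119860654351249793203813437537136652518869619682668401090336115179160807438524892188550918524359174194055686918948452281940494516584744488979017578855055731881039686203017183731347201826394375815848590891242761059095798671410844075205616441701500636903116405035993339638479162131424376967181699967024008520772750717097727511863615003406575510593238635368994575270823767886887431233413087326717616871359354626484516804849993026273308931383783887902487880141720816767597828327734007363809807131721869352834211436036596401910516447525794748320541454550975183509270151556679568069335904507991624918741958174593002733101595077845748385982841703800385998014197941818522234688173811550759933151451380281762619742382701644025047795709614608280586228736964693043198998909341730239675554136506942848233503988405928124861010605526076939956566501193909362609901565130091615793354818740244912656233744695469457340229011493472766699875968337831543116137021720708716986646966288482442282371054803324597280529735307934387144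
def cA5 : ℕ := 1139118042995253028050930900381097560487041323473762602314592393692336523147861175117107762243067597141394190677982844010681178666850407566365099652824894748505764660900019435915691093542477274840644499347297901152010413722071411942226609855838813649615224157728805887054827408742904529492370529183483697745622885358234655893575552981947817589372060567115124956592142481613996501092813111967020585365029529305482742609597567122127402842584897695653153385455844501863354014060115295680070870380381387215582225796286539646276186284130286371566491996467740695781797887198030786263820300392732516565313149954239583464407240386254115715196363428781388397758767143583495365898580768074744381314397723853776004159823091304642777938328543754544897863477633557063673236919588700903871418886908258654978278242482449640911362296839648138232217309204144047174163029552366282808770592567960108610871732250642696675762716179756017379781864465912412147311428592177569127628542279688046440833848415883652492642288585541459604619317049222467470609070763783193785877589937343512869000357674398133836192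
def cA8 : ℕ := 681659934822372585064644718070903089139700468258024521011034393132112779109541967036619993770200848424929181809373675130027867500935727695757360935824029023054128886815749136958893561625181329993972078868568969974794516881492409944158774150149718508130699820451595701126788297842005138234816077682103506186572687458329656445573401291791225830227466530866328088695129662268019790206218828288508315278717762550379966276757924449942041774854642444447403480990839070718527031683834233629140500983434572131162888440958083193113119001250160881574636013045435532949578597155808406685232262611842882671305271182315546025039173438930924827245928956570778426138369824367657673952167239845245261335966540436239313353304573522211429887518688415925361685488539445657951232474741580947735437106753424269966788921526843959566300876262922591176684414136278051621876814118626654215511195523830015398451582387520527531910297629549184376466901590709614321406767216163385487562409484126281992884252278725649117561220698871004261153197426635707384777807479804745068362759987245970421907174306732122556898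

lemma cA2_ok : lg (2^3600) 4000 (2^3599) (fun y => Nat.beq y cA2) = true := by decide +kernel
lemma cA4_ok : lg (2^3600) 4000 (2^3598) (fun y => Nat.beq y cA4) = true := by decide +kernel
lemma cA5_ok : lg (2^3600) 4000 (2^3600/5) (fun y => Nat.beq y cA5) = true := by decide +kernel
lemma cA8_ok : lg (2^3600) 4000 (2^3597) (fun y => Nat.beq y cA8) = true := by decide +kernel

lemma lg_lit {X c E : ℕ} {x : ℝ} (h : lg (2^3600) 4000 X (fun y => Nat.beq y c) = true) (hA : Ap 3600 x X E) (hx : x ≤ 3/4) :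
    Ap 3600 (-Real.log (1-x)) c (4*E+24000) := by
  obtain ⟨Y, h1, h2⟩ := lg_spec h hA hx
  rw [Nat.beq_eq] at h1
  rw [← h1]
  exact h2

lemma Ap_inv2 (j : ℕ) (hj : j ≤ 3600) : Ap 3600 ((1/2)^j) (2^(3600-j)) 0 := by
  unfold Ap
  have : (2:ℝ)^3600 = 2^j*2^(3600-j) := by rw [← pow_add]; congr 1; omega
  rw [this, ← mul_assoc, ← mul_pow]
  simp

lemma ck3600 : CK 3600 cA2 (2*cA2-cA4) (2*cA2+cA5) (3*cA2-cA8) 131000 := by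
  have h2 := lg_lit cA2_ok (Ap_inv2 1 (by norm_num)) (by norm_num)
  have h4 := lg_lit cA4_ok (Ap_inv2 2 (by norm_num)) (by norm_num)
  have h8 := lg_lit cA8_ok (Ap_inv2 3 (by norm_num)) (by norm_num)
  have a5 : Ap 3600 (1/5) (2^3600/5) 1 := by
    have := (Ap_inv2 0 (by norm_num)).div 5 (by norm_num)
    simpa using this
  have h5 := lg_lit cA5_ok a5 (by norm_num)
  have e2 : -Real.log (1-(1/2)^1) = Real.log 2 := by rw [← Real.log_inv]; norm_num
  have e4 : -Real.log (1-(1/2)^2) = 2*Real.log 2 - Real.log 3 := by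
    rw [← Real.log_inv, show (1-(1/2:ℝ)^2)⁻¹ = 2^2/3 by norm_num, Real.log_div (by norm_num) (by norm_num), Real.log_pow]; norm_num
  have e8 : -Real.log (1-(1/2)^3) = 3*Real.log 2 - Real.log 7 := by
    rw [← Real.log_inv, show (1-(1/2:ℝ)^3)⁻¹ = 2^3/7 by norm_num, Real.log_div (by norm_num) (by norm_num), Real.log_pow]; norm_num
  have e5 : -Real.log (1-1/5) = Real.log 5 - 2*Real.log 2 := by
    rw [← Real.log_inv, show (1-(1/5:ℝ))⁻¹ = 5/2^2 by norm_num, Real.log_div (by norm_num) (by norm_num), Real.log_pow]; norm_num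
  rw [e2] at h2
  rw [e4] at h4
  rw [e8] at h8
  rw [e5] at h5
  refine ⟨h2.mono (by norm_num), ?_, ?_, ?_⟩
  · exact ((h2.nmul 2).sub h4 (by unfold cA2 cA4; norm_num)).congr (by push_cast; ring) (by norm_num)
  · exact ((h2.nmul 2).add h5).congr (by push_cast; ring) (by norm_num)
  · exact ((h2.nmul 3).sub h8 (by unfold cA2 cA8; norm_num)).congr (by push_cast; ring) (by norm_num)

lemma CK.shift {P s l2 l3 l5 l7 W0 : ℕ} (h : CK (P+s) l2 l3 l5 l7 W0) : CK P (l2/2^s) (l3/2^s) (l5/2^s) (l7/2^s) (W0+1) :=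
  ⟨h.h2.shift, h.h3.shift, h.h5.shift, h.h7.shift⟩

noncomputable def allk (f : ℕ → Bool) (cnt : ℕ) : ℕ → Bool :=
  Nat.rec (fun _ => true) (fun _ ih k => bA (f k) (fz (Nat.succ k) ih)) cnt

lemma allk_spec (f : ℕ → Bool) : ∀ cnt k0, allk f cnt k0 = true → ∀ k, k0 ≤ k → k < k0 + cnt → f k = true := by
  intro cnt
  induction cnt with
  | zero => intro k0 _ k _ _; omega
  | succ cnt ih =>
    intro k0 h k h1 h2
    change bA (f k0) (fz (Nat.succ k0) (allk f cnt)) = true at h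
    rw [bA_eq, fz_eq] at h
    by_cases hk : k = k0
    · rw [hk]; exact h.1
    · exact ih _ h.2 k (by omega) (by omega)

end

section

/-- The constants of the first reduction. -/
noncomputable def rA0 (f : ℕ → ℕ → ℕ → ℕ → ℕ → ℕ → ℕ → ℕ → ℕ → ℕ → ℕ → ℕ → Bool) : Bool :=
  fz cA2 fun l2 => fz (Nat.sub (Nat.mul 2 l2) cA4) fun l3 => fz (Nat.add (Nat.mul 2 l2) cA5) fun l5 => fz (Nat.sub (Nat.mul 3 l2) cA8) fun l7 =>
  fz (Nat.add l2 l5) fun T => fz (Nat.pow 2 3600) fun Q => fz (Nat.pow 2 1745) fun N => fz (Nat.pow 2 20) fun W =>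
  fz (Nat.add (Nat.mul 1010 W) (Nat.mul 120 (Nat.pow 2 1785))) fun K => fz (Nat.pow 2 1870) fun S =>
  fz (Nat.pow 2 3700) fun b1 => fz (Nat.pow 2 3692) fun b2 => f Q l2 l3 l5 l7 T N W K S b1 b2

/-- The first reduction for `cnt` values of `k`. -/
noncomputable def rW (k0 cnt : ℕ) : Bool :=
  rA0 fun Q l2 l3 l5 l7 T N W K S b1 b2 =>
  warm S (Nat.mul (Nat.pow 2 (Nat.sub 3620 (Nat.div k0 2))) S) 4600 l2 T fun q0 p0 q1 p1 =>
  allk (fun k => logs Q k 4600 l2 l3 fun A H =>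
    tail (Nat.beq k 2) q0 p0 q1 p1 N W K S b1 b2 4600 l2 l3 l5 l7 T A H fun _ _ => true) cnt k0

/-- The first reduction for all large `k`. -/
noncomputable def rU : Bool :=
  rA0 fun Q l2 l3 l5 l7 T N W K S b1 b2 =>
  bA (Nat.ble (Nat.mul 2 l2) (Nat.mul 2 l3))
  (tail false 0 1 1 0 N W K S b1 b2 4600 l2 l3 l5 l7 T l2 (Nat.sub (Nat.mul 2 l3) (Nat.mul 2 l2)) fun _ _ => true)

def DoneA (k : ℕ) : Prop := ∀ e, IsE k e → ∀ n m d a, RepD k n m d a → n + m ≤ 2^1745 → 12 ≤ m → (2-e)^m < 2^1815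

lemma rW_spec {k0 cnt : ℕ} (h : rW k0 cnt = true) (hb : k0 + cnt ≤ 3700) : ∀ k, k0 ≤ k → k < k0 + cnt → DoneA k := by
  intro k h1 h2 e he
  unfold rW rA0 at h
  simp only [fz_eq, nadd, nmul, nsub] at h
  obtain ⟨q0, p0, q1, p1, h⟩ := warm_spec h
  have h := allk_spec _ _ _ h k h1 h2
  obtain ⟨A, H, h, hA, hH⟩ := logs_spec (W := 2^20) he ck3600 (by omega) h
  refine (tail_spec (Wg := 5*2^20) (M' := 1815) he ck3600 hA hH rfl (by norm_num) (by norm_num) ?_ (by norm_num) ?_ h).2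
  · decide +kernel
  · intro h; exact Nat.eq_of_beq_eq_true h

lemma rU_spec (h : rU = true) : ∀ k, 3616 ≤ k → DoneA k := by
  intro k h1 e he
  unfold rU rA0 at h
  simp only [fz_eq, nadd, nmul, nsub, bA_eq, nble] at h
  obtain ⟨hA, hH⟩ := logs_large (W := 2^20) he ck3600 (by norm_num) (by norm_num) h1 h.1
  refine (tail_spec (Wg := 5*2^20) (M' := 1815) he ck3600 hA hH rfl (by norm_num) (by norm_num) ?_ (by norm_num) ?_ h.2).2
  · decide +kernel
  · intro h; exact absurd h (by simp)

def UpA (b : ℕ) : Prop := ∀ k, 2 ≤ k → k < b → DoneA k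

lemma UpA.step {b : ℕ} (h : UpA b) (c : ℕ) (hr : rW b c = true) (hb : b + c ≤ 3700) : UpA (b+c) := by
  intro k h1 h2
  by_cases hk : k < b
  · exact h k h1 hk
  · exact rW_spec hr hb k (by omega) h2

lemma upA_2 : UpA 2 := fun k h1 h2 => by omega

set_option maxRecDepth 10000

lemma rU_ok : rU = true := by decide +kernel

end

section

set_option maxRecDepth 10000
set_option maxHeartbeats 4000000

lemma upA_220 : UpA 220 := by
  have h := upA_2
  have h : UpA 3 := h.step 1 (by decide +kernel) (by norm_num)
  have h : UpA 10 := h.step 7 (by decide +kernel) (by norm_num)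
  have h : UpA 20 := h.step 10 (by decide +kernel) (by norm_num)
  have h : UpA 30 := h.step 10 (by decide +kernel) (by norm_num)
  have h : UpA 40 := h.step 10 (by decide +kernel) (by norm_num)
  have h : UpA 52 := h.step 12 (by decide +kernel) (by norm_num)
  have h : UpA 64 := h.step 12 (by decide +kernel) (by norm_num)
  have h : UpA 76 := h.step 12 (by decide +kernel) (by norm_num)
  have h : UpA 88 := h.step 12 (by decide +kernel) (by norm_num)
  have h : UpA 100 := h.step 12 (by decide +kernel) (by norm_num)
  have h : UpA 112 := h.step 12 (by decide +kernel) (by norm_num)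
  have h : UpA 124 := h.step 12 (by decide +kernel) (by norm_num)
  have h : UpA 136 := h.step 12 (by decide +kernel) (by norm_num)
  have h : UpA 148 := h.step 12 (by decide +kernel) (by norm_num)
  have h : UpA 160 := h.step 12 (by decide +kernel) (by norm_num)
  have h : UpA 172 := h.step 12 (by decide +kernel) (by norm_num)
  have h : UpA 184 := h.step 12 (by decide +kernel) (by norm_num)
  have h : UpA 196 := h.step 12 (by decide +kernel) (by norm_num)
  have h : UpA 208 := h.step 12 (by decide +kernel) (by norm_num)
  have h : UpA 220 := h.step 12 (by decide +kernel) (by norm_num)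
  exact h

lemma upA_460 : UpA 460 := by
  have h := upA_220
  have h : UpA 232 := h.step 12 (by decide +kernel) (by norm_num)
  have h : UpA 244 := h.step 12 (by decide +kernel) (by norm_num)
  have h : UpA 256 := h.step 12 (by decide +kernel) (by norm_num)
  have h : UpA 268 := h.step 12 (by decide +kernel) (by norm_num)
  have h : UpA 280 := h.step 12 (by decide +kernel) (by norm_num)
  have h : UpA 292 := h.step 12 (by decide +kernel) (by norm_num)
  have h : UpA 304 := h.step 12 (by decide +kernel) (by norm_num)
  have h : UpA 316 := h.step 12 (by decide +kernel) (by norm_num)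
  have h : UpA 328 := h.step 12 (by decide +kernel) (by norm_num)
  have h : UpA 340 := h.step 12 (by decide +kernel) (by norm_num)
  have h : UpA 352 := h.step 12 (by decide +kernel) (by norm_num)
  have h : UpA 364 := h.step 12 (by decide +kernel) (by norm_num)
  have h : UpA 376 := h.step 12 (by decide +kernel) (by norm_num)
  have h : UpA 388 := h.step 12 (by decide +kernel) (by norm_num)
  have h : UpA 400 := h.step 12 (by decide +kernel) (by norm_num)
  have h : UpA 412 := h.step 12 (by decide +kernel) (by norm_num)
  have h : UpA 424 := h.step 12 (by decide +kernel) (by norm_num)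
  have h : UpA 436 := h.step 12 (by decide +kernel) (by norm_num)
  have h : UpA 448 := h.step 12 (by decide +kernel) (by norm_num)
  have h : UpA 460 := h.step 12 (by decide +kernel) (by norm_num)
  exact h

lemma upA_700 : UpA 700 := by
  have h := upA_460
  have h : UpA 472 := h.step 12 (by decide +kernel) (by norm_num)
  have h : UpA 484 := h.step 12 (by decide +kernel) (by norm_num)
  have h : UpA 496 := h.step 12 (by decide +kernel) (by norm_num)
  have h : UpA 508 := h.step 12 (by decide +kernel) (by norm_num)
  have h : UpA 520 := h.step 12 (by decide +kernel) (by norm_num)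
  have h : UpA 532 := h.step 12 (by decide +kernel) (by norm_num)
  have h : UpA 544 := h.step 12 (by decide +kernel) (by norm_num)
  have h : UpA 556 := h.step 12 (by decide +kernel) (by norm_num)
  have h : UpA 568 := h.step 12 (by decide +kernel) (by norm_num)
  have h : UpA 580 := h.step 12 (by decide +kernel) (by norm_num)
  have h : UpA 592 := h.step 12 (by decide +kernel) (by norm_num)
  have h : UpA 604 := h.step 12 (by decide +kernel) (by norm_num)
  have h : UpA 616 := h.step 12 (by decide +kernel) (by norm_num)
  have h : UpA 628 := h.step 12 (by decide +kernel) (by norm_num)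
  have h : UpA 640 := h.step 12 (by decide +kernel) (by norm_num)
  have h : UpA 652 := h.step 12 (by decide +kernel) (by norm_num)
  have h : UpA 664 := h.step 12 (by decide +kernel) (by norm_num)
  have h : UpA 676 := h.step 12 (by decide +kernel) (by norm_num)
  have h : UpA 688 := h.step 12 (by decide +kernel) (by norm_num)
  have h : UpA 700 := h.step 12 (by decide +kernel) (by norm_num)
  exact h

lemma upA_940 : UpA 940 := by
  have h := upA_700
  have h : UpA 712 := h.step 12 (by decide +kernel) (by norm_num)
  have h : UpA 724 := h.step 12 (by decide +kernel) (by norm_num)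
  have h : UpA 736 := h.step 12 (by decide +kernel) (by norm_num)
  have h : UpA 748 := h.step 12 (by decide +kernel) (by norm_num)
  have h : UpA 760 := h.step 12 (by decide +kernel) (by norm_num)
  have h : UpA 772 := h.step 12 (by decide +kernel) (by norm_num)
  have h : UpA 784 := h.step 12 (by decide +kernel) (by norm_num)
  have h : UpA 796 := h.step 12 (by decide +kernel) (by norm_num)
  have h : UpA 808 := h.step 12 (by decide +kernel) (by norm_num)
  have h : UpA 820 := h.step 12 (by decide +kernel) (by norm_num)
  have h : UpA 832 := h.step 12 (by decide +kernel) (by norm_num)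
  have h : UpA 844 := h.step 12 (by decide +kernel) (by norm_num)
  have h : UpA 856 := h.step 12 (by decide +kernel) (by norm_num)
  have h : UpA 868 := h.step 12 (by decide +kernel) (by norm_num)
  have h : UpA 880 := h.step 12 (by decide +kernel) (by norm_num)
  have h : UpA 892 := h.step 12 (by decide +kernel) (by norm_num)
  have h : UpA 904 := h.step 12 (by decide +kernel) (by norm_num)
  have h : UpA 916 := h.step 12 (by decide +kernel) (by norm_num)
  have h : UpA 928 := h.step 12 (by decide +kernel) (by norm_num)
  have h : UpA 940 := h.step 12 (by decide +kernel) (by norm_num)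
  exact h

lemma upA_1180 : UpA 1180 := by
  have h := upA_940
  have h : UpA 952 := h.step 12 (by decide +kernel) (by norm_num)
  have h : UpA 964 := h.step 12 (by decide +kernel) (by norm_num)
  have h : UpA 976 := h.step 12 (by decide +kernel) (by norm_num)
  have h : UpA 988 := h.step 12 (by decide +kernel) (by norm_num)
  have h : UpA 1000 := h.step 12 (by decide +kernel) (by norm_num)
  have h : UpA 1012 := h.step 12 (by decide +kernel) (by norm_num)
  have h : UpA 1024 := h.step 12 (by decide +kernel) (by norm_num)
  have h : UpA 1036 := h.step 12 (by decide +kernel) (by norm_num)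
  have h : UpA 1048 := h.step 12 (by decide +kernel) (by norm_num)
  have h : UpA 1060 := h.step 12 (by decide +kernel) (by norm_num)
  have h : UpA 1072 := h.step 12 (by decide +kernel) (by norm_num)
  have h : UpA 1084 := h.step 12 (by decide +kernel) (by norm_num)
  have h : UpA 1096 := h.step 12 (by decide +kernel) (by norm_num)
  have h : UpA 1108 := h.step 12 (by decide +kernel) (by norm_num)
  have h : UpA 1120 := h.step 12 (by decide +kernel) (by norm_num)
  have h : UpA 1132 := h.step 12 (by decide +kernel) (by norm_num)
  have h : UpA 1144 := h.step 12 (by decide +kernel) (by norm_num)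
  have h : UpA 1156 := h.step 12 (by decide +kernel) (by norm_num)
  have h : UpA 1168 := h.step 12 (by decide +kernel) (by norm_num)
  have h : UpA 1180 := h.step 12 (by decide +kernel) (by norm_num)
  exact h

lemma upA_1420 : UpA 1420 := by
  have h := upA_1180
  have h : UpA 1192 := h.step 12 (by decide +kernel) (by norm_num)
  have h : UpA 1204 := h.step 12 (by decide +kernel) (by norm_num)
  have h : UpA 1216 := h.step 12 (by decide +kernel) (by norm_num)
  have h : UpA 1228 := h.step 12 (by decide +kernel) (by norm_num)
  have h : UpA 1240 := h.step 12 (by decide +kernel) (by norm_num)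
  have h : UpA 1252 := h.step 12 (by decide +kernel) (by norm_num)
  have h : UpA 1264 := h.step 12 (by decide +kernel) (by norm_num)
  have h : UpA 1276 := h.step 12 (by decide +kernel) (by norm_num)
  have h : UpA 1288 := h.step 12 (by decide +kernel) (by norm_num)
  have h : UpA 1300 := h.step 12 (by decide +kernel) (by norm_num)
  have h : UpA 1312 := h.step 12 (by decide +kernel) (by norm_num)
  have h : UpA 1324 := h.step 12 (by decide +kernel) (by norm_num)
  have h : UpA 1336 := h.step 12 (by decide +kernel) (by norm_num)
  have h : UpA 1348 := h.step 12 (by decide +kernel) (by norm_num)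
  have h : UpA 1360 := h.step 12 (by decide +kernel) (by norm_num)
  have h : UpA 1372 := h.step 12 (by decide +kernel) (by norm_num)
  have h : UpA 1384 := h.step 12 (by decide +kernel) (by norm_num)
  have h : UpA 1396 := h.step 12 (by decide +kernel) (by norm_num)
  have h : UpA 1408 := h.step 12 (by decide +kernel) (by norm_num)
  have h : UpA 1420 := h.step 12 (by decide +kernel) (by norm_num)
  exact h

lemma upA_1660 : UpA 1660 := by
  have h := upA_1420
  have h : UpA 1432 := h.step 12 (by decide +kernel) (by norm_num)
  have h : UpA 1444 := h.step 12 (by decide +kernel) (by norm_num)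
  have h : UpA 1456 := h.step 12 (by decide +kernel) (by norm_num)
  have h : UpA 1468 := h.step 12 (by decide +kernel) (by norm_num)
  have h : UpA 1480 := h.step 12 (by decide +kernel) (by norm_num)
  have h : UpA 1492 := h.step 12 (by decide +kernel) (by norm_num)
  have h : UpA 1504 := h.step 12 (by decide +kernel) (by norm_num)
  have h : UpA 1516 := h.step 12 (by decide +kernel) (by norm_num)
  have h : UpA 1528 := h.step 12 (by decide +kernel) (by norm_num)
  have h : UpA 1540 := h.step 12 (by decide +kernel) (by norm_num)
  have h : UpA 1552 := h.step 12 (by decide +kernel) (by norm_num)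
  have h : UpA 1564 := h.step 12 (by decide +kernel) (by norm_num)
  have h : UpA 1576 := h.step 12 (by decide +kernel) (by norm_num)
  have h : UpA 1588 := h.step 12 (by decide +kernel) (by norm_num)
  have h : UpA 1600 := h.step 12 (by decide +kernel) (by norm_num)
  have h : UpA 1612 := h.step 12 (by decide +kernel) (by norm_num)
  have h : UpA 1624 := h.step 12 (by decide +kernel) (by norm_num)
  have h : UpA 1636 := h.step 12 (by decide +kernel) (by norm_num)
  have h : UpA 1648 := h.step 12 (by decide +kernel) (by norm_num)
  have h : UpA 1660 := h.step 12 (by decide +kernel) (by norm_num)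
  exact h

lemma upA_1900 : UpA 1900 := by
  have h := upA_1660
  have h : UpA 1672 := h.step 12 (by decide +kernel) (by norm_num)
  have h : UpA 1684 := h.step 12 (by decide +kernel) (by norm_num)
  have h : UpA 1696 := h.step 12 (by decide +kernel) (by norm_num)
  have h : UpA 1708 := h.step 12 (by decide +kernel) (by norm_num)
  have h : UpA 1720 := h.step 12 (by decide +kernel) (by norm_num)
  have h : UpA 1732 := h.step 12 (by decide +kernel) (by norm_num)
  have h : UpA 1744 := h.step 12 (by decide +kernel) (by norm_num)
  have h : UpA 1756 := h.step 12 (by decide +kernel) (by norm_num)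
  have h : UpA 1768 := h.step 12 (by decide +kernel) (by norm_num)
  have h : UpA 1780 := h.step 12 (by decide +kernel) (by norm_num)
  have h : UpA 1792 := h.step 12 (by decide +kernel) (by norm_num)
  have h : UpA 1804 := h.step 12 (by decide +kernel) (by norm_num)
  have h : UpA 1816 := h.step 12 (by decide +kernel) (by norm_num)
  have h : UpA 1828 := h.step 12 (by decide +kernel) (by norm_num)
  have h : UpA 1840 := h.step 12 (by decide +kernel) (by norm_num)
  have h : UpA 1852 := h.step 12 (by decide +kernel) (by norm_num)
  have h : UpA 1864 := h.step 12 (by decide +kernel) (by norm_num)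
  have h : UpA 1876 := h.step 12 (by decide +kernel) (by norm_num)
  have h : UpA 1888 := h.step 12 (by decide +kernel) (by norm_num)
  have h : UpA 1900 := h.step 12 (by decide +kernel) (by norm_num)
  exact h

lemma upA_2140 : UpA 2140 := by
  have h := upA_1900
  have h : UpA 1912 := h.step 12 (by decide +kernel) (by norm_num)
  have h : UpA 1924 := h.step 12 (by decide +kernel) (by norm_num)
  have h : UpA 1936 := h.step 12 (by decide +kernel) (by norm_num)
  have h : UpA 1948 := h.step 12 (by decide +kernel) (by norm_num)
  have h : UpA 1960 := h.step 12 (by decide +kernel) (by norm_num)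
  have h : UpA 1972 := h.step 12 (by decide +kernel) (by norm_num)
  have h : UpA 1984 := h.step 12 (by decide +kernel) (by norm_num)
  have h : UpA 1996 := h.step 12 (by decide +kernel) (by norm_num)
  have h : UpA 2008 := h.step 12 (by decide +kernel) (by norm_num)
  have h : UpA 2020 := h.step 12 (by decide +kernel) (by norm_num)
  have h : UpA 2032 := h.step 12 (by decide +kernel) (by norm_num)
  have h : UpA 2044 := h.step 12 (by decide +kernel) (by norm_num)
  have h : UpA 2056 := h.step 12 (by decide +kernel) (by norm_num)
  have h : UpA 2068 := h.step 12 (by decide +kernel) (by norm_num)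
  have h : UpA 2080 := h.step 12 (by decide +kernel) (by norm_num)
  have h : UpA 2092 := h.step 12 (by decide +kernel) (by norm_num)
  have h : UpA 2104 := h.step 12 (by decide +kernel) (by norm_num)
  have h : UpA 2116 := h.step 12 (by decide +kernel) (by norm_num)
  have h : UpA 2128 := h.step 12 (by decide +kernel) (by norm_num)
  have h : UpA 2140 := h.step 12 (by decide +kernel) (by norm_num)
  exact h

lemma upA_2380 : UpA 2380 := by
  have h := upA_2140
  have h : UpA 2152 := h.step 12 (by decide +kernel) (by norm_num)
  have h : UpA 2164 := h.step 12 (by decide +kernel) (by norm_num)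
  have h : UpA 2176 := h.step 12 (by decide +kernel) (by norm_num)
  have h : UpA 2188 := h.step 12 (by decide +kernel) (by norm_num)
  have h : UpA 2200 := h.step 12 (by decide +kernel) (by norm_num)
  have h : UpA 2212 := h.step 12 (by decide +kernel) (by norm_num)
  have h : UpA 2224 := h.step 12 (by decide +kernel) (by norm_num)
  have h : UpA 2236 := h.step 12 (by decide +kernel) (by norm_num)
  have h : UpA 2248 := h.step 12 (by decide +kernel) (by norm_num)
  have h : UpA 2260 := h.step 12 (by decide +kernel) (by norm_num)
  have h : UpA 2272 := h.step 12 (by decide +kernel) (by norm_num)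
  have h : UpA 2284 := h.step 12 (by decide +kernel) (by norm_num)
  have h : UpA 2296 := h.step 12 (by decide +kernel) (by norm_num)
  have h : UpA 2308 := h.step 12 (by decide +kernel) (by norm_num)
  have h : UpA 2320 := h.step 12 (by decide +kernel) (by norm_num)
  have h : UpA 2332 := h.step 12 (by decide +kernel) (by norm_num)
  have h : UpA 2344 := h.step 12 (by decide +kernel) (by norm_num)
  have h : UpA 2356 := h.step 12 (by decide +kernel) (by norm_num)
  have h : UpA 2368 := h.step 12 (by decide +kernel) (by norm_num)
  have h : UpA 2380 := h.step 12 (by decide +kernel) (by norm_num)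
  exact h

lemma upA_2620 : UpA 2620 := by
  have h := upA_2380
  have h : UpA 2392 := h.step 12 (by decide +kernel) (by norm_num)
  have h : UpA 2404 := h.step 12 (by decide +kernel) (by norm_num)
  have h : UpA 2416 := h.step 12 (by decide +kernel) (by norm_num)
  have h : UpA 2428 := h.step 12 (by decide +kernel) (by norm_num)
  have h : UpA 2440 := h.step 12 (by decide +kernel) (by norm_num)
  have h : UpA 2452 := h.step 12 (by decide +kernel) (by norm_num)
  have h : UpA 2464 := h.step 12 (by decide +kernel) (by norm_num)
  have h : UpA 2476 := h.step 12 (by decide +kernel) (by norm_num)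
  have h : UpA 2488 := h.step 12 (by decide +kernel) (by norm_num)
  have h : UpA 2500 := h.step 12 (by decide +kernel) (by norm_num)
  have h : UpA 2512 := h.step 12 (by decide +kernel) (by norm_num)
  have h : UpA 2524 := h.step 12 (by decide +kernel) (by norm_num)
  have h : UpA 2536 := h.step 12 (by decide +kernel) (by norm_num)
  have h : UpA 2548 := h.step 12 (by decide +kernel) (by norm_num)
  have h : UpA 2560 := h.step 12 (by decide +kernel) (by norm_num)
  have h : UpA 2572 := h.step 12 (by decide +kernel) (by norm_num)
  have h : UpA 2584 := h.step 12 (by decide +kernel) (by norm_num)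
  have h : UpA 2596 := h.step 12 (by decide +kernel) (by norm_num)
  have h : UpA 2608 := h.step 12 (by decide +kernel) (by norm_num)
  have h : UpA 2620 := h.step 12 (by decide +kernel) (by norm_num)
  exact h

lemma upA_2860 : UpA 2860 := by
  have h := upA_2620
  have h : UpA 2632 := h.step 12 (by decide +kernel) (by norm_num)
  have h : UpA 2644 := h.step 12 (by decide +kernel) (by norm_num)
  have h : UpA 2656 := h.step 12 (by decide +kernel) (by norm_num)
  have h : UpA 2668 := h.step 12 (by decide +kernel) (by norm_num)
  have h : UpA 2680 := h.step 12 (by decide +kernel) (by norm_num)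
  have h : UpA 2692 := h.step 12 (by decide +kernel) (by norm_num)
  have h : UpA 2704 := h.step 12 (by decide +kernel) (by norm_num)
  have h : UpA 2716 := h.step 12 (by decide +kernel) (by norm_num)
  have h : UpA 2728 := h.step 12 (by decide +kernel) (by norm_num)
  have h : UpA 2740 := h.step 12 (by decide +kernel) (by norm_num)
  have h : UpA 2752 := h.step 12 (by decide +kernel) (by norm_num)
  have h : UpA 2764 := h.step 12 (by decide +kernel) (by norm_num)
  have h : UpA 2776 := h.step 12 (by decide +kernel) (by norm_num)
  have h : UpA 2788 := h.step 12 (by decide +kernel) (by norm_num)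
  have h : UpA 2800 := h.step 12 (by decide +kernel) (by norm_num)
  have h : UpA 2812 := h.step 12 (by decide +kernel) (by norm_num)
  have h : UpA 2824 := h.step 12 (by decide +kernel) (by norm_num)
  have h : UpA 2836 := h.step 12 (by decide +kernel) (by norm_num)
  have h : UpA 2848 := h.step 12 (by decide +kernel) (by norm_num)
  have h : UpA 2860 := h.step 12 (by decide +kernel) (by norm_num)
  exact h

lemma upA_3100 : UpA 3100 := by
  have h := upA_2860
  have h : UpA 2872 := h.step 12 (by decide +kernel) (by norm_num)
  have h : UpA 2884 := h.step 12 (by decide +kernel) (by norm_num)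
  have h : UpA 2896 := h.step 12 (by decide +kernel) (by norm_num)
  have h : UpA 2908 := h.step 12 (by decide +kernel) (by norm_num)
  have h : UpA 2920 := h.step 12 (by decide +kernel) (by norm_num)
  have h : UpA 2932 := h.step 12 (by decide +kernel) (by norm_num)
  have h : UpA 2944 := h.step 12 (by decide +kernel) (by norm_num)
  have h : UpA 2956 := h.step 12 (by decide +kernel) (by norm_num)
  have h : UpA 2968 := h.step 12 (by decide +kernel) (by norm_num)
  have h : UpA 2980 := h.step 12 (by decide +kernel) (by norm_num)
  have h : UpA 2992 := h.step 12 (by decide +kernel) (by norm_num)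
  have h : UpA 3004 := h.step 12 (by decide +kernel) (by norm_num)
  have h : UpA 3016 := h.step 12 (by decide +kernel) (by norm_num)
  have h : UpA 3028 := h.step 12 (by decide +kernel) (by norm_num)
  have h : UpA 3040 := h.step 12 (by decide +kernel) (by norm_num)
  have h : UpA 3052 := h.step 12 (by decide +kernel) (by norm_num)
  have h : UpA 3064 := h.step 12 (by decide +kernel) (by norm_num)
  have h : UpA 3076 := h.step 12 (by decide +kernel) (by norm_num)
  have h : UpA 3088 := h.step 12 (by decide +kernel) (by norm_num)
  have h : UpA 3100 := h.step 12 (by decide +kernel) (by norm_num)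
  exact h

lemma upA_3340 : UpA 3340 := by
  have h := upA_3100
  have h : UpA 3112 := h.step 12 (by decide +kernel) (by norm_num)
  have h : UpA 3124 := h.step 12 (by decide +kernel) (by norm_num)
  have h : UpA 3136 := h.step 12 (by decide +kernel) (by norm_num)
  have h : UpA 3148 := h.step 12 (by decide +kernel) (by norm_num)
  have h : UpA 3160 := h.step 12 (by decide +kernel) (by norm_num)
  have h : UpA 3172 := h.step 12 (by decide +kernel) (by norm_num)
  have h : UpA 3184 := h.step 12 (by decide +kernel) (by norm_num)
  have h : UpA 3196 := h.step 12 (by decide +kernel) (by norm_num)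
  have h : UpA 3208 := h.step 12 (by decide +kernel) (by norm_num)
  have h : UpA 3220 := h.step 12 (by decide +kernel) (by norm_num)
  have h : UpA 3232 := h.step 12 (by decide +kernel) (by norm_num)
  have h : UpA 3244 := h.step 12 (by decide +kernel) (by norm_num)
  have h : UpA 3256 := h.step 12 (by decide +kernel) (by norm_num)
  have h : UpA 3268 := h.step 12 (by decide +kernel) (by norm_num)
  have h : UpA 3280 := h.step 12 (by decide +kernel) (by norm_num)
  have h : UpA 3292 := h.step 12 (by decide +kernel) (by norm_num)
  have h : UpA 3304 := h.step 12 (by decide +kernel) (by norm_num)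
  have h : UpA 3316 := h.step 12 (by decide +kernel) (by norm_num)
  have h : UpA 3328 := h.step 12 (by decide +kernel) (by norm_num)
  have h : UpA 3340 := h.step 12 (by decide +kernel) (by norm_num)
  exact h

lemma upA_3580 : UpA 3580 := by
  have h := upA_3340
  have h : UpA 3352 := h.step 12 (by decide +kernel) (by norm_num)
  have h : UpA 3364 := h.step 12 (by decide +kernel) (by norm_num)
  have h : UpA 3376 := h.step 12 (by decide +kernel) (by norm_num)
  have h : UpA 3388 := h.step 12 (by decide +kernel) (by norm_num)
  have h : UpA 3400 := h.step 12 (by decide +kernel) (by norm_num)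
  have h : UpA 3412 := h.step 12 (by decide +kernel) (by norm_num)
  have h : UpA 3424 := h.step 12 (by decide +kernel) (by norm_num)
  have h : UpA 3436 := h.step 12 (by decide +kernel) (by norm_num)
  have h : UpA 3448 := h.step 12 (by decide +kernel) (by norm_num)
  have h : UpA 3460 := h.step 12 (by decide +kernel) (by norm_num)
  have h : UpA 3472 := h.step 12 (by decide +kernel) (by norm_num)
  have h : UpA 3484 := h.step 12 (by decide +kernel) (by norm_num)
  have h : UpA 3496 := h.step 12 (by decide +kernel) (by norm_num)
  have h : UpA 3508 := h.step 12 (by decide +kernel) (by norm_num)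
  have h : UpA 3520 := h.step 12 (by decide +kernel) (by norm_num)
  have h : UpA 3532 := h.step 12 (by decide +kernel) (by norm_num)
  have h : UpA 3544 := h.step 12 (by decide +kernel) (by norm_num)
  have h : UpA 3556 := h.step 12 (by decide +kernel) (by norm_num)
  have h : UpA 3568 := h.step 12 (by decide +kernel) (by norm_num)
  have h : UpA 3580 := h.step 12 (by decide +kernel) (by norm_num)
  exact h

lemma upA_3616 : UpA 3616 := by
  have h := upA_3580
  have h : UpA 3592 := h.step 12 (by decide +kernel) (by norm_num)
  have h : UpA 3604 := h.step 12 (by decide +kernel) (by norm_num)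
  have h : UpA 3616 := h.step 12 (by decide +kernel) (by norm_num)
  exact h

end

section

lemma IsE.le25 {k : ℕ} {e : ℝ} (he : IsE k e) : e ≤ 2/5 := by
  obtain ⟨hk, h0, h1, h2⟩ := he
  rcases Nat.lt_or_ge 2 k with h | h
  · have : (3:ℝ) ≤ k := by exact_mod_cast h
    nlinarith
  · obtain rfl : k = 2 := by omega
    push_cast at h1
    nlinarith [sq_nonneg (e-1/2)]

lemma IsE.pow_lt_of {k : ℕ} {e : ℝ} (_ : IsE k e) {m M x u v : ℕ} (hu : (u:ℝ)/v ≤ 2-e) (hv : 0 < v) (hvu : v ≤ u) (h : (2-e)^m < 2^x)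
    (hM : v^M*2^x ≤ u^M) : m < M := by
  by_contra hc
  push Not at hc
  have hv' : (0:ℝ) < v := by exact_mod_cast hv
  have hvu' : (1:ℝ) ≤ (u:ℝ)/v := by rw [one_le_div hv']; exact_mod_cast hvu
  have h1 : ((u:ℝ)/v)^M ≤ (2-e)^m :=
    (pow_le_pow_right₀ hvu' hc).trans (pow_le_pow_left₀ (by linarith) hu _)
  have h2 : (v:ℝ)^M*2^x ≤ u^M := by exact_mod_cast hM
  rw [div_pow, div_le_iff₀ (by positivity)] at h1
  have h3 : (0:ℝ) < v^M := by positivity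
  nlinarith

lemma roundA {k n m d a : ℕ} (hr : RepD k n m d a) (hn : n < 2^1744) : m < 2677 := by
  by_cases hm : m < 12
  · omega
  obtain ⟨e, he⟩ := exists_e k hr.1
  have hd : DoneA k := by
    by_cases hk : k < 3616
    · exact upA_3616 k hr.1 hk
    · exact rU_spec rU_ok k (by omega)
  have hmn := hr.2.1
  have hnm : n + m ≤ 2^1745 := by
    have : 2^1745 = 2^1744*2 := pow_succ 2 1744
    generalize (2:ℕ)^1744 = z at *
    omega
  exact he.pow_lt_of (u := 8) (v := 5) (by push_cast; linarith [he.le25]) (by norm_num) (by norm_num)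
    (hd e he n m d a hr hnm (by omega)) (by decide +kernel)

lemma RepD.pass3 {k n m d a : ℕ} (hr : RepD k n m d a) (hn : n < 2^1744) : n < 2^451 := by
  have hk : k ≤ 12223 := by
    have := hr.k_le 1744 hn
    norm_num at this; omega
  exact hr.passX (M := 2677) (D := 12222) (g := 896) (L := 346153959593960046572857196546) (S₀ := 10673214465) (σ := 5) (J := 121) (τ := 92894016228347794680838614935253398951) (c := 314) (bB := 1844) (w := 444)
    hn (roundA hr hn) (by omega) (by unfold BParam; decide +kernel) (by decide +kernel) (by decide +kernel) (by decide +kernel) (by decide +kernel)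

lemma RepD.pass4 {k n m d a : ℕ} (hr : RepD k n m d a) (hn : n < 2^1744) : n < 2^409 := by
  have hn' := hr.pass3 hn
  have hk : k ≤ 3172 := by
    have := hr.k_le 451 hn'
    norm_num at this; omega
  exact hr.passX (M := 2677) (D := 3171) (g := 896) (L := 368640024140635046114492418) (S₀ := 783223321) (σ := 5) (J := 110) (τ := 25729497943988137778585266881167132) (c := 285) (bB := 541) (w := 403)
    hn' (roundA hr hn) (by omega) (by unfold BParam; decide +kernel) (by decide +kernel) (by decide +kernel) (by decide +kernel) (by decide +kernel)

lemma RepD.bound409 {k n m d a : ℕ} (hr : RepD k n m d a) : n < 2^409 := hr.pass4 (hr.pass2 (hr.pass1 hr.generic))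

end

section

/-- Final step in the computation of a logarithm. -/
noncomputable def lfin (l2 Q fuel t y8 c lc : ℕ) (cont : ℕ → Bool) : Bool :=
  bA (Nat.ble (Nat.mul c Q) (Nat.mul 2 y8)) (fz (Nat.sub Q (Nat.div y8 c)) fun x => lg Q fuel x fun Y =>
    fz (Nat.add lc (Nat.mul t l2)) fun a => fz (Nat.add (Nat.mul 3 l2) Y) fun b => bA (Nat.ble b a) (fz (Nat.sub a b) cont))

/-- One choice of the reference point. -/
noncomputable def lbr (l2 Q fuel t y8 c lc : ℕ) (cont : ℕ → Bool) (els : Bool) : Bool :=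
  Bool.rec els (lfin l2 Q fuel t y8 c lc cont) (Nat.ble y8 (Nat.mul c Q))

/-- One step of the binary search for the size of a number. -/
noncomputable def l2s (X b t : ℕ) (c : ℕ → Bool) : Bool :=
  fz (Nat.add t b) fun t' => Bool.rec (c t') (c t) (Nat.beq (Nat.shiftRight X t') 0)

/-- Binary search for the size of a number. -/
noncomputable def lb2 (X : ℕ) (c : ℕ → Bool) : Bool :=
  l2s X 512 0 fun t => l2s X 256 t fun t => l2s X 128 t fun t => l2s X 64 t fun t => l2s X 32 t fun t =>
  l2s X 16 t fun t => l2s X 8 t fun t => l2s X 4 t fun t => l2s X 2 t fun t => l2s X 1 t c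

lemma l2s_spec {X b t : ℕ} {c : ℕ → Bool} (h : l2s X b t c = true) : ∃ t, c t = true := by
  unfold l2s at h
  rw [fz_eq] at h
  cases hb : Nat.beq (Nat.shiftRight X (Nat.add t b)) 0 <;> rw [hb] at h
  · exact ⟨_, h⟩
  · exact ⟨_, h⟩

lemma lb2_spec {X : ℕ} {c : ℕ → Bool} (h : lb2 X c = true) : ∃ t, c t = true := by
  unfold lb2 at h
  obtain ⟨_, h⟩ := l2s_spec h
  obtain ⟨_, h⟩ := l2s_spec h
  obtain ⟨_, h⟩ := l2s_spec h
  obtain ⟨_, h⟩ := l2s_spec h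
  obtain ⟨_, h⟩ := l2s_spec h
  obtain ⟨_, h⟩ := l2s_spec h
  obtain ⟨_, h⟩ := l2s_spec h
  obtain ⟨_, h⟩ := l2s_spec h
  obtain ⟨_, h⟩ := l2s_spec h
  exact l2s_spec h

/-- The logarithm of a positive integer. -/
noncomputable def logN (l2 l3 l5 l7 Q fuel X : ℕ) (cont : ℕ → Bool) : Bool :=
  lb2 X fun t => bA (Nat.ble t 1000) (bA (Nat.ble X (Nat.mul 2 (Nat.pow 2 t)))
    (fz (Nat.mul 8 (Nat.succ (Nat.shiftRight (Nat.mul X (Nat.sub Q 1)) t))) fun y8 =>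
    lbr l2 Q fuel t y8 8 (Nat.mul 3 l2) cont (
    lbr l2 Q fuel t y8 10 (Nat.add l2 l5) cont (
    lbr l2 Q fuel t y8 12 (Nat.add (Nat.mul 2 l2) l3) cont (
    lbr l2 Q fuel t y8 14 (Nat.add l2 l7) cont (
    lbr l2 Q fuel t y8 16 (Nat.mul 4 l2) cont false))))))

lemma logN_core {P X t y8 c : ℕ} (hX : 0 < X) (hXt : X ≤ 2*2^t) (hP : 2 ≤ P) (hc8 : 8 ≤ c) (hc : 0 < c) (hy : y8 = 8*(X*(2^P-1)/2^t+1)) (h : y8 ≤ c*2^P)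
    (h2 : c*2^P ≤ 2*y8) : Ap P (1 - 8*X/(c*2^t)) (2^P - y8/c) 33 ∧ 1 - 8*(X:ℝ)/(c*2^t) ≤ 3/4 := by
  have hc' : (1:ℝ) ≤ c := by exact_mod_cast hc
  have hX' : (0:ℝ) < X := by exact_mod_cast hX
  have hQ : (1:ℝ) ≤ 2^P := one_le_pow₀ (by norm_num)
  have ht : (0:ℝ) < 2^t := by positivity
  have hXt' : (X:ℝ)/2^t ≤ 2 := by rw [div_le_iff₀ ht]; exact_mod_cast hXt
  have f1 := fdiv (X*(2^P-1)) (2^t) (by positivity)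
  have f2 := fdiv y8 c hc
  have f3 : y8/c ≤ 2^P := by rw [Nat.div_le_iff_le_mul_add_pred hc]; omega
  have e1 : ((X*(2^P-1):ℕ):ℝ)/((2^t:ℕ):ℝ) = X/2^t*2^P - X/2^t := by
    push_cast [Nat.cast_sub (Nat.one_le_two_pow : 1 ≤ 2^P)]; ring
  rw [e1] at f1
  have e2 : (y8:ℝ) = 8*((X*(2^P-1)/2^t:ℕ):ℝ)+8 := by rw [hy]; push_cast; ring
  have e3 : 8*(X:ℝ)/(c*2^t) = 8*(X/2^t)/c := by field_simp
  have h2' : (c:ℝ)*2^P ≤ 2*y8 := by exact_mod_cast h2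
  have hu : (0:ℝ) < X/2^t := by positivity
  set u : ℝ := (X:ℝ)/2^t
  have g1 : (y8:ℝ) ≤ 8*u*2^P + 8 := by linarith
  have g2 : 8*u*2^P - 24 ≤ (y8:ℝ) := by linarith
  have g3 : (y8:ℝ)/c ≤ 8*u/c*2^P + 8 := by
    have : y8/c - 8*u/c*2^P = (y8 - 8*u*2^P)/c := by ring
    have : (y8 - 8*u*2^P)/c ≤ 8 := by rw [div_le_iff₀ (by linarith)]; linarith
    linarith
  have g4 : 8*u/c*2^P - 24 ≤ (y8:ℝ)/c := by
    have : 8*u/c*2^P - y8/c = (8*u*2^P - y8)/c := by ring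
    have : (8*u*2^P - y8)/c ≤ 24 := by rw [div_le_iff₀ (by linarith)]; linarith
    linarith
  rw [e3]
  constructor
  · unfold Ap
    rw [Nat.cast_sub f3, sub_mul, one_mul]
    push_cast
    rw [abs_le]
    constructor <;> linarith [f2.1, f2.2]
  · have : 1/4 ≤ 8*u/c := by
      rw [le_div_iff₀ (by linarith)]
      have h8 : (8:ℝ) ≤ c := by exact_mod_cast hc8
      have h5 : (32:ℝ) ≤ c*2^P := by
        have : (2:ℝ)^2 ≤ 2^P := pow_le_pow_right₀ (by norm_num) hP
        nlinarith
      have : 1/4*(c:ℝ)*2^P ≤ 8*u*2^P := by linarith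
      have := le_of_mul_le_mul_right this (by linarith)
      linarith
    linarith

lemma lbr_spec {P l2 W0 fuel t X c lc y8 : ℕ} {cont : ℕ → Bool} {els : Bool} (hX : 0 < X) (hP : 2 ≤ P) (h2 : Ap P (Real.log 2) l2 W0)
    (hc : 8 ≤ c) (hl : Ap P (Real.log c) lc (4*W0)) (ht : t ≤ 1000) (hXt : X ≤ 2*2^t) (hy : y8 = 8*(X*(2^P-1)/2^t+1))
    (h : lbr l2 (2^P) fuel t y8 c lc cont els = true) :
    els = true ∨ ∃ G, cont G = true ∧ Ap P (Real.log X) G (1010*W0 + (6*fuel+140)) := by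
  unfold lbr at h
  cases hb : Nat.ble y8 (Nat.mul c (2^P)) with
  | false => rw [hb] at h; exact Or.inl h
  | true =>
    right
    rw [hb] at h
    rw [nble, nmul] at hb
    change lfin _ _ _ _ _ _ _ _ = true at h
    unfold lfin at h
    simp only [fz_eq, bA_eq, nadd, nmul, nsub, ndiv, nble] at h
    obtain ⟨h3, h⟩ := h
    obtain ⟨hx, hx'⟩ := logN_core hX hXt hP hc (by omega) hy hb h3
    obtain ⟨Y, h, hY⟩ := lg_spec h hx hx'
    simp only [bA_eq, nble] at h
    refine ⟨_, h.2, ?_⟩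
    refine ((hl.add (h2.nmul t)).sub ((h2.nmul 3).add hY) h.1).congr ?_ ?_
    · rw [sub_sub_cancel, show (8:ℝ)*X = 2^3*X by norm_num]
      have hX' : (0:ℝ) < X := by exact_mod_cast hX
      have hc' : (0:ℝ) < c := by exact_mod_cast (show 0 < c by omega)
      rw [Real.log_div (by positivity) (by positivity), Real.log_mul (by positivity) (by positivity), Real.log_mul (by positivity) (by positivity),
        Real.log_pow, Real.log_pow]
      push_cast; ring
    · have : t*W0 ≤ 1000*W0 := Nat.mul_le_mul_right _ ht
      omega

lemma logN_spec {P l2 l3 l5 l7 W0 fuel X : ℕ} {cont : ℕ → Bool} (hX : 0 < X) (hP : 2 ≤ P) (hc : CK P l2 l3 l5 l7 W0)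
    (h : logN l2 l3 l5 l7 (2^P) fuel X cont = true) :
    ∃ G, cont G = true ∧ Ap P (Real.log X) G (1010*W0 + (6*fuel+140)) := by
  unfold logN at h
  obtain ⟨t, h⟩ := lb2_spec h
  simp only [fz_eq, bA_eq, nble] at h
  obtain ⟨ht, hXt, h⟩ := h
  have hy : Nat.mul 8 (Nat.succ (Nat.shiftRight (Nat.mul X (Nat.sub (2^P) 1)) t)) = 8*(X*(2^P-1)/2^t+1) := by
    rw [← Nat.shiftRight_eq_div_pow]; rfl
  rcases lbr_spec hX hP hc.h2 (by norm_num) ((hc.h2.nmul 3).congr (by rw [show ((8:ℕ):ℝ) = 2^3 by norm_num, Real.log_pow]) (by omega)) ht hXt hy h with h | h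
  swap
  · exact h
  rcases lbr_spec hX hP hc.h2 (by norm_num) ((hc.h2.add hc.h5).congr (by push_cast; exact log_ten) (by omega)) ht hXt hy h with h | h
  swap
  · exact h
  rcases lbr_spec hX hP hc.h2 (by norm_num) (((hc.h2.nmul 2).add hc.h3).congr (by
      rw [show ((12:ℕ):ℝ) = 2^2*3 by norm_num, Real.log_mul (by norm_num) (by norm_num), Real.log_pow]) (by omega)) ht hXt hy h with h | h
  swap
  · exact h
  rcases lbr_spec hX hP hc.h2 (by norm_num) ((hc.h2.add hc.h7).congr (by
      rw [show ((14:ℕ):ℝ) = 2*7 by norm_num, Real.log_mul (by norm_num) (by norm_num)]) (by omega)) ht hXt hy h with h | h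
  swap
  · exact h
  rcases lbr_spec hX hP hc.h2 (by norm_num) ((hc.h2.nmul 4).congr (by rw [show ((16:ℕ):ℝ) = 2^4 by norm_num, Real.log_pow]) (by omega)) ht hXt hy h with h | h
  · exact absurd h (by simp)
  · exact h

/-- List reversal. -/
noncomputable def rv (l : List ℕ) (cont : List ℕ → Bool) : List ℕ → Bool :=
  List.rec (fun acc => cont acc) (fun x _ ih acc => ih (x :: acc)) l

lemma rv_eq (l : List ℕ) (cont : List ℕ → Bool) : ∀ acc, rv l cont acc = cont (l.reverse ++ acc) := by
  induction l with
  | nil => intro acc; rfl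
  | cons x l ih => intro acc; change rv l cont (x :: acc) = _; rw [ih]; simp

/-- Taking the first element of a queue. -/
noncomputable def pop (F R : List ℕ) (c : ℕ → List ℕ → List ℕ → Bool) : Bool :=
  List.rec (rv R (fun F2 => List.rec false (fun o F' _ => c o F' []) F2) []) (fun o F' _ => c o F' R) F

lemma pop_spec {F R : List ℕ} {c : ℕ → List ℕ → List ℕ → Bool} (h : pop F R c = true) :
    ∃ o F' R', c o F' R' = true ∧ F ++ R.reverse = o :: (F' ++ R'.reverse) := by
  cases F with
  | nil =>
    change rv R (fun F2 => List.rec false (fun o F' _ => c o F' []) F2) [] = true at h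
    rw [rv_eq, List.append_nil] at h
    rw [List.nil_append]
    cases hR : R.reverse with
    | nil => rw [hR] at h; exact absurd h (by simp)
    | cons o F' => rw [hR] at h; exact ⟨o, F', [], h, by simp⟩
  | cons o F' => exact ⟨o, F', R, h, rfl⟩

/-- A tagged term of the sequence (the tag keeps the low digits distinct). -/
noncomputable def tg (k i : ℕ) : ℕ := lucasK k i * 2^64 + i

/-- Running through the sequence. -/
noncomputable def walk (k1 c B : ℕ) (test : ℕ → Bool) (fuel : ℕ) : ℕ → List ℕ → List ℕ → ℕ → Bool :=
  Nat.rec (fun _ _ _ _ => true) (fun _ ih m F R p => pop F R fun o F' R' => fz (Nat.sub (Nat.mul 2 p) (Nat.add o c)) fun p' => fz (Nat.succ m) fun m' =>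
    bA (bO (Nat.ble 6 (Nat.mod m' k1)) (fz (Nat.div p' B) test)) (ih m' F' (p' :: R') p')) fuel

lemma walk_spec (k : ℕ) (hk : 2 ≤ k) (test : ℕ → Bool) : ∀ fuel m F R p, k ≤ m → m + fuel ≤ 10000 → p = tg k m →
    F ++ R.reverse = (List.range' (m-k) (k+1)).map (tg k) → walk (k+1) (k-1) (2^64) test fuel m F R p = true →
    ∀ i, m < i → i ≤ m + fuel → i % (k+1) ≤ 5 → test (lucasK k i) = true := by
  intro fuel
  induction fuel with
  | zero => intro m F R p _ _ _ _ _ i h1 h2; omega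
  | succ fuel ih =>
    intro m F R p hm hmf hp hF h i h1 h2 h3
    change pop F R (fun o F' R' => fz (Nat.sub (Nat.mul 2 p) (Nat.add o (k-1))) fun p' => fz (Nat.succ m) fun m' =>
      bA (bO (Nat.ble 6 (Nat.mod m' (k+1))) (fz (Nat.div p' (2^64)) test)) (walk (k+1) (k-1) (2^64) test fuel m' F' (p' :: R') p')) = true at h
    obtain ⟨o, F', R', h, hpop⟩ := pop_spec h
    simp only [fz_eq, bA_eq, bO_eq, nsub, nmul, nmod, nadd, ndiv, nble, Nat.succ_eq_add_one] at h
    rw [hpop, List.range'_succ, List.map_cons, List.cons.injEq] at hF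
    have hd := lucasK_double k m hk (by omega) hm
    have hp' : 2*p - (o + (k-1)) = tg k (m+1) := by
      rw [hF.1, hp]; unfold tg; omega
    rw [hp', show tg k (m+1) / 2^64 = lucasK k (m+1) by unfold tg; omega] at h
    by_cases hi : i = m+1
    · rw [hi] at h3 ⊢
      exact h.1.resolve_left (by omega)
    · refine ih (m+1) F' _ _ (by omega) (by omega) rfl ?_ h.2 i (by omega) (by omega) h3
      rw [List.reverse_cons, ← List.append_assoc, hF.2, List.range'_1_concat, List.map_append, List.map_singleton,
        show m + 1 - k + k = m + 1 by omega, show m - k + 1 = m + 1 - k by omega]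

/-- The first terms of the sequence. -/
noncomputable def ini (B : ℕ) (cont : List ℕ → Bool) (fuel : ℕ) : ℕ → List ℕ → Bool :=
  Nat.rec (fun _ acc => fz (Nat.mul 2 B) fun x => fz (Nat.succ B) fun y => cont (x :: y :: acc))
    (fun f ih v acc => fz (Nat.div v 2) fun w => fz (Nat.add (Nat.mul v B) (Nat.add f 2)) fun x => ih w (x :: acc)) fuel

lemma ini_spec (k : ℕ) (hk : 2 ≤ k) (cont : List ℕ → Bool) : ∀ fuel j v acc, fuel + 1 ≤ k → (∀ f, fuel = f + 1 → v = 3*2^f) →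
    acc = (List.range' (fuel+2) j).map (tg k) → ini (2^64) cont fuel v acc = true →
    cont ((List.range' 0 (fuel+2+j)).map (tg k)) = true := by
  intro fuel
  induction fuel with
  | zero =>
    intro j v acc _ _ ha h
    change fz (Nat.mul 2 (2^64)) (fun x => fz (Nat.succ (2^64)) fun y => cont (x :: y :: acc)) = true at h
    rw [fz_eq, fz_eq] at h
    rw [show 0 + 2 + j = j + 1 + 1 by omega, List.range'_succ, List.range'_succ, List.map_cons, List.map_cons, ← ha,
      show tg k 0 = Nat.mul 2 (2^64) by unfold tg; rw [lucasK_zero]; rfl, show tg k (0+1) = Nat.succ (2^64) by unfold tg; rw [lucasK_one, one_mul]]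
    exact h
  | succ f ih =>
    intro j v acc hfk hv ha h
    change fz (Nat.div v 2) (fun w => fz (Nat.add (Nat.mul v (2^64)) (Nat.add f 2)) fun x => ini (2^64) cont f w (x :: acc)) = true at h
    rw [fz_eq, fz_eq] at h
    have := ih (j+1) _ _ (by omega) ?_ ?_ h
    · rw [show f + 1 + 2 + j = f + 2 + (j+1) by omega]; exact this
    · intro g hg
      rw [hv f rfl, hg, ndiv, pow_succ]; omega
    · have e : Nat.add (Nat.mul v (2^64)) (Nat.add f 2) = tg k (f+2) := by
        unfold tg
        rw [nadd, nmul, nadd, hv f rfl, lucasK_small k f hk (by omega)]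
      rw [ha, List.range'_succ, List.map_cons, e]

/-- Applying a test to all possible values of the smaller factor. -/
noncomputable def xAll (k Mx : ℕ) (test : ℕ → Bool) : Bool :=
  bA (test 2) (bA (test 1) (bA (test 3) (bA (test 6) (bA (test 12) (bA (test 24)
    (bO (Nat.ble Mx k) (fz (Nat.mul 3 (Nat.pow 2 (Nat.sub k 2))) fun v => fz (Nat.pow 2 64) fun B => fz (Nat.sub k 1) fun c =>
      fz (Nat.add (Nat.mul v B) k) fun p => fz (Nat.succ k) fun k1 =>
      ini B (fun F => walk k1 c B test (Nat.sub Mx k) k F [] p) c v [])))))))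

lemma xAll_spec {k n m d a Mx : ℕ} {test : ℕ → Bool} (hr : RepD k n m d a) (hm : m < Mx) (hMx : Mx ≤ 10000)
    (h : xAll k Mx test = true) : test (lucasK k m) = true := by
  have hk := hr.1
  unfold xAll at h
  simp only [bA_eq, bO_eq, nble, fz_eq, nsub, nadd] at h
  obtain ⟨t0, t1, t2, t3, t4, t5, h⟩ := h
  by_cases hmk : m ≤ k
  · have hm5 := hr.m_small hmk
    interval_cases m
    · rw [lucasK_zero]; exact t0
    · rw [lucasK_one]; exact t1
    · rw [lucasK_small k 0 hk (by omega)]; exact t2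
    · rw [lucasK_small k 1 hk (by omega)]; exact t3
    · rw [lucasK_small k 2 hk (by omega)]; exact t4
    · rw [lucasK_small k 3 hk (by omega)]; exact t5
  · have h := h.resolve_left (by omega)
    have hv : Nat.mul 3 (Nat.pow 2 (k-2)) = 3*2^(k-2) := rfl
    rw [hv] at h
    have h := ini_spec k hk _ (k-1) 0 _ _ (by omega) (by intro f hf; rw [show k-2 = f by omega]) (by simp) h
    refine walk_spec k hk test _ _ _ _ _ le_rfl (by omega) ?_ ?_ h m (by omega) (by omega) ?_
    · unfold tg
      rw [← lucasK_small k (k-2) hk (by omega), show k - 2 + 2 = k by omega]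
      rfl
    · rw [List.reverse_nil, List.append_nil, Nat.sub_self]; congr 2; omega
    · have := hr.res; omega

/-- The test for the form in `n`. -/
noncomputable def xTest (sk : Bool) (l2 l3 l5 l7 Q fuel T G0 : ℕ) (t : ℕ → Bool) (X : ℕ) : Bool :=
  logN l2 l3 l5 l7 Q fuel X fun G => fz (Nat.add G0 G) fun G => all9 sk l2 l3 l5 l7 T G t

/-- Adding the logarithm of a quotient. -/
noncomputable def rlog (Q fuel u v D : ℕ) (cont : ℕ → Bool) : Bool :=
  Bool.rec
    (bA (Nat.ble u (Nat.mul 4 v)) (fz (Nat.div (Nat.mul (Nat.sub u v) Q) u) fun x => lg Q fuel x fun Y => fz (Nat.add D Y) cont))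
    (bA (Nat.ble v (Nat.mul 4 u)) (fz (Nat.div (Nat.mul (Nat.sub v u) Q) v) fun x => lg Q fuel x fun Y => bA (Nat.ble Y D) (fz (Nat.sub D Y) cont)))
    (Nat.ble u v)

lemma rlog_aux {P u v : ℕ} (hv : 0 < v) (h : u ≤ v) (h4 : v ≤ 4*u) :
    Ap P (1-(u:ℝ)/v) ((v-u)*2^P/v) 1 ∧ 1-(u:ℝ)/v ≤ 3/4 := by
  have hv' : (0:ℝ) < v := by exact_mod_cast hv
  constructor
  · have f := fdiv ((v-u)*2^P) v hv
    have e : (((v-u)*2^P : ℕ):ℝ)/v = (1-(u:ℝ)/v)*2^P := by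
      push_cast [Nat.cast_sub h]; field_simp
    rw [e] at f
    unfold Ap
    rw [abs_le]; push_cast
    constructor <;> linarith [f.1, f.2]
  · have : (1:ℝ)/4 ≤ u/v := by
      rw [div_le_div_iff₀ (by norm_num) hv']
      have : (v:ℝ) ≤ 4*u := by exact_mod_cast h4
      linarith
    linarith

lemma rlog_spec {P fuel u v D E : ℕ} {r : ℝ} {cont : ℕ → Bool} (hu : 0 < u) (hv : 0 < v) (hD : Ap P r D E)
    (h : rlog (2^P) fuel u v D cont = true) : ∃ D', cont D' = true ∧ Ap P (r + Real.log (u/v)) D' (E + (4+6*fuel)) := by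
  unfold rlog at h
  have hu' : (0:ℝ) < u := by exact_mod_cast hu
  have hv' : (0:ℝ) < v := by exact_mod_cast hv
  cases hb : Nat.ble u v with
  | true =>
    rw [hb] at h
    simp only [bA_eq, fz_eq, nble, nmul, nsub, ndiv] at h hb
    obtain ⟨a1, a2⟩ := rlog_aux (P := P) hv hb h.1
    obtain ⟨Y, h1, hY⟩ := lg_spec h.2 a1 a2
    simp only [bA_eq, nble] at h1
    refine ⟨_, h1.2, (hD.sub hY h1.1).congr ?_ (by omega)⟩
    rw [sub_sub_cancel]; ring
  | false =>
    rw [hb] at h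
    have hb : v ≤ u := by
      by_contra hc
      have : Nat.ble u v = true := nble.2 (by omega)
      rw [hb] at this; exact absurd this (by simp)
    simp only [bA_eq, fz_eq, nble, nmul, nsub, ndiv, nadd] at h
    obtain ⟨a1, a2⟩ := rlog_aux (P := P) hu hb h.1
    obtain ⟨Y, h1, hY⟩ := lg_spec h.2 a1 a2
    refine ⟨_, h1, (hD.add hY).congr ?_ (by omega)⟩
    rw [sub_sub_cancel, Real.log_div hu'.ne' hv'.ne', Real.log_div hv'.ne' hu'.ne']; ring

/-- Running through the sequence together with its logarithms. -/
noncomputable def cwalk (Q f2 k1 c B : ℕ) (test : ℕ → Bool) (fuel : ℕ) : ℕ → List ℕ → List ℕ → ℕ → ℕ → ℕ → ℕ → ℕ → Bool :=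
  Nat.rec (fun _ _ _ _ _ _ _ _ => true) (fun _ ih m F R p x0 x1 G D => pop F R fun o F' R' => fz (Nat.sub (Nat.mul 2 p) (Nat.add o c)) fun p' =>
    fz (Nat.succ m) fun m' => fz (Nat.div p' B) fun x2 => fz (Nat.mul x2 x0) fun u => fz (Nat.mul x1 x1) fun v => rlog Q f2 u v D fun D' => fz (Nat.add G D') fun G' =>
    bA (bO (Nat.ble 6 (Nat.mod m' k1)) (test G')) (ih m' F' (p' :: R') p' x1 x2 G' D')) fuel

lemma cwalk_spec (P f2 k EM EG : ℕ) (hk : 2 ≤ k) (test : ℕ → Bool) : ∀ fuel m F R p x0 x1 G D Ed Eg, k ≤ m → m + fuel ≤ 10000 → p = tg k m →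
    x0 = lucasK k (m-1) → x1 = lucasK k m → Ap P (Real.log (lucasK k m)) G Eg → Ap P (Real.log (lucasK k m) - Real.log (lucasK k (m-1))) D Ed →
    Ed + fuel*(4+6*f2) ≤ EM → Eg + fuel*EM ≤ EG →
    F ++ R.reverse = (List.range' (m-k) (k+1)).map (tg k) → cwalk (2^P) f2 (k+1) (k-1) (2^64) test fuel m F R p x0 x1 G D = true →
    ∀ i, m < i → i ≤ m + fuel → i % (k+1) ≤ 5 → ∃ G, test G = true ∧ Ap P (Real.log (lucasK k i)) G EG := by
  intro fuel
  induction fuel with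
  | zero => intro m F R p x0 x1 G D Ed Eg _ _ _ _ _ _ _ _ _ _ _ i h1 h2; omega
  | succ fuel ih =>
    intro m F R p x0 x1 G D Ed Eg hm hmf hp hx0 hx1 hG hD hEd hEg hF h i h1 h2 h3
    change pop F R (fun o F' R' => fz (Nat.sub (Nat.mul 2 p) (Nat.add o (k-1))) fun p' =>
      fz (Nat.succ m) fun m' => fz (Nat.div p' (2^64)) fun x2 => fz (Nat.mul x2 x0) fun u => fz (Nat.mul x1 x1) fun v =>
      rlog (2^P) f2 u v D fun D' => fz (Nat.add G D') fun G' =>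
      bA (bO (Nat.ble 6 (Nat.mod m' (k+1))) (test G')) (cwalk (2^P) f2 (k+1) (k-1) (2^64) test fuel m' F' (p' :: R') p' x1 x2 G' D')) = true at h
    obtain ⟨o, F', R', h, hpop⟩ := pop_spec h
    simp only [fz_eq, nsub, nmul, nadd, ndiv, Nat.succ_eq_add_one] at h
    rw [hpop, List.range'_succ, List.map_cons, List.cons.injEq] at hF
    have hd := lucasK_double k m hk (by omega) hm
    have hp' : 2*p - (o + (k-1)) = tg k (m+1) := by
      rw [hF.1, hp]; unfold tg; omega
    rw [hp', show tg k (m+1) / 2^64 = lucasK k (m+1) by unfold tg; omega, hx0, hx1] at h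
    have q0 := lucasK_pos k (m-1) hk
    have q1 := lucasK_pos k m hk
    have q2 := lucasK_pos k (m+1) hk
    obtain ⟨D', h, hD'⟩ := rlog_spec (Nat.mul_pos q2 q0) (Nat.mul_pos q1 q1) hD h
    simp only [bA_eq, bO_eq, nmod, nble] at h
    have hD2 : Ap P (Real.log (lucasK k (m+1)) - Real.log (lucasK k m)) D' (Ed + (4+6*f2)) := by
      refine hD'.congr ?_ le_rfl
      have q0' : (0:ℝ) < lucasK k (m-1) := by exact_mod_cast q0
      have q1' : (0:ℝ) < lucasK k m := by exact_mod_cast q1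
      have q2' : (0:ℝ) < lucasK k (m+1) := by exact_mod_cast q2
      push_cast
      rw [Real.log_div (by positivity) (by positivity), Real.log_mul q2'.ne' q0'.ne', Real.log_mul q1'.ne' q1'.ne']
      ring
    have e1 : (fuel+1)*(4+6*f2) = fuel*(4+6*f2) + (4+6*f2) := by ring
    have e2 : (fuel+1)*EM = fuel*EM + EM := by ring
    have hG2 : Ap P (Real.log (lucasK k (m+1))) (G+D') (Eg + EM) := (hG.add hD2).congr (by ring) (by omega)
    by_cases hi : i = m+1
    · rw [hi] at h3 ⊢
      exact ⟨_, h.1.resolve_left (by omega), hG2.mono (by omega)⟩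
    · refine ih (m+1) F' _ _ _ _ _ _ _ _ (by omega) (by omega) rfl (by rw [Nat.add_sub_cancel]) rfl hG2 (by rw [Nat.add_sub_cancel]; exact hD2) (by omega) (by omega) ?_ h.2 i (by omega) (by omega) h3
      rw [List.reverse_cons, ← List.append_assoc, hF.2, List.range'_1_concat, List.map_append, List.map_singleton,
        show m + 1 - k + k = m + 1 by omega, show m - k + 1 = m + 1 - k by omega]

/-- Applying a test to the logarithms of all possible values of the smaller factor. -/
noncomputable def cAll (Q f2 l2 l3 k Mx : ℕ) (test : ℕ → Bool) : Bool :=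
  bA (test l2) (bA (test 0) (bA (test l3) (bA (test (Nat.add l3 l2)) (bA (test (Nat.add l3 (Nat.mul 2 l2))) (bA (test (Nat.add l3 (Nat.mul 3 l2)))
    (bO (Nat.ble Mx k) (fz (Bool.rec l2 l3 (Nat.beq k 2)) fun D => fz (Nat.mul 3 (Nat.pow 2 (Nat.sub k 2))) fun v => fz (Nat.pow 2 64) fun B => fz (Nat.sub k 1) fun c =>
      fz (Nat.add (Nat.mul v B) k) fun p => fz (Nat.succ k) fun k1 => fz (Nat.div v 2) fun w => fz (Nat.add l3 (Nat.mul (Nat.sub k 2) l2)) fun G =>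
      ini B (fun F => cwalk Q f2 k1 c B test (Nat.sub Mx k) k F [] p w v G D) c v [])))))))

lemma log_lk_small {P l2 l3 l5 l7 W0 k j : ℕ} (hc : CK P l2 l3 l5 l7 W0) (hk : 2 ≤ k) (hj : j + 2 ≤ k) :
    Ap P (Real.log (lucasK k (j+2))) (l3 + j*l2) (W0 + j*W0) := by
  refine (hc.h3.add (hc.h2.nmul j)).congr ?_ le_rfl
  rw [lucasK_small k j hk hj]
  push_cast
  rw [Real.log_mul (by norm_num) (by positivity), Real.log_pow]

lemma cAll_spec {P l2 l3 l5 l7 W0 f2 k n m d a Mx EG : ℕ} {test : ℕ → Bool} (hr : RepD k n m d a) (hc : CK P l2 l3 l5 l7 W0) (hm : m < Mx) (hMx : Mx ≤ 10000)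
    (hE : (k+1)*W0 + 4*W0 + Mx*(2*W0 + Mx*(4+6*f2)) ≤ EG)
    (h : cAll (2^P) f2 l2 l3 k Mx test = true) : ∃ G, test G = true ∧ Ap P (Real.log (lucasK k m)) G EG := by
  have hk := hr.1
  have hE4 : 4*W0 ≤ EG := by omega
  unfold cAll at h
  simp only [bA_eq, bO_eq, nble, fz_eq, nsub, nadd, ndiv, nmul] at h
  obtain ⟨t0, t1, t2, t3, t4, t5, h⟩ := h
  by_cases hmk : m ≤ k
  · have hm5 := hr.m_small hmk
    interval_cases m
    · refine ⟨_, t0, hc.h2.congr ?_ (by omega)⟩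
      rw [lucasK_zero]; norm_num
    · refine ⟨_, t1, ?_⟩
      rw [lucasK_one]; simp [Ap]
    · have := (log_lk_small (j := 0) hc hk (by omega)).mono (F := EG) (by omega)
      exact ⟨_, t2, by simpa using this⟩
    · have := (log_lk_small (j := 1) hc hk (by omega)).mono (F := EG) (by omega)
      exact ⟨_, t3, by simpa using this⟩
    · exact ⟨_, t4, (log_lk_small (j := 2) hc hk (by omega)).congr rfl (by omega)⟩
    · exact ⟨_, t5, (log_lk_small (j := 3) hc hk (by omega)).congr rfl (by omega)⟩
  · have h := h.resolve_left (by omega)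
    have hv : Nat.pow 2 (k-2) = 2^(k-2) := rfl
    rw [hv] at h
    have h := ini_spec k hk _ (k-1) 0 _ _ (by omega) (by intro f hf; rw [show k-2 = f by omega]) (by simp) h
    have hLk : lucasK k k = 3*2^(k-2) := by
      rw [← lucasK_small k (k-2) hk (by omega), show k - 2 + 2 = k by omega]
    have hLk1 : lucasK k (k-1) = 3*2^(k-2)/2 := by
      rcases Nat.lt_or_ge 2 k with h3 | h3
      · have := lucasK_small k (k-3) hk (by omega)
        rw [show k - 3 + 2 = k - 1 by omega] at this
        rw [this, show k - 2 = (k-3)+1 by omega, pow_succ]; omega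
      · obtain rfl : k = 2 := by omega
        rw [show 2 - 1 = 1 from rfl, lucasK_one]; norm_num
    have hLD : Ap P (Real.log (lucasK k k) - Real.log (lucasK k (k-1))) (Bool.rec l2 l3 (Nat.beq k 2) : ℕ) W0 := by
      rcases Nat.lt_or_ge 2 k with h3 | h3
      · have hLL : lucasK k k = 2*lucasK k (k-1) := by
          rw [hLk, hLk1, show k - 2 = (k-3)+1 by omega, pow_succ]; omega
        have hb : Nat.beq k 2 = false := by
          rw [← Bool.not_eq_true]; intro hb; have := Nat.eq_of_beq_eq_true hb; omega
        rw [hb]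
        refine hc.h2.congr ?_ le_rfl
        have : (0:ℝ) < lucasK k (k-1) := by exact_mod_cast lucasK_pos k (k-1) hk
        rw [hLL]
        push_cast
        rw [Real.log_mul (by norm_num) this.ne']; ring
      · obtain rfl : k = 2 := by omega
        refine hc.h3.congr ?_ le_rfl
        rw [hLk, show 2 - 1 = 1 from rfl, lucasK_one]; norm_num
    have hG0 := log_lk_small (j := k-2) hc hk (by omega)
    rw [show k - 2 + 2 = k by omega] at hG0
    have hmm : (Mx-k)*(4+6*f2) ≤ Mx*(4+6*f2) := Nat.mul_le_mul_right _ (by omega)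
    have hmm2 : (Mx-k)*(2*W0 + Mx*(4+6*f2)) ≤ Mx*(2*W0 + Mx*(4+6*f2)) := Nat.mul_le_mul_right _ (by omega)
    have hmm3 : (k-2)*W0 ≤ (k+1)*W0 := Nat.mul_le_mul_right _ (by omega)
    refine cwalk_spec P f2 k (2*W0 + Mx*(4+6*f2)) EG hk test _ _ _ _ _ _ _ _ _ W0 (W0 + (k-2)*W0) le_rfl (by omega) ?_ hLk1.symm hLk.symm hG0 ?_ ?_ ?_ ?_ h m (by omega) (by omega) ?_
    · unfold tg
      rw [hLk]; rfl
    · exact hLD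
    · omega
    · omega
    · rw [List.reverse_nil, List.append_nil, Nat.sub_self]; congr 2; omega
    · have := hr.res; omega

/-- The test for the form in `n`, for all values of `m`. -/
noncomputable def xSel (sk : Bool) (l2 l3 l5 l7 Q f2 T k Mx G0 : ℕ) (t : ℕ → Bool) : Bool :=
  Bool.rec (xAll k Mx (xTest sk l2 l3 l5 l7 Q f2 T G0 t)) (cAll Q f2 l2 l3 k Mx fun G => fz (Nat.add G0 G) fun G => all9 sk l2 l3 l5 l7 T G t)
    (Nat.ble k 45)

lemma xSel_spec {sk : Bool} {P T W0 f2 EG G0 l2 l3 l5 l7 k n m d a Mx : ℕ} {t : ℕ → Bool} (hr : RepD k n m d a) (hP : 2 ≤ P) (hc : CK P l2 l3 l5 l7 W0) (hm : m < Mx) (hMx : Mx ≤ 10000)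
    (hE : 60*W0 + Mx*(2*W0 + Mx*(4+6*f2)) ≤ EG) (hE' : 1010*W0 + (6*f2+140) ≤ EG) (h : xSel sk l2 l3 l5 l7 (2^P) f2 T k Mx G0 t = true) :
    ∃ G, all9 sk l2 l3 l5 l7 T (G0+G) t = true ∧ Ap P (Real.log (lucasK k m)) G EG := by
  unfold xSel at h
  cases hb : Nat.ble k 45 with
  | false =>
    rw [hb] at h
    have hX := xAll_spec hr hm hMx h
    unfold xTest at hX
    obtain ⟨G, hX, hG⟩ := logN_spec (lucasK_pos k m hr.1) hP hc hX
    rw [fz_eq] at hX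
    exact ⟨G, hX, hG.mono hE'⟩
  | true =>
    rw [hb] at h
    rw [nble] at hb
    obtain ⟨G, h1, h2⟩ := cAll_spec (EG := EG) hr hc hm hMx (by
      have : (k+1)*W0 ≤ 46*W0 := Nat.mul_le_mul_right _ (by omega)
      omega) h
    rw [fz_eq] at h1
    exact ⟨G, h1, h2⟩

lemma xy_spec {sk : Bool} {q0 p0 q1 p1 P A H T N' W W0 Wg K M' S b1 b2 fuel f2 l2 l3 l5 l7 k Mx u v : ℕ} {e : ℝ}
    (he : IsE k e) (hP : 2 ≤ P) (hc : CK P l2 l3 l5 l7 W0) (hA : Ap P (Real.log (2-e)) A W) (hH : Ap P (Real.log (3*IsE.Cst k e)) H W)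
    (hT : T = l2 + l5) (hW : 2*W0 ≤ W) (hWg : 5*W ≤ Wg) (hWg' : W + 70*W0 + Mx*(2*W0 + Mx*(4+6*f2)) ≤ Wg) (hWx : W + 1020*W0 + (6*f2+140) ≤ Wg)
    (hK : Wg + 1001*W + 120*2^(P-M') ≤ K) (hM : M' ≤ P)
    (hsk : sk = true → k = 2)
    (h : tail sk q0 p0 q1 p1 N' W K S b1 b2 fuel l2 l3 l5 l7 T A H
      (fun H t => fz (Nat.add (Nat.add H l3) T) fun G0 => xSel sk l2 l3 l5 l7 (2^P) f2 T k Mx G0 t) = true)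
    (hu : (u:ℝ)/v ≤ 2-e) (hv : 0 < v) (hvu : v ≤ u) (hMx : v^Mx*2^M' ≤ u^Mx) (hMx' : 12 ≤ Mx ∧ Mx ≤ 10000)
    {n m d a : ℕ} (hr : RepD k n m d a) (hN : n + m ≤ N') : n < Mx := by
  obtain ⟨⟨t, hX, ht⟩, hY⟩ := tail_spec he hc hA hH hT hW hWg hK hM hsk h
  have hm : m < Mx := by
    by_cases h12 : m < 12
    · omega
    · exact he.pow_lt_of hu hv hvu (hY n m d a hr hN (by omega)) hMx
  by_cases hn : n < 10
  · omega
  rw [fz_eq] at hX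
  obtain ⟨G, hX, hG⟩ := xSel_spec (EG := Wg - W - 9*W0) hr hP hc hm hMx'.2 (by omega) (by omega) hX
  have hT' : Ap P (Real.log 10) T (2*W0) := by
    rw [hT]
    exact (hc.h2.add hc.h5).congr log_ten (by omega)
  obtain ⟨G', g1, g2, g3⟩ := all9_spec hc (((hH.add hc.h3).add hT').add hG) hX a hr.2.2.2.1 hr.2.2.2.2.1 (fun h => hr.k2 (hsk h))
  refine he.pow_lt_of hu hv hvu (m := n) (x := M') ?_ hMx
  have hC := he.Cst_lower
  have ha : (0:ℝ) < a := by exact_mod_cast hr.2.2.2.1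
  have hL : (0:ℝ) < lucasK k m := by exact_mod_cast lucasK_pos k m hr.1
  have hp : (0:ℝ) < (2-e)^n := pow_pos (by linarith [he.half]) _
  refine ht G' _ g1 (g3.mono (by omega)) g2 n d _ hp (by omega) ?_
  have hf := he.formX hr (by omega)
  refine le_trans (le_of_eq ?_) (hf.trans (by gcongr; norm_num))
  congr 1
  have hC3 : (0:ℝ) < 3*IsE.Cst k e := by linarith
  rw [show 9 * lucasK k m * IsE.Cst k e / a = (3*IsE.Cst k e)*(3*lucasK k m)/a by ring]
  generalize 3*IsE.Cst k e = C at *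
  rw [Real.log_div (mul_pos hC3 (by linarith)).ne' ha.ne', Real.log_mul hC3.ne' (by linarith), Real.log_mul (by norm_num) hL.ne']
  ring

end

section

/-- The constants of the later reductions. -/
noncomputable def rX0 (P bN wg M' bS e1 e2 : ℕ) (f : ℕ → ℕ → ℕ → ℕ → ℕ → ℕ → ℕ → ℕ → ℕ → ℕ → ℕ → ℕ → Bool) : Bool :=
  fz (Nat.pow 2 (Nat.sub 3600 P)) fun sh => fz (Nat.div cA2 sh) fun l2 => fz (Nat.div (Nat.sub (Nat.mul 2 cA2) cA4) sh) fun l3 =>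
  fz (Nat.div (Nat.add (Nat.mul 2 cA2) cA5) sh) fun l5 => fz (Nat.div (Nat.sub (Nat.mul 3 cA2) cA8) sh) fun l7 =>
  fz (Nat.add l2 l5) fun T => fz (Nat.pow 2 P) fun Q => fz (Nat.pow 2 bN) fun N => fz (Nat.pow 2 20) fun W =>
  fz (Nat.add (Nat.add (Nat.pow 2 wg) (Nat.mul 1001 W)) (Nat.mul 120 (Nat.pow 2 (Nat.sub P M')))) fun K => fz (Nat.pow 2 bS) fun S =>
  fz (Nat.pow 2 e1) fun b1 => fz (Nat.pow 2 e2) fun b2 =>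
  f Q l2 l3 l5 l7 T N W K S b1 b2

/-- The later reductions for `cnt` values of `k`. -/
noncomputable def rX (P bN wg M' bS e1 e2 fuel f2 M3 M4 k0 cnt : ℕ) : Bool :=
  rX0 P bN wg M' bS e1 e2 fun Q l2 l3 l5 l7 T N W K S b1 b2 =>
  allk (fun k => logs Q k fuel l2 l3 fun A H =>
    tail (Nat.beq k 2) 0 1 1 0 N W K S b1 b2 fuel l2 l3 l5 l7 T A H fun H t => fz (Nat.add (Nat.add H l3) T) fun G0 =>
      fz (Bool.rec M4 M3 (Nat.ble k 3)) fun Mx => xSel (Nat.beq k 2) l2 l3 l5 l7 Q f2 T k Mx G0 t) cnt k0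

/-- The second reduction. -/
noncomputable def rB (k0 cnt : ℕ) : Bool := rX 900 410 40 470 535 1000 992 2000 1200 694 519 k0 cnt

/-- The later reductions for all large `k`. -/
noncomputable def rXU (P bN wg M' bS e1 e2 fuel f2 M4 k : ℕ) : Bool :=
  rX0 P bN wg M' bS e1 e2 fun Q l2 l3 l5 l7 T N W K S b1 b2 =>
  bA (Nat.ble (Nat.mul 2 l2) (Nat.mul 2 l3))
  (tail false 0 1 1 0 N W K S b1 b2 fuel l2 l3 l5 l7 T l2 (Nat.sub (Nat.mul 2 l3) (Nat.mul 2 l2)) fun H t => fz (Nat.add (Nat.add H l3) T) fun G0 =>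
      xSel false l2 l3 l5 l7 Q f2 T k M4 G0 t)

/-- The second reduction for all large `k`. -/
noncomputable def rBU : Bool := rXU 900 410 40 470 535 1000 992 2000 1200 519 916

lemma npow (a b : ℕ) : Nat.pow a b = a^b := rfl

lemma ckX {P s : ℕ} (h : P + s = 3600) : CK P (cA2/2^s) ((2*cA2-cA4)/2^s) ((2*cA2+cA5)/2^s) ((3*cA2-cA8)/2^s) 131001 := by
  have := ck3600
  rw [← h] at this
  exact this.shift

lemma IsE.ge158 {k : ℕ} {e : ℝ} (he : IsE k e) (hk : 4 ≤ k) : ((15:ℕ):ℝ)/((8:ℕ):ℝ) ≤ 2 - e := by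
  have h1 := he.upper
  have : ((1:ℝ)/2)^k ≤ (1/2)^4 := pow_le_pow_of_le_one (by norm_num) (by norm_num) hk
  push_cast
  norm_num at this ⊢
  norm_num at h1
  linarith

lemma rX0_spec {P bN wg M' bS e1 e2 : ℕ} (hP : P ≤ 3600) {f : ℕ → ℕ → ℕ → ℕ → ℕ → ℕ → ℕ → ℕ → ℕ → ℕ → ℕ → ℕ → Bool}
    (h : rX0 P bN wg M' bS e1 e2 f = true) : ∃ l2 l3 l5 l7 N W K S b1 b2, CK P l2 l3 l5 l7 131001 ∧ N = 2^bN ∧ W = 2^20 ∧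
      K = 2^wg + 1001*W + 120*2^(P-M') ∧ f (2^P) l2 l3 l5 l7 (l2+l5) N W K S b1 b2 = true := by
  unfold rX0 at h
  simp only [fz_eq] at h
  exact ⟨_, _, _, _, _, _, _, _, _, _, ckX (show P + (3600-P) = 3600 by omega), rfl, rfl, rfl, h⟩

lemma xy_spec2 {sk : Bool} {q0 p0 q1 p1 P A H T N' W W0 Wg K M' S b1 b2 fuel f2 l2 l3 l5 l7 k Mx u v : ℕ} {e : ℝ}
    (he : IsE k e) (hP : 2 ≤ P) (hc : CK P l2 l3 l5 l7 W0) (hA : Ap P (Real.log (2-e)) A W) (hH : Ap P (Real.log (3*IsE.Cst k e)) H W)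
    (hT : T = l2 + l5) (hW : 2*W0 ≤ W) (hWg : 5*W ≤ Wg) (hWg' : W + 70*W0 + Mx*(2*W0 + Mx*(4+6*f2)) ≤ Wg) (hWx : W + 1020*W0 + (6*f2+140) ≤ Wg)
    (hK : Wg + 1001*W + 120*2^(P-M') ≤ K) (hM : M' ≤ P)
    (hsk : sk = true → k = 2)
    (h : tail sk q0 p0 q1 p1 N' W K S b1 b2 fuel l2 l3 l5 l7 T A H
      (fun H t => xSel sk l2 l3 l5 l7 (2^P) f2 T k Mx (H + l3 + T) t) = true)
    (hu : (u:ℝ)/v ≤ 2-e) (hv : 0 < v) (hvu : v ≤ u) (hMx : v^Mx*2^M' ≤ u^Mx) (hMx' : 12 ≤ Mx ∧ Mx ≤ 10000)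
    {n m d a : ℕ} (hr : RepD k n m d a) (hN : n + m ≤ N') : n < Mx := by
  refine xy_spec (q0 := q0) (p0 := p0) (q1 := q1) (p1 := p1) (S := S) (b1 := b1) (b2 := b2) (fuel := fuel) he hP hc hA hH hT hW hWg hWg' hWx hK hM hsk ?_ hu hv hvu hMx hMx' hr hN
  simp only [fz_eq, nadd]
  exact h

lemma rX_spec {P bN wg M' bS e1 e2 fuel f2 M3 M4 k0 cnt : ℕ} (h : rX P bN wg M' bS e1 e2 fuel f2 M3 M4 k0 cnt = true) (hk0 : 2 ≤ k0)
    (hb : k0 + cnt ≤ 1000) (hP : P ≤ 3600) (hP2 : 2 ≤ P) (hM : M' ≤ P) (hfuel : fuel ≤ 2000) (hf2 : f2 ≤ 1200)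
    (hM3 : M3 ≤ 1000) (hM3' : 12 ≤ M3) (hM4 : M4 ≤ M3) (hM4' : 12 ≤ M4) (hwg : 40 ≤ wg)
    (c3 : 5^M3*2^M' ≤ 8^M3) (c4 : 8^M4*2^M' ≤ 15^M4) :
    ∀ k, k0 ≤ k → k < k0 + cnt → ∀ n m d a, RepD k n m d a → n + m ≤ 2^bN → n < M3 ∧ (4 ≤ k → n < M4) := by
  intro k h1 h2 n m d a hr hN
  obtain ⟨e, he⟩ := exists_e k hr.1
  unfold rX at h
  obtain ⟨l2, l3, l5, l7, N, W, K, S, b1, b2, hc, hN', hW, hK, h⟩ := rX0_spec hP h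
  have h := allk_spec _ _ _ h k h1 h2
  obtain ⟨A, H, h, hA, hH⟩ := logs_spec (W := W) he hc (by omega) h
  simp only [fz_eq, nadd] at h
  have hwg' : 2^40 ≤ 2^wg := Nat.pow_le_pow_right (by norm_num) hwg
  have main : ∀ Mx u v : ℕ, (Bool.rec M4 M3 (Nat.ble k 3) : ℕ) = Mx → Mx ≤ 1000 → 12 ≤ Mx → 0 < v → v ≤ u → (u:ℝ)/v ≤ 2-e → v^Mx*2^M' ≤ u^Mx → n < Mx := by
    intro Mx u v e1 e2 e3 hv hvu hu hMx
    rw [e1] at h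
    have g1 : Mx*(4+6*f2) ≤ 1000*7204 := Nat.mul_le_mul e2 (by omega)
    have g2 : Mx*(2*131001 + Mx*(4+6*f2)) ≤ 1000*(2*131001 + 1000*7204) := Nat.mul_le_mul e2 (by omega)
    refine xy_spec2 (Wg := 2^wg) he hP2 hc hA hH rfl (by omega) ?_ ?_ ?_ ?_ hM ?_ h hu hv hvu hMx ⟨e3, by omega⟩ hr (hN'.ge.trans' hN)
    · omega
    · omega
    · omega
    · exact hK.ge
    · intro h; exact Nat.eq_of_beq_eq_true h
  by_cases hk : k ≤ 3
  · refine ⟨main M3 8 5 ?_ hM3 hM3' (by norm_num) (by norm_num) (by push_cast; linarith [he.le25]) c3, by omega⟩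
    have : Nat.ble k 3 = true := nble.2 hk
    rw [this]
  · suffices hlt : n < M4 from ⟨by omega, fun _ => hlt⟩
    refine main M4 15 8 ?_ (by omega) hM4' (by norm_num) (by norm_num) (he.ge158 (by omega)) c4
    have : Nat.ble k 3 = false := by
      rw [← Bool.not_eq_true, nble]; exact hk
    rw [this]

lemma bO_true (x : Bool) : bO true x = true := rfl

lemma xAll_big {k Mx : ℕ} {test : ℕ → Bool} (h : Mx ≤ k) : xAll k Mx test =
    bA (test 2) (bA (test 1) (bA (test 3) (bA (test 6) (bA (test 12) (bA (test 24) true))))) := by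
  have hb : Nat.ble Mx k = true := nble.2 h
  unfold xAll
  rw [hb, bO_true]

lemma bool_rec_false (x y : Bool) : (Bool.rec x y false : Bool) = x := rfl

lemma xSel_big {sk : Bool} {l2 l3 l5 l7 Q f2 T k Mx G0 : ℕ} {t : ℕ → Bool} (hk : 45 < k) (h : Mx ≤ k) :
    xSel sk l2 l3 l5 l7 Q f2 T k Mx G0 t = (fun test : ℕ → Bool =>
    bA (test 2) (bA (test 1) (bA (test 3) (bA (test 6) (bA (test 12) (bA (test 24) true)))))) (xTest sk l2 l3 l5 l7 Q f2 T G0 t) := by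
  have hb : Nat.ble k 45 = false := by
    rw [← Bool.not_eq_true, nble]; omega
  unfold xSel
  rw [hb]
  exact xAll_big h

lemma rXU_spec {P bN wg M' bS e1 e2 fuel f2 M4 k0 : ℕ} (h : rXU P bN wg M' bS e1 e2 fuel f2 M4 k0 = true) (hk0 : P + 16 ≤ k0)
    (hP : P ≤ 3600) (hP2 : 46 ≤ P) (hM : M' ≤ P) (hf2 : f2 ≤ 1200)
    (hM4 : M4 ≤ 1000) (hM4' : 12 ≤ M4) (hMk : M4 ≤ k0) (hwg : 40 ≤ wg) (c4 : 8^M4*2^M' ≤ 15^M4) :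
    ∀ k, k0 ≤ k → ∀ n m d a, RepD k n m d a → n + m ≤ 2^bN → n < M4 := by
  intro k hk n m d a hr hN
  obtain ⟨e, he⟩ := exists_e k hr.1
  unfold rXU at h
  obtain ⟨l2, l3, l5, l7, N, W, K, S, b1, b2, hc, hN', hW, hK, h⟩ := rX0_spec hP h
  simp only [fz_eq, nadd, nmul, nsub, bA_eq, nble] at h
  obtain ⟨hA, hH⟩ := logs_large (W := W) he hc (by omega) (by omega) (by omega) h.1
  have hwg' : 2^40 ≤ 2^wg := Nat.pow_le_pow_right (by norm_num) hwg
  have hx : ∀ (l2 l3 l5 l7 Q T G0 : ℕ) (t : ℕ → Bool), xSel false l2 l3 l5 l7 Q f2 T k0 M4 G0 t =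
      xSel false l2 l3 l5 l7 Q f2 T k M4 G0 t := by
    intro l2 l3 l5 l7 Q T G0 t
    rw [xSel_big (by omega) hMk, xSel_big (by omega) (by omega)]
  simp only [hx] at h
  have g1 : M4*(4+6*f2) ≤ 1000*7204 := Nat.mul_le_mul hM4 (by omega)
  have g2 : M4*(2*131001 + M4*(4+6*f2)) ≤ 1000*(2*131001 + 1000*7204) := Nat.mul_le_mul hM4 (by omega)
  refine xy_spec2 (Wg := 2^wg) (u := 15) (v := 8) he (by omega) hc hA hH rfl (by omega) ?_ ?_ ?_ ?_ hM ?_ h.2 (he.ge158 (by omega)) (by norm_num) (by norm_num) c4 ⟨hM4', by omega⟩ hr (hN'.ge.trans' hN)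
  · omega
  · omega
  · omega
  · exact hK.ge
  · intro h; exact absurd h (by simp)

lemma rBU_spec (h : rBU = true) : ∀ k, 916 ≤ k → ∀ n m d a, RepD k n m d a → n + m ≤ 2^410 → n < 519 :=
  rXU_spec h (by norm_num) (by norm_num) (by norm_num) (by norm_num) (by norm_num) (by norm_num) (by norm_num) (by norm_num) (by norm_num) (by decide +kernel)

def DoneB (k : ℕ) : Prop := ∀ n m d a, RepD k n m d a → n + m ≤ 2^410 → n < 694

def UpB (b : ℕ) : Prop := ∀ k, 2 ≤ k → k < b → DoneB k

lemma UpB.step {b : ℕ} (h : UpB b) (c : ℕ) (hr : rB b c = true) (hb : b + c ≤ 1000 ∧ 2 ≤ b) : UpB (b+c) := by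
  intro k h1 h2
  by_cases hk : k < b
  · exact h k h1 hk
  · intro n m d a hD hN
    refine (rX_spec hr hb.2 hb.1 (by norm_num) (by norm_num) (by norm_num) (by norm_num) (by norm_num) (by norm_num) (by norm_num) (by norm_num) (by norm_num) (by norm_num)
      (by decide +kernel) (by decide +kernel) k (by omega) h2 n m d a hD hN).1

lemma upB_2 : UpB 2 := fun k h1 h2 => by omega

set_option maxRecDepth 10000

lemma rBU_ok : rBU = true := by decide +kernel

end

section

set_option maxRecDepth 10000
set_option maxHeartbeats 4000000

lemma upB_64 : UpB 64 := by
  have h := upB_2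
  have h : UpB 3 := h.step 1 (by decide +kernel) (by norm_num)
  have h : UpB 4 := h.step 1 (by decide +kernel) (by norm_num)
  have h : UpB 5 := h.step 1 (by decide +kernel) (by norm_num)
  have h : UpB 8 := h.step 3 (by decide +kernel) (by norm_num)
  have h : UpB 11 := h.step 3 (by decide +kernel) (by norm_num)
  have h : UpB 14 := h.step 3 (by decide +kernel) (by norm_num)
  have h : UpB 17 := h.step 3 (by decide +kernel) (by norm_num)
  have h : UpB 20 := h.step 3 (by decide +kernel) (by norm_num)
  have h : UpB 23 := h.step 3 (by decide +kernel) (by norm_num)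
  have h : UpB 26 := h.step 3 (by decide +kernel) (by norm_num)
  have h : UpB 29 := h.step 3 (by decide +kernel) (by norm_num)
  have h : UpB 32 := h.step 3 (by decide +kernel) (by norm_num)
  have h : UpB 35 := h.step 3 (by decide +kernel) (by norm_num)
  have h : UpB 38 := h.step 3 (by decide +kernel) (by norm_num)
  have h : UpB 41 := h.step 3 (by decide +kernel) (by norm_num)
  have h : UpB 44 := h.step 3 (by decide +kernel) (by norm_num)
  have h : UpB 46 := h.step 2 (by decide +kernel) (by norm_num)
  have h : UpB 52 := h.step 6 (by decide +kernel) (by norm_num)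
  have h : UpB 58 := h.step 6 (by decide +kernel) (by norm_num)
  have h : UpB 64 := h.step 6 (by decide +kernel) (by norm_num)
  exact h

lemma upB_214 : UpB 214 := by
  have h := upB_64
  have h : UpB 70 := h.step 6 (by decide +kernel) (by norm_num)
  have h : UpB 76 := h.step 6 (by decide +kernel) (by norm_num)
  have h : UpB 82 := h.step 6 (by decide +kernel) (by norm_num)
  have h : UpB 88 := h.step 6 (by decide +kernel) (by norm_num)
  have h : UpB 94 := h.step 6 (by decide +kernel) (by norm_num)
  have h : UpB 100 := h.step 6 (by decide +kernel) (by norm_num)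
  have h : UpB 106 := h.step 6 (by decide +kernel) (by norm_num)
  have h : UpB 112 := h.step 6 (by decide +kernel) (by norm_num)
  have h : UpB 118 := h.step 6 (by decide +kernel) (by norm_num)
  have h : UpB 124 := h.step 6 (by decide +kernel) (by norm_num)
  have h : UpB 130 := h.step 6 (by decide +kernel) (by norm_num)
  have h : UpB 136 := h.step 6 (by decide +kernel) (by norm_num)
  have h : UpB 142 := h.step 6 (by decide +kernel) (by norm_num)
  have h : UpB 148 := h.step 6 (by decide +kernel) (by norm_num)
  have h : UpB 154 := h.step 6 (by decide +kernel) (by norm_num)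
  have h : UpB 166 := h.step 12 (by decide +kernel) (by norm_num)
  have h : UpB 178 := h.step 12 (by decide +kernel) (by norm_num)
  have h : UpB 190 := h.step 12 (by decide +kernel) (by norm_num)
  have h : UpB 202 := h.step 12 (by decide +kernel) (by norm_num)
  have h : UpB 214 := h.step 12 (by decide +kernel) (by norm_num)
  exact h

lemma upB_454 : UpB 454 := by
  have h := upB_214
  have h : UpB 226 := h.step 12 (by decide +kernel) (by norm_num)
  have h : UpB 238 := h.step 12 (by decide +kernel) (by norm_num)
  have h : UpB 250 := h.step 12 (by decide +kernel) (by norm_num)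
  have h : UpB 262 := h.step 12 (by decide +kernel) (by norm_num)
  have h : UpB 274 := h.step 12 (by decide +kernel) (by norm_num)
  have h : UpB 286 := h.step 12 (by decide +kernel) (by norm_num)
  have h : UpB 298 := h.step 12 (by decide +kernel) (by norm_num)
  have h : UpB 310 := h.step 12 (by decide +kernel) (by norm_num)
  have h : UpB 322 := h.step 12 (by decide +kernel) (by norm_num)
  have h : UpB 334 := h.step 12 (by decide +kernel) (by norm_num)
  have h : UpB 346 := h.step 12 (by decide +kernel) (by norm_num)
  have h : UpB 358 := h.step 12 (by decide +kernel) (by norm_num)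
  have h : UpB 370 := h.step 12 (by decide +kernel) (by norm_num)
  have h : UpB 382 := h.step 12 (by decide +kernel) (by norm_num)
  have h : UpB 394 := h.step 12 (by decide +kernel) (by norm_num)
  have h : UpB 406 := h.step 12 (by decide +kernel) (by norm_num)
  have h : UpB 418 := h.step 12 (by decide +kernel) (by norm_num)
  have h : UpB 430 := h.step 12 (by decide +kernel) (by norm_num)
  have h : UpB 442 := h.step 12 (by decide +kernel) (by norm_num)
  have h : UpB 454 := h.step 12 (by decide +kernel) (by norm_num)
  exact h

lemma upB_876 : UpB 876 := by
  have h := upB_454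
  have h : UpB 466 := h.step 12 (by decide +kernel) (by norm_num)
  have h : UpB 478 := h.step 12 (by decide +kernel) (by norm_num)
  have h : UpB 490 := h.step 12 (by decide +kernel) (by norm_num)
  have h : UpB 502 := h.step 12 (by decide +kernel) (by norm_num)
  have h : UpB 514 := h.step 12 (by decide +kernel) (by norm_num)
  have h : UpB 526 := h.step 12 (by decide +kernel) (by norm_num)
  have h : UpB 551 := h.step 25 (by decide +kernel) (by norm_num)
  have h : UpB 576 := h.step 25 (by decide +kernel) (by norm_num)
  have h : UpB 601 := h.step 25 (by decide +kernel) (by norm_num)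
  have h : UpB 626 := h.step 25 (by decide +kernel) (by norm_num)
  have h : UpB 651 := h.step 25 (by decide +kernel) (by norm_num)
  have h : UpB 676 := h.step 25 (by decide +kernel) (by norm_num)
  have h : UpB 701 := h.step 25 (by decide +kernel) (by norm_num)
  have h : UpB 726 := h.step 25 (by decide +kernel) (by norm_num)
  have h : UpB 751 := h.step 25 (by decide +kernel) (by norm_num)
  have h : UpB 776 := h.step 25 (by decide +kernel) (by norm_num)
  have h : UpB 801 := h.step 25 (by decide +kernel) (by norm_num)
  have h : UpB 826 := h.step 25 (by decide +kernel) (by norm_num)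
  have h : UpB 851 := h.step 25 (by decide +kernel) (by norm_num)
  have h : UpB 876 := h.step 25 (by decide +kernel) (by norm_num)
  exact h

lemma upB_916 : UpB 916 := by
  have h := upB_876
  have h : UpB 901 := h.step 25 (by decide +kernel) (by norm_num)
  have h : UpB 916 := h.step 15 (by decide +kernel) (by norm_num)
  exact h


lemma RepD.bound694 {k n m d a : ℕ} (hr : RepD k n m d a) : n < 694 := by
  have h := hr.bound409
  have hmn : m ≤ n := hr.2.1
  have hs : n + m ≤ 2^410 := by
    have : (2:ℕ)^410 = 2*2^409 := by rw [pow_succ]; ring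
    omega
  by_cases hk : k < 916
  · exact upB_916 k hr.1 hk n m d a hr hs
  · have := rBU_spec rBU_ok k (by omega) n m d a hr hs
    omega

lemma RepD.k181 {k n m d a : ℕ} (hr : RepD k n m d a) : k ≤ 181 := by
  have h := hr.k_le 10 (by have := hr.bound694; omega)
  norm_num at h
  exact h

end

section

set_option maxRecDepth 10000

/-- The third reduction. -/
noncomputable def rC (k0 cnt : ℕ) : Bool := rX 120 11 40 51 115 208 201 400 200 76 57 k0 cnt

lemma rC_ok1 : rC 2 28 = true := by decide +kernel

lemma rC_ok2 : rC 30 152 = true := by decide +kernel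

lemma rC_spec {k0 cnt : ℕ} (h : rC k0 cnt = true) (hk0 : 2 ≤ k0) (hb : k0 + cnt ≤ 1000) :
    ∀ k, k0 ≤ k → k < k0 + cnt → ∀ n m d a, RepD k n m d a → n + m ≤ 2^11 → n < 76 ∧ (4 ≤ k → n < 57) :=
  rX_spec h hk0 hb (by norm_num) (by norm_num) (by norm_num) (by norm_num) (by norm_num) (by norm_num) (by norm_num) (by norm_num) (by norm_num) (by norm_num)
      (by decide +kernel) (by decide +kernel)

lemma RepD.bound76 {k n m d a : ℕ} (hr : RepD k n m d a) : n < 76 ∧ (4 ≤ k → n < 57) := by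
  have h1 := hr.bound694
  have h2 := hr.k181
  have hmn : m ≤ n := hr.2.1
  have hk := hr.1
  by_cases hk30 : k < 30
  · exact rC_spec rC_ok1 (by norm_num) (by norm_num) k hk (by omega) n m d a hr (by norm_num; omega)
  · exact rC_spec rC_ok2 (by norm_num) (by norm_num) k (by omega) (by omega) n m d a hr (by norm_num; omega)

end

section

set_option maxRecDepth 10000

/-- Inequality test. -/
noncomputable def nne (a b : ℕ) : Bool := Bool.rec true false (Nat.beq a b)

lemma nne_eq {a b : ℕ} : nne a b = true ↔ a ≠ b := by
  unfold nne
  cases h : Nat.beq a b with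
  | false => simpa using Nat.ne_of_beq_eq_false h
  | true => simpa using Nat.eq_of_beq_eq_true h

/-- A number congruent to `P` is visibly not a repdigit. -/
noncomputable def notRep (P : ℕ) : Bool :=
  fz (Nat.mod P 1000000000) fun P => fz (Nat.mod P 10) fun a => bO (Nat.beq a 0) (bO (nne (Nat.mod P 100) (Nat.mul 11 a))
    (bA (nne P (Nat.mul 11 a)) (bA (nne P (Nat.mul 111 a)) (bA (nne P (Nat.mul 1111 a)) (bA (nne P (Nat.mul 11111 a))
      (nne (Nat.mod P 1000000) (Nat.mul 111111 a)))))))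

lemma notRep_congr {P Q : ℕ} (h : Q % 1000000000 = P % 1000000000) : notRep Q = notRep P := by
  unfold notRep
  rw [nmod, nmod, h]

lemma notRep_spec {P d a : ℕ} (hd : 2 ≤ d) (h1 : 1 ≤ a) (h9 : a ≤ 9) (h : 9*P + a = a*10^d) : notRep P ≠ true := by
  intro hP
  unfold notRep at hP
  simp only [fz_eq, bO_eq, bA_eq, nne_eq, nmul, nmod, Nat.beq_eq] at hP
  by_cases h6 : 6 ≤ d
  · obtain ⟨c, rfl⟩ := Nat.exists_eq_add_of_le h6
    rw [pow_add] at h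
    have : 9*P + a = 1000000*(a*10^c) := by rw [h]; ring
    generalize a*10^c = y at this
    have e : P % 1000000000 % 1000000 = 111111*a := by omega
    have e2 : P % 1000000000 % 10 = a := by omega
    have e3 : P % 1000000000 % 100 = 11*a := by omega
    rw [e, e2, e3] at hP
    omega
  · have : d = 2 ∨ d = 3 ∨ d = 4 ∨ d = 5 := by omega
    have hP2 : ∀ c, (c = 11 ∨ c = 111 ∨ c = 1111 ∨ c = 11111) → P = c*a → False := by
      intro c hc e
      have e1 : P % 1000000000 = c*a := by rcases hc with rfl | rfl | rfl | rfl <;> omega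
      have e2 : c*a % 10 = a := by rcases hc with rfl | rfl | rfl | rfl <;> omega
      have e3 : c*a % 100 = 11*a := by rcases hc with rfl | rfl | rfl | rfl <;> omega
      rw [e1, e2, e3] at hP
      rcases hP with hP | hP | hP
      · omega
      · exact hP rfl
      · rcases hc with rfl | rfl | rfl | rfl
        · exact hP.1 rfl
        · exact hP.2.1 rfl
        · exact hP.2.2.1 rfl
        · exact hP.2.2.2.1 rfl
    rcases this with rfl | rfl | rfl | rfl
    · exact hP2 11 (by simp) (by omega)
    · exact hP2 111 (by simp) (by omega)
    · exact hP2 1111 (by simp) (by omega)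
    · exact hP2 11111 (by simp) (by omega)

/-- Sum of the first elements of a list. -/
noncomputable def sumk (f : ℕ → Bool) (l : List ℕ) : ℕ → ℕ → Bool :=
  List.rec (fun _ s => f s) (fun y _ ih k s => Nat.rec (f s) (fun k' _ => fz (Nat.add s y) fun s => ih k' s) k) l

lemma sumk_spec (f : ℕ → Bool) (l : List ℕ) : ∀ k s, sumk f l k s = f (s + ∑ j ∈ Finset.range k, l.getD j 0) := by
  induction l with
  | nil => intro k s; simp [sumk]
  | cons y l ih =>
    intro k s
    cases k with
    | zero => simp [sumk]
    | succ k =>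
      have : sumk f (y::l) (k+1) s = fz (Nat.add s y) fun s => sumk f l k s := rfl
      rw [this, fz_eq, ih, Finset.sum_range_succ']
      simp only [nadd, List.getD_cons_succ, List.getD_cons_zero]
      congr 1
      ring

noncomputable def allL (f : ℕ → Bool) (l : List ℕ) : Bool := List.rec true (fun y _ ih => bA (f y) ih) l

lemma allL_spec (f : ℕ → Bool) (l : List ℕ) (h : allL f l = true) : ∀ y ∈ l, f y = true := by
  induction l with
  | nil => simp
  | cons z l ih =>
    have e : allL f (z::l) = bA (f z) (allL f l) := rfl
    rw [e, bA_eq] at h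
    intro y hy
    rcases List.mem_cons.1 hy with rfl | hy
    · exact h.1
    · exact ih h.2 y hy

/-- The residues of the sequence in decreasing order of the index. -/
def lst (k : ℕ) : ℕ → List ℕ
  | 0 => []
  | n+1 => lucasK k n % 1000000000 :: lst k n

lemma lst_getD (k n : ℕ) : ∀ j, (lst k n).getD j 0 = (if j < n then lucasK k (n-1-j) else 0) % 1000000000 := by
  induction n with
  | zero => intro j; simp [lst]
  | succ n ih =>
    intro j
    cases j with
    | zero => simp [lst]
    | succ j =>
      simp only [lst, List.getD_cons_succ, ih]
      by_cases h : j < n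
      · rw [if_pos h, if_pos (by omega)]; congr 2; omega
      · rw [if_neg h, if_neg (by omega)]

lemma lst_mem (k n m : ℕ) (h : m < n) : lucasK k m % 1000000000 ∈ lst k n := by
  induction n with
  | zero => omega
  | succ n ih =>
    rw [lst, List.mem_cons]
    by_cases e : m = n
    · left; rw [e]
    · right; exact ih (by omega)

/-- The final enumeration for one `k`. -/
noncomputable def enu (k fuel : ℕ) : List ℕ → ℕ → Bool :=
  Nat.rec (fun _ _ => true) (fun _ ih l n => sumk (fun s => fz (Nat.mod s 1000000000) fun x => bA (bO (Nat.ble n k) (bO (Nat.ble n 5)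
    (allL (fun y => notRep (Nat.mul x y)) (x::l)))) (fz (Nat.succ n) fun n => ih (x::l) n)) l k 0) fuel

lemma enu_spec (k : ℕ) : ∀ fuel n0, 2 ≤ n0 → enu k fuel (lst k n0) n0 = true →
    ∀ n m, n0 ≤ n → n < n0 + fuel → k < n → 5 < n → m ≤ n → notRep (lucasK k n * lucasK k m) = true := by
  intro fuel
  induction fuel with
  | zero => intro n0 _ _ n m _ _; omega
  | succ fuel ih =>
    intro n0 h0 h n m h1 h2 h3 h4 h5
    have e : enu k (fuel+1) (lst k n0) n0 = sumk (fun s => fz (Nat.mod s 1000000000) fun x => bA (bO (Nat.ble n0 k) (bO (Nat.ble n0 5)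
      (allL (fun y => notRep (Nat.mul x y)) (x::lst k n0)))) (fz (Nat.succ n0) fun n => enu k fuel (x::lst k n0) n)) (lst k n0) k 0 := rfl
    have es : (0 + ∑ j ∈ Finset.range k, (lst k n0).getD j 0) % 1000000000 = lucasK k n0 % 1000000000 := by
      obtain ⟨c, rfl⟩ := Nat.exists_eq_add_of_le' h0
      rw [lucasK_rec, zero_add, Finset.sum_nat_mod _ _ (fun j => if j ≤ c + 1 then lucasK k (c + 1 - j) else 0)]
      congr 1
      refine Finset.sum_congr rfl fun j _ => ?_
      rw [lst_getD]
      congr 1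
      by_cases hj : j ≤ c + 1
      · rw [if_pos hj, if_pos (by omega)]; congr 1
      · rw [if_neg hj, if_neg (by omega)]
    rw [e, sumk_spec, fz_eq, nmod, es] at h
    simp only [bA_eq, bO_eq, nble, fz_eq] at h
    obtain ⟨g1, g2⟩ := h
    by_cases hn : n = n0
    · subst hn
      rcases g1 with g | g | g
      · omega
      · omega
      · have := allL_spec _ _ g _ (lst_mem k (n+1) m (by omega))
        rw [← this]
        refine notRep_congr ?_
        rw [nmul]
        exact Nat.mul_mod _ _ _
    · exact ih (n0+1) (by omega) g2 n m (by omega) (by omega) h3 h4 h5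

noncomputable def enuAll (fuel k0 cnt : ℕ) : Bool := allk (fun k => enu k fuel [1, 2] 2) cnt k0

lemma enuAll_spec {fuel k0 cnt : ℕ} (h : enuAll fuel k0 cnt = true) {k n m d a : ℕ} (hr : RepD k n m d a) (h1 : k0 ≤ k) (h2 : k < k0 + cnt)
    (hn : n < 2 + fuel) : n ≤ 5 := by
  have h := allk_spec _ _ _ h k h1 h2
  have hgt := hr.n_gt
  obtain ⟨hk, hmn, hd, ha1, ha9, hr⟩ := hr
  by_contra hc
  have e : lst k 2 = [1, 2] := by simp [lst, lucasK_zero, lucasK_one]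
  refine notRep_spec hd ha1 ha9 hr (enu_spec k fuel 2 le_rfl ?_ n m (by omega) (by omega) hgt (by omega) hmn)
  rw [e]
  exact h

lemma enuAll_1 : enuAll 74 2 2 = true := by decide +kernel
lemma enuAll_2 : enuAll 55 4 16 = true := by decide +kernel
lemma enuAll_3 : enuAll 55 20 36 = true := by decide +kernel

lemma RepD.n_le5 {k n m d a : ℕ} (hr : RepD k n m d a) : n ≤ 5 := by
  have hn := hr.bound76
  have hgt := hr.n_gt
  have hk := hr.1
  by_cases k1 : k < 4
  · exact enuAll_spec enuAll_1 hr (by omega) (by omega) (by omega)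
  by_cases k2 : k < 20
  · exact enuAll_spec enuAll_2 hr (by omega) (by omega) (by omega)
  · exact enuAll_spec enuAll_3 hr (by omega) (by omega) (by omega)

lemma final_small {k n m : ℕ} (hk : 2 ≤ k) (hmn : m ≤ n) (hkn : k < n) (hn : n ≤ 5)
    (h : notRep (lucasK k n * lucasK k m) ≠ true) :
    (k, n, m, lucasK k n * lucasK k m) ∈
      ({(2, 5, 0, 22), (2, 5, 1, 11), (2, 5, 2, 33), (2, 5, 3, 44), (2, 5, 4, 77),
        (4, 5, 0, 44), (4, 5, 1, 22), (4, 5, 2, 66)} : Set (ℕ × ℕ × ℕ × ℕ)) := by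
  have e0 := lucasK_zero k
  have e1 := lucasK_one k
  have e2 := lucasK_rec k 0
  have e3 := lucasK_rec k 1
  have e4 := lucasK_rec k 2
  have e5 := lucasK_rec k 3
  have hk4 : k ≤ 4 := by omega
  interval_cases k <;> simp [Finset.sum_range_succ, e0, e1] at e2 <;> simp [Finset.sum_range_succ, e0, e1, e2] at e3 <;>
    simp [Finset.sum_range_succ, e0, e1, e2, e3] at e4 <;> simp [Finset.sum_range_succ, e0, e1, e2, e3, e4] at e5 <;>
    interval_cases n <;> interval_cases m <;> simp only [e0, e1, e2, e3, e4, e5] at h ⊢ <;>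
    first
    | exact absurd (by decide +kernel) h
    | simp

end

theorem products_of_two_k_lucas_repdigits
    (k n m : ℕ) (hk : 2 ≤ k) (hnm : m ≤ n)
    (hrep : ∃ d, 2 ≤ d ∧ ∃ a, 1 ≤ a ∧ a ≤ 9 ∧
      lucasK k n * lucasK k m = a * ((10 ^ d - 1) / 9)) :
    (k, n, m, lucasK k n * lucasK k m) ∈
      ({(2,5,0,22), (2,5,1,11), (2,5,2,33), (2,5,3,44), (2,5,4,77),
        (4,5,0,44), (4,5,1,22), (4,5,2,66)} : Set (ℕ × ℕ × ℕ × ℕ)) := by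
  obtain ⟨d, hd, a, h1, h9, h⟩ := hrep
  have hr := rep_of k n m d a hk hnm hd h1 h9 h
  exact final_small hk hnm hr.n_gt hr.n_le5 (notRep_spec hd h1 h9 hr.2.2.2.2.2)
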